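/- arXiv:2110.06551 — 6 statements merged into one kernel-verified Lean document; each statement's English description precedes it below -/
import Mathlib

section
/- Suppose there are at least three agents (I ≥ 3) and A is finite. A social choice correspondence F is implementable in mixed-strategy Nash equilibria by a finite mechanism if and only if F satisfies Maskin monotonicity. -/
/-!
STATEMENT 7 (Theorem 2): Suppose there are at least three agents (I ≥ 3) and A is finite.
A social choice correspondence F is implementable in mixed-strategy Nash equilibria by a
finite mechanism if and only if F satisfies Maskin monotonicity.
-/

open scoped BigOperators Classical

noncomputable section

/-- Lotteries on a finite set `A`. -/
abbrev Lot (A : Type) [Fintype A] : Type := ↥(stdSimplex ℝ A)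

/-- The outcome space `X = Δ(A) × ℝ^I`. -/
abbrev OutcS (A : Type) [Fintype A] (I : ℕ) : Type := Lot A × (Fin I → ℝ)

variable {A Θ : Type} {I : ℕ}

/-- Agent `i`'s quasilinear utility `ũ_i(x,θ) = v_i(ℓ,θ) + t_i`. -/
def uS [Fintype A] (w : Fin I → A → Θ → ℝ) (i : Fin I) (x : OutcS A I) (θ : Θ) : ℝ :=
  (∑ a, (x.1 : A → ℝ) a * w i a θ) + x.2 i

/-- Maskin monotonicity of an SCC `F`. -/
def MaskinMonotoneSCC [Fintype A] (w : Fin I → A → Θ → ℝ) (F : Θ → Set (OutcS A I)) : Prop :=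
  ∀ θ' θ : Θ, ∀ y ∈ F θ', y ∉ F θ →
    ∃ (i : Fin I) (x : OutcS A I),
      uS w i x θ' ≤ uS w i y θ' ∧ uS w i y θ < uS w i x θ

/-- A finite mechanism whose outcome function assigns to each message profile a
(finitely supported) lottery over outcomes in `X`. -/
structure FinMechC (A : Type) [Fintype A] (I : ℕ) where
  M : Fin I → Type
  fintypeM : ∀ i, Fintype (M i)
  nonemptyM : ∀ i, Nonempty (M i)
  g : (∀ i, M i) → (OutcS A I →₀ ℝ)
  gProb : ∀ m, (∀ x, 0 ≤ g m x) ∧ ((g m).sum fun _ p => p) = 1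
  τ : Fin I → (∀ i, M i) → ℝ

attribute [instance] FinMechC.fintypeM FinMechC.nonemptyM

/-- Agent `i`'s (expected) payoff in `Γ(𝓜,θ)`. -/
def payoffC [Fintype A] (w : Fin I → A → Θ → ℝ) (𝓜 : FinMechC A I) (θ : Θ) (i : Fin I)
    (m : ∀ j, 𝓜.M j) : ℝ :=
  ((𝓜.g m).sum fun x p => p * uS w i x θ) + 𝓜.τ i m

/-- A mixed-strategy profile. -/
def IsMixedProfileC [Fintype A] (𝓜 : FinMechC A I) (σ : ∀ i, 𝓜.M i → ℝ) : Prop :=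
  ∀ i, (∀ mi, 0 ≤ σ i mi) ∧ (∑ mi, σ i mi) = 1

/-- Expected payoff to agent `i` from the pure message `mi` against `σ_{-i}`. -/
def expPayC [Fintype A] (w : Fin I → A → Θ → ℝ) (𝓜 : FinMechC A I) (θ : Θ)
    (σ : ∀ i, 𝓜.M i → ℝ) (i : Fin I) (mi : 𝓜.M i) : ℝ :=
  ∑ m : ∀ j, 𝓜.M j,
    (∏ j ∈ Finset.univ.erase i, σ j (m j)) * (if m i = mi then payoffC w 𝓜 θ i m else 0)

/-- Mixed-strategy Nash equilibrium of `Γ(𝓜,θ)`. -/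
def IsNEC [Fintype A] (w : Fin I → A → Θ → ℝ) (𝓜 : FinMechC A I) (θ : Θ)
    (σ : ∀ i, 𝓜.M i → ℝ) : Prop :=
  IsMixedProfileC 𝓜 σ ∧
    ∀ (i : Fin I) (mi : 𝓜.M i), 0 < σ i mi → ∀ mi' : 𝓜.M i,
      expPayC w 𝓜 θ σ i mi' ≤ expPayC w 𝓜 θ σ i mi

/-- Pure-strategy Nash equilibrium of `Γ(𝓜,θ)`. -/
def IsPureNEC [Fintype A] (w : Fin I → A → Θ → ℝ) (𝓜 : FinMechC A I) (θ : Θ)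
    (m : ∀ j, 𝓜.M j) : Prop :=
  ∀ (i : Fin I) (mi' : 𝓜.M i),
    payoffC w 𝓜 θ i (Function.update m i mi') ≤ payoffC w 𝓜 θ i m

/-- `m` is played with positive probability under some mixed-strategy Nash equilibrium. -/
def InSuppNEC [Fintype A] (w : Fin I → A → Θ → ℝ) (𝓜 : FinMechC A I) (θ : Θ)
    (m : ∀ j, 𝓜.M j) : Prop :=
  ∃ σ, IsNEC w 𝓜 θ σ ∧ 0 < ∏ i, σ i (m i)

/-- Implementability of an SCC in mixed-strategy Nash equilibria by a finite mechanism
(Definition 4 of the paper). -/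
def NashImplementableSCC [Fintype A] (w : Fin I → A → Θ → ℝ)
    (F : Θ → Set (OutcS A I)) : Prop :=
  ∃ 𝓜 : FinMechC A I, ∀ θ : Θ,
    (∀ x ∈ F θ, ∃ m, IsPureNEC w 𝓜 θ m ∧ 𝓜.g m = Finsupp.single x 1 ∧ ∀ i, 𝓜.τ i m = 0) ∧
    (∀ m, InSuppNEC w 𝓜 θ m → ↑(𝓜.g m).support ⊆ F θ ∧ ∀ i, 𝓜.τ i m = 0)

/-! ### Equilibria and weak dominance on supports -/

/-- No strategy in `S i` is weakly dominated against the profiles drawn from `S`: if `b` does at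
least as well as `p i` against all of them, then it does no better against `p`. -/
def IsUndominatedOn {N : Fin I → Type} (pay : Fin I → (∀ j, N j) → ℝ)
    (S : ∀ j, Set (N j)) : Prop :=
  ∀ (i : Fin I) (p : ∀ j, N j), (∀ j, p j ∈ S j) → ∀ b : N i,
    (∀ q : ∀ j, N j, (∀ j, q j ∈ S j) → q i = p i → pay i q ≤ pay i (Function.update q i b)) →
      pay i (Function.update p i b) ≤ pay i p

theorem expPayC_eq_sum_update [Fintype A] (w : Fin I → A → Θ → ℝ) (𝓜 : FinMechC A I) (θ : Θ)
    (σ : ∀ i, 𝓜.M i → ℝ) (i : Fin I) (b c : 𝓜.M i) :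
    expPayC w 𝓜 θ σ i b = ∑ m : ∀ j, 𝓜.M j with m i = c,
      (∏ j ∈ Finset.univ.erase i, σ j (m j)) * payoffC w 𝓜 θ i (Function.update m i b) := by
  have h : expPayC w 𝓜 θ σ i b = ∑ m : ∀ j, 𝓜.M j with m i = b,
      (∏ j ∈ Finset.univ.erase i, σ j (m j)) * payoffC w 𝓜 θ i m := by
    unfold expPayC
    rw [Finset.sum_filter]
    exact Finset.sum_congr rfl fun m _ => by split_ifs <;> simp
  rw [h]
  refine Finset.sum_nbij' (fun m => Function.update m i c) (fun m => Function.update m i b)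
    (fun m _ => by simp) (fun m _ => by simp) ?_ ?_ ?_
  · intro m hm
    have hb : m i = b := by simpa using hm
    simp [← hb]
  · intro m hm
    have hb : m i = c := by simpa using hm
    simp [← hb]
  · intro m hm
    have hb : m i = b := by simpa using hm
    have hprod : ∏ j ∈ Finset.univ.erase i, σ j (Function.update m i c j)
        = ∏ j ∈ Finset.univ.erase i, σ j (m j) :=
      Finset.prod_congr rfl fun j hj => by
        rw [Function.update_of_ne (Finset.ne_of_mem_erase hj)]
    rw [hprod]
    simp [← hb]

theorem IsNEC.isUndominatedOn_support [Fintype A] {w : Fin I → A → Θ → ℝ} {𝓜 : FinMechC A I}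
    {θ : Θ} {σ : ∀ i, 𝓜.M i → ℝ} (h : IsNEC w 𝓜 θ σ) :
    IsUndominatedOn (payoffC w 𝓜 θ) fun j => {b | 0 < σ j b} := by
  intro i p hp b hb
  by_contra! hlt
  have hσ : ∀ j c, 0 ≤ σ j c := fun j => (h.1 j).1
  have hle := h.2 i (p i) (hp i) b
  rw [expPayC_eq_sum_update w 𝓜 θ σ i b (p i),
    expPayC_eq_sum_update w 𝓜 θ σ i (p i) (p i)] at hle
  refine absurd hle (not_le.mpr (Finset.sum_lt_sum ?_ ⟨p, by simp, ?_⟩))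
  · intro m hm
    have hmi : m i = p i := by simpa using hm
    rw [← hmi, Function.update_eq_self]
    by_cases hpos : ∀ j ∈ Finset.univ.erase i, 0 < σ j (m j)
    · refine mul_le_mul_of_nonneg_left (hb m (fun j => ?_) hmi)
        (Finset.prod_nonneg fun j _ => hσ j _)
      by_cases hj : j = i
      · subst hj
        rw [hmi]
        exact hp j
      · exact hpos j (by simp [hj])
    · push Not at hpos
      obtain ⟨j, hj, hj0⟩ := hpos
      rw [Finset.prod_eq_zero hj (le_antisymm hj0 (hσ j _))]
      simp
  · rw [Function.update_eq_self]
    exact mul_lt_mul_of_pos_left hlt (Finset.prod_pos fun j _ => hp j)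

theorem IsPureNEC.inSuppNEC [Fintype A] {w : Fin I → A → Θ → ℝ} {𝓜 : FinMechC A I}
    {θ : Θ} {m : ∀ j, 𝓜.M j} (h : IsPureNEC w 𝓜 θ m) : InSuppNEC w 𝓜 θ m := by
  have key : ∀ (i : Fin I) (b : 𝓜.M i),
      expPayC w 𝓜 θ (fun j c => if c = m j then 1 else 0) i b
        = payoffC w 𝓜 θ i (Function.update m i b) := by
    intro i b
    rw [expPayC_eq_sum_update w 𝓜 θ _ i b (m i), Finset.sum_eq_single m]
    · simp
    · intro q hq hne
      have hqi : q i = m i := by simpa using hq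
      obtain ⟨j, hj⟩ := Function.ne_iff.mp hne
      have hji : j ≠ i := by
        rintro rfl
        exact hj hqi
      rw [Finset.prod_eq_zero (i := j) (by simp [hji]) (by simp [hj]), zero_mul]
    · simp
  refine ⟨fun j c => if c = m j then 1 else 0, ⟨fun i => ⟨fun c => ?_, by simp⟩, ?_⟩, by simp⟩
  · dsimp only
    split_ifs <;> norm_num
  · intro i b hb b'
    have hbm : b = m i := by
      by_contra hne
      simp [hne] at hb
    rw [key, key, hbm, Function.update_eq_self]
    exact h i b'

/-! ### Necessity of Maskin monotonicity -/

/-- A lottery over outcomes together with a payment is worth the same to an agent, in every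
state, as some outcome. -/
theorem exists_outcome_uS_eq [Fintype A] (w : Fin I → A → Θ → ℝ) (i : Fin I)
    (p : OutcS A I →₀ ℝ) (hp : (∀ x, 0 ≤ p x) ∧ (p.sum fun _ q => q) = 1) (r : ℝ) :
    ∃ x : OutcS A I, ∀ θ, uS w i x θ = (p.sum fun y q => q * uS w i y θ) + r := by
  have hsum : ∑ y ∈ p.support, p y = 1 := hp.2
  obtain ⟨ℓ, hℓ⟩ : ∃ ℓ : Lot A, (ℓ : A → ℝ) = ∑ y ∈ p.support, p y • (y.1 : A → ℝ) :=
    ⟨⟨_, (convex_stdSimplex ℝ A).sum_mem (fun y _ => hp.1 y) hsum fun y _ => y.1.2⟩, rfl⟩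
  refine ⟨(ℓ, fun _ => (∑ y ∈ p.support, p y * y.2 i) + r), fun θ => ?_⟩
  simp only [uS, hℓ, Finsupp.sum, mul_add, Finset.sum_add_distrib, Finset.sum_apply,
    Pi.smul_apply, smul_eq_mul, Finset.sum_mul, Finset.mul_sum]
  rw [Finset.sum_comm, add_assoc]
  simp only [mul_assoc]

theorem NashImplementableSCC.maskinMonotone [Fintype A] {w : Fin I → A → Θ → ℝ}
    {F : Θ → Set (OutcS A I)} (h : NashImplementableSCC w F) : MaskinMonotoneSCC w F := by
  obtain ⟨𝓜, h𝓜⟩ := h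
  intro θ' θ y hy hyn
  obtain ⟨m, hm, hg, hτ⟩ := (h𝓜 θ').1 y hy
  have hpay : ∀ i θ, payoffC w 𝓜 θ i m = uS w i y θ := fun i θ => by
    simp [payoffC, hg, hτ]
  have hnot : ¬ IsPureNEC w 𝓜 θ m := fun hne => hyn <| by
    refine ((h𝓜 θ).2 m hne.inSuppNEC).1 ?_
    simp [hg]
  simp only [IsPureNEC, not_forall, not_le] at hnot
  obtain ⟨i, b, hb⟩ := hnot
  obtain ⟨x, hx⟩ := exists_outcome_uS_eq w i _ (𝓜.gProb (Function.update m i b))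
    (𝓜.τ i (Function.update m i b))
  have hx' : ∀ θ, uS w i x θ = payoffC w 𝓜 θ i (Function.update m i b) := hx
  refine ⟨i, x, ?_, ?_⟩
  · rw [hx', ← hpay]
    exact hm i b
  · rw [hx', ← hpay]
    exact hb

/-! ### The game of state announcements

In this game agent `i` sends a pair `(a, s)`: a report `a` of a state with her own type, and an
announcement `s` of the state. The function `Z` sends a state to the profile of types. -/

/-- All agents announce the same type profile. -/
def Consensus {T : Type*} (Z : Θ → Fin I → T) (n : Fin I → Θ × Θ) : Prop :=
  ∀ i j, Z (n i).2 = Z (n j).2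

/-- The announcements disagree or some agent challenges them. -/
def Triggered {T : Type*} (Z : Θ → Fin I → T) (Ch : Fin I → Θ → Θ → Prop)
    (n : Fin I → Θ × Θ) : Prop :=
  ¬ Consensus Z n ∨ ∃ i, Ch i (n i).2 (n i).1

/-- The payments that reward announcements in line with the reports of the other agents, and
fine announcements of one's own type that differ from those of the other agents. -/
def stateTransfer {T : Type*} (Z : Θ → Fin I → T) (η₁ η₂ : ℝ) (l : Fin I)
    (n : Fin I → Θ × Θ) : ℝ :=
  η₁ * ∑ k ∈ Finset.univ.erase l, ((if Z (n l).2 k = Z (n k).1 k then (1 : ℝ) else 0)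
      - if Z (n k).2 k = Z (n k).1 k then 1 else 0)
    - η₂ * ∑ j ∈ Finset.univ.erase l, if Z (n j).2 l = Z (n l).2 l then (0 : ℝ) else 1

/-- What is required, at the true state `θ`, of the payoffs `E` from the outcomes of the game of
state announcements, where `Ch i s a` means that the report `a` of agent `i` challenges `s`. -/
structure IsTruthInducing {T : Type*} (Z : Θ → Fin I → T) (θ : Θ)
    (E : Fin I → (Fin I → Θ × Θ) → ℝ) (Ch : Fin I → Θ → Θ → Prop) (G : ℝ) : Prop where
  abs_payoff_le : ∀ i n, |E i n| ≤ G
  challenge_state : ∀ i s s' a, Z s = Z s' → Ch i s a → Ch i s' a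
  challenge_report : ∀ i s a a', Z a i = Z a' i → Ch i s a → Ch i s a'
  not_challenge : ∀ i s a, Z s i = Z a i → ¬ Ch i s a
  le_truth : ∀ i n, Z (n i).1 i ≠ Z θ i → E i n ≤ E i (Function.update n i (θ, (n i).2))
  lt_truth : ∀ i n, Z (n i).1 i ≠ Z θ i →
    (Triggered Z Ch n ∨ Consensus Z n ∧ Ch i (n i).2 θ) →
      E i n < E i (Function.update n i (θ, (n i).2))
  eq_of_not_triggered : ∀ i n n', ¬ Triggered Z Ch n → ¬ Triggered Z Ch n' →
    (∀ j, Z (n j).2 = Z (n' j).2) → E i n = E i n'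

section Announcements

variable {T : Type*} {Z : Θ → Fin I → T}

theorem stateTransfer_eq_zero {n : Fin I → Θ × Θ} (h : Consensus Z n) (η₁ η₂ : ℝ) (l : Fin I) :
    stateTransfer Z η₁ η₂ l n = 0 := by
  unfold stateTransfer
  rw [Finset.sum_eq_zero, Finset.sum_eq_zero]
  · simp
  · intro j _
    rw [h j l]
    simp
  · intro k _
    rw [h l k]
    simp

theorem stateTransfer_update (η₁ η₂ : ℝ) (l : Fin I) (n : Fin I → Θ × Θ) (b : Θ × Θ) :
    stateTransfer Z η₁ η₂ l (Function.update n l b) =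
      η₁ * ∑ k ∈ Finset.univ.erase l, ((if Z b.2 k = Z (n k).1 k then (1 : ℝ) else 0)
        - if Z (n k).2 k = Z (n k).1 k then 1 else 0)
      - η₂ * ∑ j ∈ Finset.univ.erase l, if Z (n j).2 l = Z b.2 l then (0 : ℝ) else 1 := by
  unfold stateTransfer
  congr 2 <;> refine Finset.sum_congr rfl fun k hk => ?_ <;>
    simp [Function.update_of_ne (Finset.ne_of_mem_erase hk)]

theorem stateTransfer_update_report (η₁ η₂ : ℝ) (l : Fin I) (n : Fin I → Θ × Θ) (a : Θ) :
    stateTransfer Z η₁ η₂ l (Function.update n l (a, (n l).2)) = stateTransfer Z η₁ η₂ l n := by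
  rw [stateTransfer_update]
  rfl

/-- Announcing a state whose types are reported by the others earns at least `η₁` if one's
announcement has a wrong type. -/
theorem stateTransfer_add_le_of_ne {η₁ η₂ : ℝ} (h₁ : 0 ≤ η₁) (h₂ : 0 ≤ η₂) {l k : Fin I}
    (hkl : k ≠ l) {n : Fin I → Θ × Θ} {t : Θ} (ht : ∀ j, j ≠ l → Z (n j).1 j = Z t j)
    (hk : Z (n l).2 k ≠ Z t k) (a : Θ) :
    stateTransfer Z η₁ η₂ l n + η₁ ≤
      stateTransfer Z η₁ η₂ l (Function.update n l (a, t)) + η₂ * I := by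
  have hA : (∑ j ∈ Finset.univ.erase l, ((if Z (n l).2 j = Z (n j).1 j then (1 : ℝ) else 0)
        - if Z (n j).2 j = Z (n j).1 j then 1 else 0)) + 1 ≤
      ∑ j ∈ Finset.univ.erase l, ((if Z t j = Z (n j).1 j then (1 : ℝ) else 0)
        - if Z (n j).2 j = Z (n j).1 j then 1 else 0) := by
    have hmem : k ∈ Finset.univ.erase l := by simp [hkl]
    rw [← Finset.add_sum_erase _ _ hmem, ← Finset.add_sum_erase _ _ hmem]
    have hle : ∑ j ∈ (Finset.univ.erase l).erase k,
          ((if Z (n l).2 j = Z (n j).1 j then (1 : ℝ) else 0)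
            - if Z (n j).2 j = Z (n j).1 j then 1 else 0) ≤
        ∑ j ∈ (Finset.univ.erase l).erase k, ((if Z t j = Z (n j).1 j then (1 : ℝ) else 0)
            - if Z (n j).2 j = Z (n j).1 j then 1 else 0) := by
      refine Finset.sum_le_sum fun j hj => sub_le_sub_right ?_ _
      rw [if_pos (ht j (Finset.ne_of_mem_erase (Finset.mem_of_mem_erase hj))).symm]
      split_ifs <;> norm_num
    rw [if_neg (by rwa [ht k hkl]), if_pos (ht k hkl).symm]
    linarith
  have hB : ∑ j ∈ Finset.univ.erase l, (if Z (n j).2 l = Z t l then (0 : ℝ) else 1) ≤ I := by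
    calc ∑ j ∈ Finset.univ.erase l, (if Z (n j).2 l = Z t l then (0 : ℝ) else 1)
        ≤ ∑ j ∈ Finset.univ.erase l, (1 : ℝ) :=
          Finset.sum_le_sum fun j _ => by split_ifs <;> norm_num
      _ ≤ ∑ j : Fin I, (1 : ℝ) :=
          Finset.sum_le_sum_of_subset_of_nonneg (Finset.erase_subset _ _) fun _ _ _ => by norm_num
      _ = I := by simp
  have hC : 0 ≤ ∑ j ∈ Finset.univ.erase l, (if Z (n j).2 l = Z (n l).2 l then (0 : ℝ) else 1) :=
    Finset.sum_nonneg fun j _ => by split_ifs <;> norm_num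
  rw [stateTransfer_update]
  unfold stateTransfer
  have e1 := mul_le_mul_of_nonneg_left hA h₁
  have e2 := mul_le_mul_of_nonneg_left hB h₂
  have e3 := mul_nonneg h₂ hC
  dsimp only
  linarith

/-- Conforming to the announcements of the others about one's own type, by announcing a state
whose other types are reported, saves at least `η₂`. -/
theorem stateTransfer_add_le_of_own_ne {η₁ η₂ : ℝ} (h₁ : 0 ≤ η₁) (h₂ : 0 ≤ η₂) {l k : Fin I}
    (hkl : k ≠ l) {n : Fin I → Θ × Θ} {t : Θ} (ht : ∀ j, j ≠ l → Z (n j).1 j = Z t j)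
    (hs : ∀ j, j ≠ l → Z (n j).2 l = Z t l) (hl : Z (n l).2 l ≠ Z t l) (a : Θ) :
    stateTransfer Z η₁ η₂ l n + η₂ ≤ stateTransfer Z η₁ η₂ l (Function.update n l (a, t)) := by
  have hA : ∑ j ∈ Finset.univ.erase l, ((if Z (n l).2 j = Z (n j).1 j then (1 : ℝ) else 0)
        - if Z (n j).2 j = Z (n j).1 j then 1 else 0) ≤
      ∑ j ∈ Finset.univ.erase l, ((if Z t j = Z (n j).1 j then (1 : ℝ) else 0)
        - if Z (n j).2 j = Z (n j).1 j then 1 else 0) := by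
    refine Finset.sum_le_sum fun j hj => sub_le_sub_right ?_ _
    rw [if_pos (ht j (Finset.ne_of_mem_erase hj)).symm]
    split_ifs <;> norm_num
  have hB : ∑ j ∈ Finset.univ.erase l, (if Z (n j).2 l = Z t l then (0 : ℝ) else 1) = 0 :=
    Finset.sum_eq_zero fun j hj => if_pos (hs j (Finset.ne_of_mem_erase hj))
  have hC : 1 ≤ ∑ j ∈ Finset.univ.erase l, (if Z (n j).2 l = Z (n l).2 l then (0 : ℝ) else 1) := by
    calc (1 : ℝ) = if Z (n k).2 l = Z (n l).2 l then (0 : ℝ) else 1 := by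
          rw [if_neg]
          rw [hs k hkl]
          exact hl.symm
      _ ≤ _ := Finset.single_le_sum
          (f := fun j => if Z (n j).2 l = Z (n l).2 l then (0 : ℝ) else 1)
          (fun j _ => by split_ifs <;> norm_num) (by simp [hkl])
  rw [stateTransfer_update]
  unfold stateTransfer
  dsimp only
  rw [hB]
  have e1 := mul_le_mul_of_nonneg_left hA h₁
  have e3 := mul_le_mul_of_nonneg_left hC h₂
  linarith

variable {θ : Θ} {E : Fin I → (Fin I → Θ × Θ) → ℝ} {Ch : Fin I → Θ → Θ → Prop} {G η₁ η₂ : ℝ}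
  {S : Fin I → Set (Θ × Θ)}

/-- A report in the support of an equilibrium is truthful if it matters. -/
theorem IsTruthInducing.report_eq (hE : IsTruthInducing Z θ E Ch G)
    (hS : IsUndominatedOn (N := fun _ => Θ × Θ)
      (fun i n => E i n + stateTransfer Z η₁ η₂ i n) S)
    {n : Fin I → Θ × Θ} (hn : ∀ j, n j ∈ S j) (i : Fin I)
    (h : Triggered Z Ch n ∨ Consensus Z n ∧ Ch i (n i).2 θ) : Z (n i).1 i = Z θ i := by
  by_contra hne
  have hle := hS i n hn (θ, (n i).2) fun q _ hqi => by
    dsimp only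
    rw [← hqi, stateTransfer_update_report]
    have := hE.le_truth i q (by rwa [hqi])
    linarith
  dsimp only at hle
  rw [stateTransfer_update_report] at hle
  have := hE.lt_truth i n hne h
  linarith

theorem IsTruthInducing.announce_other_eq (hE : IsTruthInducing Z θ E Ch G)
    (hη₂ : 0 ≤ η₂) (hη₁ : 2 * G + η₂ * I < η₁)
    (hS : IsUndominatedOn (N := fun _ => Θ × Θ)
      (fun i n => E i n + stateTransfer Z η₁ η₂ i n) S) {l : Fin I}
    (htrue : ∀ q : Fin I → Θ × Θ, (∀ j, q j ∈ S j) → ∀ k, k ≠ l → Z (q k).1 k = Z θ k)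
    {n : Fin I → Θ × Θ} (hn : ∀ j, n j ∈ S j) {k : Fin I} (hk : k ≠ l) :
    Z (n l).2 k = Z θ k := by
  by_contra hne
  have hG : 0 ≤ G := (abs_nonneg _).trans (hE.abs_payoff_le l n)
  have hη₁0 : 0 ≤ η₁ := by
    have : 0 ≤ η₂ * I := mul_nonneg hη₂ (Nat.cast_nonneg _)
    linarith
  have hlt : ∀ q : Fin I → Θ × Θ, (∀ j, q j ∈ S j) → q l = n l →
      E l q + stateTransfer Z η₁ η₂ l q <
        E l (Function.update q l (θ, θ)) +
          stateTransfer Z η₁ η₂ l (Function.update q l (θ, θ)) := by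
    intro q hq hql
    have h1 := stateTransfer_add_le_of_ne hη₁0 hη₂ hk (htrue q hq) (by rwa [hql]) θ
    have h2 := abs_le.mp (hE.abs_payoff_le l q)
    have h3 := abs_le.mp (hE.abs_payoff_le l (Function.update q l (θ, θ)))
    linarith [h2.2, h3.1]
  exact absurd (hS l n hn (θ, θ) fun q hq hql => (hlt q hq hql).le) (not_le.mpr (hlt n hn rfl))

theorem IsTruthInducing.announce_own_eq (hE : IsTruthInducing Z θ E Ch G)
    (hη₁ : 0 ≤ η₁) (hη₂ : 2 * G < η₂)
    (hS : IsUndominatedOn (N := fun _ => Θ × Θ)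
      (fun i n => E i n + stateTransfer Z η₁ η₂ i n) S) {l k : Fin I} (hkl : k ≠ l)
    (htrue : ∀ q : Fin I → Θ × Θ, (∀ j, q j ∈ S j) → ∀ k, k ≠ l → Z (q k).1 k = Z θ k)
    {t : Θ} (ht : ∀ j, j ≠ l → Z t j = Z θ j)
    (hs : ∀ q : Fin I → Θ × Θ, (∀ j, q j ∈ S j) → ∀ j, j ≠ l → Z (q j).2 l = Z t l)
    {n : Fin I → Θ × Θ} (hn : ∀ j, n j ∈ S j) : Z (n l).2 l = Z t l := by
  by_contra hne
  have hG : 0 ≤ G := (abs_nonneg _).trans (hE.abs_payoff_le l n)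
  have hlt : ∀ q : Fin I → Θ × Θ, (∀ j, q j ∈ S j) → q l = n l →
      E l q + stateTransfer Z η₁ η₂ l q <
        E l (Function.update q l (t, t)) +
          stateTransfer Z η₁ η₂ l (Function.update q l (t, t)) := by
    intro q hq hql
    have h1 := stateTransfer_add_le_of_own_ne hη₁ (by linarith) hkl
      (fun j hj => (htrue q hq j hj).trans (ht j hj).symm) (hs q hq) (by rwa [hql]) t
    have h2 := abs_le.mp (hE.abs_payoff_le l q)
    have h3 := abs_le.mp (hE.abs_payoff_le l (Function.update q l (t, t)))
    linarith [h2.2, h3.1]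
  exact absurd (hS l n hn (t, t) fun q hq hql => (hlt q hq hql).le) (not_le.mpr (hlt n hn rfl))

/-- If some profile in the support of an equilibrium is triggered, then all reports in the
support are truthful. -/
theorem IsTruthInducing.report_eq_of_exists_triggered (hE : IsTruthInducing Z θ E Ch G)
    (hI : 2 ≤ I) (hη₂ : 2 * G < η₂) (hη₁ : 2 * G + η₂ * I < η₁)
    (hS : IsUndominatedOn (N := fun _ => Θ × Θ)
      (fun i n => E i n + stateTransfer Z η₁ η₂ i n) S)
    {p : Fin I → Θ × Θ} (hp : ∀ j, p j ∈ S j) (hT : Triggered Z Ch p)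
    {n : Fin I → Θ × Θ} (hn : ∀ j, n j ∈ S j) (i : Fin I) : Z (n i).1 i = Z θ i := by
  by_contra hne
  have hG : 0 ≤ G := (abs_nonneg _).trans (hE.abs_payoff_le i n)
  have hη₂0 : 0 ≤ η₂ := by linarith
  have hη₁0 : 0 ≤ η₁ := by
    have : 0 ≤ η₂ * I := mul_nonneg hη₂0 (Nat.cast_nonneg _)
    linarith
  have hupd : ∀ q : Fin I → Θ × Θ, (∀ j, q j ∈ S j) → ∀ b ∈ S i, ∀ j,
      Function.update q i b j ∈ S j := by
    intro q hq b hb j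
    by_cases hj : j = i
    · subst hj
      simpa using hb
    · simpa [hj] using hq j
  have hnoT : ∀ q : Fin I → Θ × Θ, (∀ j, q j ∈ S j) →
      ¬ Triggered Z Ch (Function.update q i (n i)) := by
    intro q hq hqT
    have := hE.report_eq hS (hupd q hq _ (hn i)) i (Or.inl hqT)
    rw [Function.update_self] at this
    exact hne this
  have hothers : ∀ q : Fin I → Θ × Θ, (∀ j, q j ∈ S j) → ∀ j, j ≠ i →
      Z (q j).2 = Z (n i).2 := by
    intro q hq j hj
    have hcons := not_not.mp fun h => hnoT q hq (Or.inl h)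
    have := hcons j i
    rwa [Function.update_of_ne hj, Function.update_self] at this
  obtain ⟨k, hk⟩ : ∃ k : Fin I, k ≠ i := by
    have : Nontrivial (Fin I) := Fin.nontrivial_iff_two_le.mpr hI
    exact exists_ne i
  have hown : ∀ q : Fin I → Θ × Θ, (∀ j, q j ∈ S j) → Z (q i).2 = Z (n i).2 := by
    intro q hq
    by_contra hqi
    have htrue : ∀ r : Fin I → Θ × Θ, (∀ j, r j ∈ S j) → ∀ j, j ≠ i →
        Z (r j).1 j = Z θ j := by
      intro r hr j hj
      have hrT : Triggered Z Ch (Function.update r i (q i)) := by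
        left
        intro hcons
        have := hcons i k
        rw [Function.update_self, Function.update_of_ne hk, hothers r hr k hk] at this
        exact hqi this
      have := hE.report_eq hS (hupd r hr _ (hq i)) j (Or.inl hrT)
      rwa [Function.update_of_ne hj] at this
    have hni : ∀ j, j ≠ i → Z (n i).2 j = Z θ j := fun j hj =>
      hE.announce_other_eq hη₂0 hη₁ hS htrue hn hj
    refine hqi (funext fun j => ?_)
    by_cases hj : j = i
    · subst hj
      exact hE.announce_own_eq hη₁0 hη₂ hS hk htrue hni
        (fun r hr j hj => by rw [hothers r hr j hj]) hq
    · rw [hni j hj]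
      exact hE.announce_other_eq hη₂0 hη₁ hS htrue hq hj
  have hall : ∀ q : Fin I → Θ × Θ, (∀ j, q j ∈ S j) → ∀ j, Z (q j).2 = Z (n i).2 := by
    intro q hq j
    by_cases hj : j = i
    · rw [hj]
      exact hown q hq
    · exact hothers q hq j hj
  have hcons : ∀ q : Fin I → Θ × Θ, (∀ j, q j ∈ S j) → Consensus Z q := fun q hq j j' => by
    rw [hall q hq j, hall q hq j']
  obtain ⟨j, hj⟩ := hT.resolve_left fun h => h (hcons p hp)
  by_cases hji : j = i
  · subst hji
    have h1 := hE.report_eq hS hp j (Or.inl (Or.inr ⟨j, hj⟩))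
    have h2 := hE.challenge_report j _ _ _ h1 hj
    have h3 := hE.challenge_state j _ _ _ (hall p hp j) h2
    exact hne (hE.report_eq hS hn j (Or.inr ⟨hcons n hn, h3⟩))
  · exact hnoT p hp (Or.inr ⟨j, by rwa [Function.update_of_ne hji]⟩)

theorem IsTruthInducing.not_triggered (hE : IsTruthInducing Z θ E Ch G)
    (hI : 2 ≤ I) (hη₂ : 2 * G < η₂) (hη₁ : 2 * G + η₂ * I < η₁)
    (hS : IsUndominatedOn (N := fun _ => Θ × Θ)
      (fun i n => E i n + stateTransfer Z η₁ η₂ i n) S)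
    {n : Fin I → Θ × Θ} (hn : ∀ j, n j ∈ S j) : ¬ Triggered Z Ch n := by
  intro hT
  have hI0 : 0 < I := by omega
  have hG : 0 ≤ G := (abs_nonneg _).trans (hE.abs_payoff_le ⟨0, hI0⟩ n)
  have hη₂0 : 0 ≤ η₂ := by linarith
  have hη₁0 : 0 ≤ η₁ := by
    have : 0 ≤ η₂ * I := mul_nonneg hη₂0 (Nat.cast_nonneg _)
    linarith
  have htrue : ∀ q : Fin I → Θ × Θ, (∀ j, q j ∈ S j) → ∀ i, Z (q i).1 i = Z θ i :=
    fun q hq i => hE.report_eq_of_exists_triggered hI hη₂ hη₁ hS hn hT hq i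
  have hother : ∀ q : Fin I → Θ × Θ, (∀ j, q j ∈ S j) → ∀ l k, k ≠ l → Z (q l).2 k = Z θ k :=
    fun q hq l k hk => hE.announce_other_eq hη₂0 hη₁ hS (fun r hr j _ => htrue r hr j) hq hk
  have hstate : ∀ l, Z (n l).2 = Z θ := by
    intro l
    funext k
    by_cases hk : k = l
    · subst hk
      obtain ⟨k', hk'⟩ : ∃ k' : Fin I, k' ≠ k := by
        have : Nontrivial (Fin I) := Fin.nontrivial_iff_two_le.mpr hI
        exact exists_ne k
      exact hE.announce_own_eq hη₁0 hη₂ hS hk' (fun r hr j _ => htrue r hr j)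
        (fun _ _ => rfl) (fun r hr j hj => hother r hr j k hj.symm) hn
    · exact hother n hn l k hk
  rcases hT with h | ⟨i, hi⟩
  · exact h fun i j => by rw [hstate i, hstate j]
  · exact hE.not_challenge i _ _ (by rw [hstate i, htrue n hn i]) hi

/-- In the support of an equilibrium the announcements agree, and no agent can challenge them
truthfully. -/
theorem IsTruthInducing.consensus_and_not_challenge (hE : IsTruthInducing Z θ E Ch G)
    (hI : 2 ≤ I) (hη₂ : 2 * G < η₂) (hη₁ : 2 * G + η₂ * I < η₁)
    (hS : IsUndominatedOn (N := fun _ => Θ × Θ)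
      (fun i n => E i n + stateTransfer Z η₁ η₂ i n) S)
    {n : Fin I → Θ × Θ} (hn : ∀ j, n j ∈ S j) :
    Consensus Z n ∧ ∀ i, ¬ Ch i (n i).2 (n i).1 ∧ ¬ Ch i (n i).2 θ := by
  have hT := hE.not_triggered hI hη₂ hη₁ hS hn
  simp only [Triggered, not_or, not_not, not_exists] at hT
  refine ⟨hT.1, fun i => ⟨hT.2 i, fun hi => hT.2 i ?_⟩⟩
  exact hE.challenge_report i _ _ _ (hE.report_eq hS hn i (Or.inr ⟨hT.1, hi⟩)).symm hi

/-- Truth-telling is an equilibrium. -/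
theorem IsTruthInducing.update_truth_le (hE : IsTruthInducing Z θ E Ch G)
    (hI : 2 ≤ I) (hη₂ : 2 * G < η₂) (hη₁ : 2 * G + η₂ * I < η₁) (l : Fin I) (b : Θ × Θ) :
    E l (Function.update (fun _ => (θ, θ)) l b)
        + stateTransfer Z η₁ η₂ l (Function.update (fun _ => (θ, θ)) l b) ≤
      E l (fun _ => (θ, θ)) + stateTransfer Z η₁ η₂ l (fun _ => (θ, θ)) := by
  obtain ⟨a, s⟩ := b
  set n : Fin I → Θ × Θ := Function.update (fun _ => (θ, θ)) l (a, s) with hn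
  have hG : 0 ≤ G := (abs_nonneg _).trans (hE.abs_payoff_le l n)
  have hη₂0 : 0 ≤ η₂ := by linarith
  have hη₁0 : 0 ≤ η₁ := by
    have : 0 ≤ η₂ * I := mul_nonneg hη₂0 (Nat.cast_nonneg _)
    linarith
  have hnl : n l = (a, s) := by simp [hn]
  have hnj : ∀ j, j ≠ l → n j = (θ, θ) := fun j hj => by simp [hn, hj]
  have hback : Function.update n l (θ, θ) = fun _ => (θ, θ) := by
    rw [hn, Function.update_idem]
    exact Function.update_eq_self l (fun _ => (θ, θ))
  have hnoT : ∀ q : Fin I → Θ × Θ, (∀ j, Z (q j).2 = Z θ) → (∀ j, Z (q j).1 j = Z θ j) →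
      ¬ Triggered Z Ch q := by
    rintro q hs ha (h | ⟨j, hj⟩)
    · exact h fun i j => by rw [hs, hs]
    · exact hE.not_challenge j _ _ (by rw [hs, ha]) hj
  have b1 := abs_le.mp (hE.abs_payoff_le l n)
  have b2 := abs_le.mp (hE.abs_payoff_le l fun _ => (θ, θ))
  by_cases hs : Z s = Z θ
  · have hns : ∀ j, Z (n j).2 = Z θ := by
      intro j
      by_cases hj : j = l
      · rw [hj, hnl]
        exact hs
      · rw [hnj j hj]
    rw [stateTransfer_eq_zero fun i j => by rw [hns, hns], stateTransfer_eq_zero fun _ _ => rfl,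
      add_zero, add_zero]
    by_cases ha : Z a l = Z θ l
    · refine (hE.eq_of_not_triggered l n _ (hnoT n hns fun j => ?_)
        (hnoT _ (fun _ => rfl) fun _ => rfl) hns).le
      by_cases hj : j = l
      · rw [hj, hnl]
        exact ha
      · rw [hnj j hj]
    · refine (hE.le_truth l n (by rwa [hnl])).trans (le_of_eq ?_)
      have hmem : ∀ j, Z (Function.update n l (θ, (n l).2) j).2 = Z θ := by
        intro j
        by_cases hj : j = l
        · subst hj
          simpa using hns j
        · simpa [hj] using hns j
      refine hE.eq_of_not_triggered l _ _ (hnoT _ hmem fun j => ?_)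
        (hnoT _ (fun _ => rfl) fun _ => rfl) hmem
      by_cases hj : j = l
      · subst hj
        simp
      · rw [Function.update_of_ne hj, hnj j hj]
  · by_cases hk : ∃ k, k ≠ l ∧ Z s k ≠ Z θ k
    · obtain ⟨k, hkl, hk⟩ := hk
      have := stateTransfer_add_le_of_ne (n := n) hη₁0 hη₂0 hkl
        (fun j hj => by rw [hnj j hj]) (by rwa [hnl]) θ
      rw [hback] at this
      linarith [b1.2, b2.1]
    · push Not at hk
      have hl : Z s l ≠ Z θ l := fun hl => hs <| funext fun k => by
        by_cases hkl : k = l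
        · rw [hkl, hl]
        · exact hk k hkl
      obtain ⟨k, hkl⟩ : ∃ k : Fin I, k ≠ l := by
        have : Nontrivial (Fin I) := Fin.nontrivial_iff_two_le.mpr hI
        exact exists_ne l
      have := stateTransfer_add_le_of_own_ne (n := n) hη₁0 hη₂0 hkl
        (fun j hj => by rw [hnj j hj]) (fun j hj => by rw [hnj j hj]) (by rwa [hnl]) θ
      rw [hback] at this
      linarith [b1.2, b2.1]

end Announcements

/-! ### Types, reversals, and the lotteries used against false announcements -/

/-- The type of agent `i` at a state: her utility over alternatives, centred at zero. -/
def prefType [Fintype A] (w : Fin I → A → Θ → ℝ) (i : Fin I) (θ : Θ) : A → ℝ :=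
  fun a => w i a θ - (∑ b, w i b θ) / Fintype.card A

theorem uS_eq_prefType [Fintype A] (w : Fin I → A → Θ → ℝ) (i : Fin I) (x : OutcS A I) (θ : Θ) :
    uS w i x θ = (∑ a, (x.1 : A → ℝ) a * prefType w i θ a) + x.2 i
      + (∑ b, w i b θ) / Fintype.card A := by
  have hx : ∑ a, (x.1 : A → ℝ) a = 1 := x.1.2.2
  simp only [uS, prefType, mul_sub, Finset.sum_sub_distrib, ← Finset.sum_mul, hx]
  ring

theorem uS_sub_eq_of_prefType_eq [Fintype A] {w : Fin I → A → Θ → ℝ} {i : Fin I} {θ θ' : Θ}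
    (h : prefType w i θ = prefType w i θ') (x y : OutcS A I) :
    uS w i x θ - uS w i y θ = uS w i x θ' - uS w i y θ' := by
  simp only [uS_eq_prefType, h]
  ring

theorem sum_prefType [Fintype A] [Nonempty A] (w : Fin I → A → Θ → ℝ) (i : Fin I) (θ : Θ) :
    ∑ a, prefType w i θ a = 0 := by
  have : (Fintype.card A : ℝ) ≠ 0 := Nat.cast_ne_zero.mpr Fintype.card_ne_zero
  simp only [prefType, Finset.sum_sub_distrib, Finset.sum_const, Finset.card_univ, nsmul_eq_mul]
  field_simp
  ring

/-- Some outcome is no better than `y` for agent `i` at `θ'` but better at `θ`. -/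
def Reversal [Fintype A] (w : Fin I → A → Θ → ℝ) (i : Fin I) (θ' : Θ) (y : OutcS A I)
    (θ : Θ) : Prop :=
  ∃ x, uS w i x θ' ≤ uS w i y θ' ∧ uS w i y θ < uS w i x θ

theorem Reversal.congr_right [Fintype A] {w : Fin I → A → Θ → ℝ} {i : Fin I} {θ' θ₁ θ₂ : Θ}
    {y : OutcS A I} (h : prefType w i θ₁ = prefType w i θ₂) (hr : Reversal w i θ' y θ₁) :
    Reversal w i θ' y θ₂ := by
  obtain ⟨x, h1, h2⟩ := hr
  have := uS_sub_eq_of_prefType_eq h x y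
  exact ⟨x, h1, by linarith⟩

theorem not_reversal_of_prefType_eq [Fintype A] {w : Fin I → A → Θ → ℝ} {i : Fin I} {θ' θ : Θ}
    (h : prefType w i θ' = prefType w i θ) (y : OutcS A I) : ¬ Reversal w i θ' y θ := by
  rintro ⟨x, h1, h2⟩
  have := uS_sub_eq_of_prefType_eq h x y
  linarith

theorem MaskinMonotoneSCC.subset_of_prefType_eq [Fintype A] {w : Fin I → A → Θ → ℝ}
    {F : Θ → Set (OutcS A I)} (hF : MaskinMonotoneSCC w F) {θ' θ : Θ}
    (h : ∀ i, prefType w i θ' = prefType w i θ) : F θ' ⊆ F θ := by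
  intro y hy
  by_contra hyn
  obtain ⟨i, hr⟩ := hF θ' θ y hy hyn
  exact not_reversal_of_prefType_eq (h i) y hr

/-- A strictly proper quadratic scoring rule for all agents at once, with arbitrarily low
payoffs. -/
theorem exists_scoring [Fintype Θ] [Fintype A] [Nonempty A] (w : Fin I → A → Θ → ℝ) (b : ℝ) :
    ∃ D : (Fin I → Θ) → OutcS A I,
      (∀ i θ a, prefType w i (a i) ≠ prefType w i θ →
        uS w i (D a) θ < uS w i (D (Function.update a i θ)) θ) ∧
      ∀ i θ a, uS w i (D a) θ < b := by
  have hcard : (0 : ℝ) < 1 / Fintype.card A := by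
    have : (0 : ℝ) < Fintype.card A := Nat.cast_pos.mpr Fintype.card_pos
    positivity
  have hev : ∀ᶠ κ : ℝ in nhdsWithin 0 (Set.Ioi 0), ∀ (a : Fin I → Θ) (c : A),
      0 < 1 / (Fintype.card A : ℝ) + κ * ∑ k, prefType w k (a k) c := by
    refine Filter.Eventually.filter_mono nhdsWithin_le_nhds ?_
    refine Filter.eventually_all.mpr fun a => Filter.eventually_all.mpr fun c => ?_
    have hcont : Continuous fun κ : ℝ =>
        1 / (Fintype.card A : ℝ) + κ * ∑ k, prefType w k (a k) c := by fun_prop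
    exact hcont.continuousAt.eventually (lt_mem_nhds (by simpa using hcard))
  obtain ⟨κ, hκ, hκ0⟩ := (hev.and self_mem_nhdsWithin).exists
  have hκ0 : 0 < κ := hκ0
  obtain ⟨ℓ, hℓ⟩ : ∃ ℓ : (Fin I → Θ) → Lot A, ∀ a c,
      (ℓ a : A → ℝ) c = 1 / (Fintype.card A : ℝ) + κ * ∑ k, prefType w k (a k) c := by
    refine ⟨fun a => ⟨_, fun c => (hκ a c).le, ?_⟩, fun a c => rfl⟩
    have hcard0 : (Fintype.card A : ℝ) ≠ 0 := Nat.cast_ne_zero.mpr Fintype.card_ne_zero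
    rw [Finset.sum_add_distrib, ← Finset.mul_sum, Finset.sum_comm]
    simp [sum_prefType, hcard0]
  set t : (Fin I → Θ) → Fin I → ℝ := fun a i => -(κ / 2) * ∑ c, prefType w i (a i) c ^ 2 with ht
  obtain ⟨K, hK⟩ := Finite.exists_le
    fun p : Fin I × Θ × (Fin I → Θ) => uS w p.1 (ℓ p.2.2, t p.2.2) p.2.1
  have hD : ∀ i θ a, uS w i (ℓ a, fun j => t a j - (K - b + 1)) θ
      = uS w i (ℓ a, t a) θ - (K - b + 1) := fun i θ a => by
    simp only [uS]
    ring
  refine ⟨fun a => (ℓ a, fun j => t a j - (K - b + 1)), fun i θ a hne => ?_, fun i θ a => ?_⟩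
  · rw [hD, hD]
    refine sub_lt_sub_right ?_ _
    rw [uS_eq_prefType, uS_eq_prefType]
    refine add_lt_add_left ?_ _
    have hpos : 0 < ∑ c, (prefType w i (a i) c - prefType w i θ c) ^ 2 := by
      obtain ⟨c, hc⟩ := Function.ne_iff.mp hne
      exact Finset.sum_pos' (fun c _ => sq_nonneg _)
        ⟨c, Finset.mem_univ _, by have := sub_ne_zero.mpr hc; positivity⟩
    have hdiff : ∀ c, (ℓ (Function.update a i θ) : A → ℝ) c - (ℓ a : A → ℝ) c
        = κ * (prefType w i θ c - prefType w i (a i) c) := by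
      intro c
      rw [hℓ, hℓ, ← Finset.add_sum_erase _ _ (Finset.mem_univ i),
        ← Finset.add_sum_erase _ (fun k => prefType w k (a k) c) (Finset.mem_univ i),
        Finset.sum_congr rfl fun k hk => by
          rw [Function.update_of_ne (Finset.ne_of_mem_erase hk)]]
      rw [Function.update_self]
      ring
    have key : ((∑ c, (ℓ (Function.update a i θ) : A → ℝ) c * prefType w i θ c)
          + t (Function.update a i θ) i)
        - ((∑ c, (ℓ a : A → ℝ) c * prefType w i θ c) + t a i)
        = κ / 2 * ∑ c, (prefType w i (a i) c - prefType w i θ c) ^ 2 := by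
      simp only [ht, Function.update_self]
      rw [add_sub_add_comm, ← Finset.sum_sub_distrib, Finset.mul_sum, Finset.mul_sum,
        Finset.mul_sum, ← Finset.sum_sub_distrib, ← Finset.sum_add_distrib]
      refine Finset.sum_congr rfl fun c _ => ?_
      rw [← sub_mul, hdiff]
      ring
    have := mul_pos (half_pos hκ0) hpos
    dsimp only
    linarith
  · rw [hD]
    have := hK (i, θ, a)
    dsimp only at this
    linarith

/-- Each type with a reversal has a best challenge among finitely many. -/
theorem exists_best_challenge [Fintype Θ] [Fintype A] (w : Fin I → A → Θ → ℝ) :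
    ∃ B : Fin I → Θ → OutcS A I → Θ → OutcS A I, ∀ i θ' y a, Reversal w i θ' y a →
      uS w i (B i θ' y a) θ' ≤ uS w i y θ' ∧ uS w i y a < uS w i (B i θ' y a) a ∧
      ∀ θ, Reversal w i θ' y θ → uS w i (B i θ' y a) θ ≤ uS w i (B i θ' y θ) θ := by
  choose x hx using fun (i : Fin I) (θ' : Θ) (y : OutcS A I)
    (a : {a // Reversal w i θ' y a}) => a.2
  have hmax : ∀ i θ' y (a : {a // Reversal w i θ' y a}), ∃ a₀ : {a // Reversal w i θ' y a},
      ∀ c, uS w i (x i θ' y c) a ≤ uS w i (x i θ' y a₀) a := fun i θ' y a => by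
    have : Nonempty {a // Reversal w i θ' y a} := ⟨a⟩
    exact Finite.exists_max fun c => uS w i (x i θ' y c) a
  choose best hbest using hmax
  refine ⟨fun i θ' y a => if h : Reversal w i θ' y a then x i θ' y (best i θ' y ⟨a, h⟩) else y,
    fun i θ' y a ha => ⟨?_, ?_, fun θ hθ => ?_⟩⟩
  · dsimp only
    rw [dif_pos ha]
    exact (hx i θ' y _).1
  · dsimp only
    rw [dif_pos ha]
    exact (hx i θ' y ⟨a, ha⟩).2.trans_le (hbest i θ' y ⟨a, ha⟩ ⟨a, ha⟩)
  · dsimp only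
    rw [dif_pos ha, dif_pos hθ]
    exact hbest i θ' y ⟨θ, hθ⟩ _

/-- The expected utility of a lottery over outcomes. -/
def expUtil [Fintype A] (w : Fin I → A → Θ → ℝ) (i : Fin I) (θ : Θ) :
    (OutcS A I →₀ ℝ) →ₗ[ℝ] ℝ :=
  Finsupp.linearCombination ℝ fun x => uS w i x θ

theorem expUtil_single [Fintype A] (w : Fin I → A → Θ → ℝ) (i : Fin I) (θ : Θ) (x : OutcS A I) :
    expUtil w i θ (Finsupp.single x 1) = uS w i x θ := by
  simp [expUtil]

/-- `D` is a scoring rule, `B` the best challenges and `ε` a small probability such that a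
challenge to an outcome in `Y`, resolved by `D` with probability `ε` and by `B` otherwise, is
profitable at the states with a reversal. -/
structure IsChallengeScheme [Fintype A] (w : Fin I → A → Θ → ℝ) (Y : Set (OutcS A I))
    (D : (Fin I → Θ) → OutcS A I) (B : Fin I → Θ → OutcS A I → Θ → OutcS A I) (ε : ℝ) : Prop where
  pos : 0 < ε
  lt_one : ε < 1
  scoring_lt : ∀ i θ a, prefType w i (a i) ≠ prefType w i θ →
    uS w i (D a) θ < uS w i (D (Function.update a i θ)) θ
  scoring_low : ∀ i θ a, ∀ y ∈ Y, uS w i (D a) θ < uS w i y θ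
  challenge_le : ∀ i θ' y a, Reversal w i θ' y a → uS w i (B i θ' y a) θ' ≤ uS w i y θ'
  challenge_best : ∀ i θ' y a θ, Reversal w i θ' y a → Reversal w i θ' y θ →
    uS w i (B i θ' y a) θ ≤ uS w i (B i θ' y θ) θ
  profitable : ∀ i θ' θ a, ∀ y ∈ Y, Reversal w i θ' y θ →
    uS w i y θ < (1 - ε) * uS w i (B i θ' y θ) θ + ε * uS w i (D a) θ

theorem exists_isChallengeScheme [Fintype Θ] [Fintype A] [Nonempty A] (w : Fin I → A → Θ → ℝ)
    {Y : Set (OutcS A I)} (hY : Y.Finite) :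
    ∃ D B ε, IsChallengeScheme w Y D B ε := by
  have : Finite Y := hY
  obtain ⟨b, hb⟩ := Finite.exists_le fun p : Fin I × Θ × Y => - uS w p.1 p.2.2 p.2.1
  obtain ⟨D, hD, hDb⟩ := exists_scoring w (-b)
  obtain ⟨B, hB⟩ := exists_best_challenge w
  have hev : ∀ᶠ ε : ℝ in nhdsWithin 0 (Set.Ioi 0), ∀ (i : Fin I) (θ' θ : Θ) (a : Fin I → Θ)
      (y : Y), Reversal w i θ' y θ →
        uS w i y θ < (1 - ε) * uS w i (B i θ' y θ) θ + ε * uS w i (D a) θ := by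
    refine Filter.Eventually.filter_mono nhdsWithin_le_nhds ?_
    refine Filter.eventually_all.mpr fun i => Filter.eventually_all.mpr fun θ' =>
      Filter.eventually_all.mpr fun θ => Filter.eventually_all.mpr fun a =>
      Filter.eventually_all.mpr fun y => ?_
    by_cases hr : Reversal w i θ' y θ
    · have hcont : Continuous fun ε : ℝ =>
          (1 - ε) * uS w i (B i θ' y θ) θ + ε * uS w i (D a) θ := by fun_prop
      filter_upwards [hcont.continuousAt.eventually (lt_mem_nhds
        (show uS w i y θ < (1 - 0) * uS w i (B i θ' y θ) θ + 0 * uS w i (D a) θ by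
          simpa using (hB i θ' y θ hr).2.1))] with ε hε _ using hε
    · exact Filter.Eventually.of_forall fun ε h => absurd h hr
  have hlt : ∀ᶠ ε : ℝ in nhdsWithin 0 (Set.Ioi 0), ε < 1 :=
    Filter.Eventually.filter_mono nhdsWithin_le_nhds (gt_mem_nhds one_pos)
  obtain ⟨ε, ⟨hε, hε1⟩, hε0⟩ := ((hev.and hlt).and self_mem_nhdsWithin).exists
  refine ⟨D, B, ε, hε0, hε1, hD, fun i θ a y hy => ?_, fun i θ' y a h => (hB i θ' y a h).1,
    fun i θ' y a θ ha hθ => (hB i θ' y a ha).2.2 θ hθ, fun i θ' θ a y hy => hε i θ' θ a ⟨y, hy⟩⟩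
  have h1 := hb (i, θ, ⟨y, hy⟩)
  have h2 := hDb i θ a
  dsimp only at h1
  linarith

/-- The lottery after the unanimous announcement of `θ'` with outcome `y`: an agent is
drawn uniformly and, if her report has a reversal, her best challenge or, with probability `ε`,
the scoring rule replaces `y`. -/
def challengeLottery [Fintype A] (w : Fin I → A → Θ → ℝ) (D : (Fin I → Θ) → OutcS A I)
    (B : Fin I → Θ → OutcS A I → Θ → OutcS A I) (ε : ℝ) (θ' : Θ) (y : OutcS A I)
    (a : Fin I → Θ) : OutcS A I →₀ ℝ :=
  ∑ i, (1 / (I : ℝ)) • if Reversal w i θ' y (a i) then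
    (1 - ε) • Finsupp.single (B i θ' y (a i)) 1 + ε • Finsupp.single (D a) 1
  else Finsupp.single y 1

section ChallengeLottery

variable [Fintype A] {w : Fin I → A → Θ → ℝ} {Y : Set (OutcS A I)} {D : (Fin I → Θ) → OutcS A I}
  {B : Fin I → Θ → OutcS A I → Θ → OutcS A I} {ε : ℝ} {θ' θ : Θ} {y : OutcS A I} {a : Fin I → Θ}

theorem challengeLottery_eq_single (hI : I ≠ 0) (h : ∀ i, ¬ Reversal w i θ' y (a i)) :
    challengeLottery w D B ε θ' y a = Finsupp.single y 1 := by
  have hI' : (I : ℝ) ≠ 0 := Nat.cast_ne_zero.mpr hI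
  simp [challengeLottery, h, hI']

theorem challengeLottery_prob (hI : I ≠ 0) (hε0 : 0 ≤ ε) (hε1 : ε ≤ 1) :
    (∀ x, 0 ≤ challengeLottery w D B ε θ' y a x) ∧
      ((challengeLottery w D B ε θ' y a).sum fun _ q => q) = 1 := by
  have hsingle : ∀ z x : OutcS A I, 0 ≤ (Finsupp.single z (1 : ℝ)) x := fun z x => by
    rw [Finsupp.single_apply]
    split_ifs <;> norm_num
  constructor
  · intro x
    rw [challengeLottery, Finsupp.finsetSum_apply]
    refine Finset.sum_nonneg fun i _ => ?_
    rw [Finsupp.smul_apply, smul_eq_mul]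
    refine mul_nonneg (by positivity) ?_
    split_ifs
    · simp only [Finsupp.add_apply, Finsupp.smul_apply, smul_eq_mul]
      exact add_nonneg (mul_nonneg (by linarith) (hsingle _ _)) (mul_nonneg hε0 (hsingle _ _))
    · exact hsingle _ _
  · have hI' : (I : ℝ) ≠ 0 := Nat.cast_ne_zero.mpr hI
    have hsum : ∀ p : OutcS A I →₀ ℝ,
        (p.sum fun _ q => q) = Finsupp.linearCombination ℝ (fun _ => (1 : ℝ)) p := fun p => by
      simp [Finsupp.linearCombination_apply]
    rw [hsum, challengeLottery, map_sum]
    have hterm : ∀ i, Finsupp.linearCombination ℝ (fun _ => (1 : ℝ))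
        ((1 / (I : ℝ)) • if Reversal w i θ' y (a i) then
          (1 - ε) • Finsupp.single (B i θ' y (a i)) 1 + ε • Finsupp.single (D a) 1
        else Finsupp.single y 1) = 1 / (I : ℝ) := by
      intro i
      rw [map_smul]
      split_ifs <;> simp
    rw [Finset.sum_congr rfl fun i _ => hterm i]
    simp [hI']

theorem expUtil_challengeLottery (i : Fin I) :
    expUtil w i θ (challengeLottery w D B ε θ' y a) = 1 / (I : ℝ) * ∑ j,
      if Reversal w j θ' y (a j) then
        (1 - ε) * uS w i (B j θ' y (a j)) θ + ε * uS w i (D a) θ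
      else uS w i y θ := by
  rw [challengeLottery, map_sum, Finset.mul_sum]
  refine Finset.sum_congr rfl fun j _ => ?_
  rw [map_smul, smul_eq_mul]
  split_ifs
  · rw [map_add, map_smul, map_smul, expUtil_single, expUtil_single, smul_eq_mul, smul_eq_mul]
  · rw [expUtil_single]

theorem IsChallengeScheme.slot_le (h : IsChallengeScheme w Y D B ε) (hy : y ∈ Y) {i : Fin I}
    (ha : prefType w i (a i) ≠ prefType w i θ) (j : Fin I) :
    (if Reversal w j θ' y (a j) then
        (1 - ε) * uS w i (B j θ' y (a j)) θ + ε * uS w i (D a) θ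
      else uS w i y θ) ≤
    (if Reversal w j θ' y (Function.update a i θ j) then
        (1 - ε) * uS w i (B j θ' y (Function.update a i θ j)) θ
          + ε * uS w i (D (Function.update a i θ)) θ
      else uS w i y θ) ∧
    (Reversal w j θ' y (a j) ∨ j = i ∧ Reversal w i θ' y θ →
      (if Reversal w j θ' y (a j) then
          (1 - ε) * uS w i (B j θ' y (a j)) θ + ε * uS w i (D a) θ
        else uS w i y θ) <
      (if Reversal w j θ' y (Function.update a i θ j) then
          (1 - ε) * uS w i (B j θ' y (Function.update a i θ j)) θ
            + ε * uS w i (D (Function.update a i θ)) θ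
        else uS w i y θ)) := by
  have hD := mul_lt_mul_of_pos_left (h.scoring_lt i θ a ha) h.pos
  have hε : 0 ≤ 1 - ε := by linarith [h.lt_one]
  by_cases hj : j = i
  · subst hj
    rw [Function.update_self]
    by_cases hra : Reversal w j θ' y (a j) <;> by_cases hrθ : Reversal w j θ' y θ
    · rw [if_pos hra, if_pos hrθ]
      have := mul_le_mul_of_nonneg_left (h.challenge_best j θ' y _ θ hra hrθ) hε
      exact ⟨by linarith, fun _ => by linarith⟩
    · rw [if_pos hra, if_neg hrθ]
      have hle : uS w j (B j θ' y (a j)) θ ≤ uS w j y θ := by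
        by_contra! hlt
        exact hrθ ⟨_, h.challenge_le j θ' y _ hra, hlt⟩
      have h1 := mul_le_mul_of_nonneg_left hle hε
      have h2 := mul_lt_mul_of_pos_left (h.scoring_low j θ a y hy) h.pos
      exact ⟨by linarith, fun _ => by linarith⟩
    · rw [if_neg hra, if_pos hrθ]
      have := h.profitable j θ' θ (Function.update a j θ) y hy hrθ
      exact ⟨this.le, fun _ => this⟩
    · rw [if_neg hra, if_neg hrθ]
      exact ⟨le_rfl, fun hor => (hor.elim hra fun h => hrθ h.2).elim⟩
  · rw [Function.update_of_ne hj]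
    by_cases hra : Reversal w j θ' y (a j)
    · rw [if_pos hra, if_pos hra]
      exact ⟨by linarith, fun _ => by linarith⟩
    · rw [if_neg hra, if_neg hra]
      exact ⟨le_rfl, fun hor => (hor.elim hra fun h => hj h.1).elim⟩

theorem IsChallengeScheme.expUtil_le (h : IsChallengeScheme w Y D B ε) (hy : y ∈ Y) {i : Fin I}
    (ha : prefType w i (a i) ≠ prefType w i θ) :
    expUtil w i θ (challengeLottery w D B ε θ' y a) ≤
      expUtil w i θ (challengeLottery w D B ε θ' y (Function.update a i θ)) := by
  rw [expUtil_challengeLottery, expUtil_challengeLottery]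
  exact mul_le_mul_of_nonneg_left (Finset.sum_le_sum fun j _ => (h.slot_le hy ha j).1)
    (by positivity)

theorem IsChallengeScheme.expUtil_lt (h : IsChallengeScheme w Y D B ε) (hy : y ∈ Y) {i : Fin I}
    (ha : prefType w i (a i) ≠ prefType w i θ)
    (hr : (∃ j, Reversal w j θ' y (a j)) ∨ Reversal w i θ' y θ) :
    expUtil w i θ (challengeLottery w D B ε θ' y a) <
      expUtil w i θ (challengeLottery w D B ε θ' y (Function.update a i θ)) := by
  have hI : (0 : ℝ) < I := Nat.cast_pos.mpr i.pos
  rw [expUtil_challengeLottery, expUtil_challengeLottery]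
  refine mul_lt_mul_of_pos_left
    (Finset.sum_lt_sum (fun j _ => (h.slot_le hy ha j).1) ?_) (by positivity)
  rcases hr with ⟨j, hj⟩ | hi
  · exact ⟨j, Finset.mem_univ j, (h.slot_le hy ha j).2 (Or.inl hj)⟩
  · exact ⟨i, Finset.mem_univ i, (h.slot_le hy ha i).2 (Or.inr ⟨rfl, hi⟩)⟩

end ChallengeLottery

/-! ### The mechanism -/

/-- The outcome of the game of state announcements `n`, where the outcome `f θ` is foreseen for
the state `θ` and `ρ` picks a representative among the states with the same types. -/
def announcementOutcome [Fintype A] (w : Fin I → A → Θ → ℝ) (D : (Fin I → Θ) → OutcS A I)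
    (B : Fin I → Θ → OutcS A I → Θ → OutcS A I) (ε : ℝ) (ρ : Θ → Θ) (i₀ : Fin I)
    (f : Θ → OutcS A I) (n : Fin I → Θ × Θ) : OutcS A I →₀ ℝ :=
  if Consensus (fun θ i => prefType w i θ) n then
    challengeLottery w D B ε (ρ (n i₀).2) (f (ρ (n i₀).2)) fun j => (n j).1
  else Finsupp.single (D fun j => (n j).1) 1

section AnnouncementOutcome

variable [Fintype A] {w : Fin I → A → Θ → ℝ} {Y : Set (OutcS A I)} {D : (Fin I → Θ) → OutcS A I}
  {B : Fin I → Θ → OutcS A I → Θ → OutcS A I} {ε : ℝ} {ρ : Θ → Θ} {i₀ : Fin I}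
  {f : Θ → OutcS A I} {n : Fin I → Θ × Θ}

theorem announcementOutcome_prob (hε0 : 0 ≤ ε) (hε1 : ε ≤ 1) :
    (∀ x, 0 ≤ announcementOutcome w D B ε ρ i₀ f n x) ∧
      ((announcementOutcome w D B ε ρ i₀ f n).sum fun _ q => q) = 1 := by
  unfold announcementOutcome
  split_ifs
  · exact challengeLottery_prob i₀.pos.ne' hε0 hε1
  · refine ⟨fun x => ?_, by simp⟩
    rw [Finsupp.single_apply]
    split_ifs <;> norm_num

theorem announcementOutcome_eq_single
    (hρ : ∀ s s', (∀ i, prefType w i s = prefType w i s') → ρ s = ρ s')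
    (hn : Consensus (fun θ i => prefType w i θ) n)
    (h : ∀ i, ¬ Reversal w i (ρ (n i).2) (f (ρ (n i).2)) (n i).1) :
    announcementOutcome w D B ε ρ i₀ f n = Finsupp.single (f (ρ (n i₀).2)) 1 := by
  rw [announcementOutcome, if_pos hn]
  refine challengeLottery_eq_single i₀.pos.ne' fun i => ?_
  rw [hρ (n i₀).2 (n i).2 fun k => congrFun (hn i₀ i) k]
  exact h i

theorem announcementOutcome_update_report (i : Fin I) (θ : Θ) :
    announcementOutcome w D B ε ρ i₀ f (Function.update n i (θ, (n i).2)) =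
      if Consensus (fun θ i => prefType w i θ) n then
        challengeLottery w D B ε (ρ (n i₀).2) (f (ρ (n i₀).2))
          (Function.update (fun j => (n j).1) i θ)
      else Finsupp.single (D (Function.update (fun j => (n j).1) i θ)) 1 := by
  have h2 : ∀ j, (Function.update n i (θ, (n i).2) j).2 = (n j).2 := fun j => by
    by_cases hj : j = i
    · subst hj
      simp
    · simp [hj]
  have h1 : (fun j => (Function.update n i (θ, (n i).2) j).1)
      = Function.update (fun j => (n j).1) i θ := by
    funext j
    by_cases hj : j = i
    · subst hj
      simp
    · simp [hj]
  have hc : Consensus (fun θ i => prefType w i θ) (Function.update n i (θ, (n i).2)) ↔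
      Consensus (fun θ i => prefType w i θ) n := by
    simp only [Consensus, h2]
  simp only [announcementOutcome, hc, h1, h2]

theorem IsChallengeScheme.isTruthInducing (h : IsChallengeScheme w Y D B ε)
    (hρ : ∀ s s', (∀ i, prefType w i s = prefType w i s') → ρ s = ρ s')
    (hρ' : ∀ s i, prefType w i (ρ s) = prefType w i s) (hf : ∀ s, f s ∈ Y) {θ : Θ} {G : ℝ}
    (hG : ∀ i n, |expUtil w i θ (announcementOutcome w D B ε ρ i₀ f n)| ≤ G) :
    IsTruthInducing (fun θ i => prefType w i θ) θ
      (fun i n => expUtil w i θ (announcementOutcome w D B ε ρ i₀ f n))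
      (fun i s a => Reversal w i (ρ s) (f (ρ s)) a) G where
  abs_payoff_le := hG
  challenge_state i s s' a hs hr := by rwa [← hρ s s' fun k => congrFun hs k]
  challenge_report i s a a' ha hr := hr.congr_right ha
  not_challenge i s a hs := not_reversal_of_prefType_eq ((hρ' s i).trans hs) _
  le_truth i n hne := by
    rw [announcementOutcome_update_report, announcementOutcome]
    split_ifs with hc
    · exact h.expUtil_le (hf _) hne
    · rw [expUtil_single, expUtil_single]
      exact (h.scoring_lt i θ _ hne).le
  lt_truth i n hne hor := by
    rw [announcementOutcome_update_report, announcementOutcome]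
    split_ifs with hc
    · have hs : ∀ j, ρ (n j).2 = ρ (n i₀).2 := fun j => hρ _ _ fun k => congrFun (hc j i₀) k
      refine h.expUtil_lt (hf _) hne ?_
      rcases hor with (hnc | ⟨j, hj⟩) | ⟨-, hi⟩
      · exact absurd hc hnc
      · exact Or.inl ⟨j, by rwa [← hs j]⟩
      · exact Or.inr (by rwa [← hs i])
    · rw [expUtil_single, expUtil_single]
      exact h.scoring_lt i θ _ hne
  eq_of_not_triggered i n n' hn hn' hs := by
    simp only [Triggered, not_or, not_not, not_exists] at hn hn'
    rw [announcementOutcome_eq_single hρ hn.1 hn.2, announcementOutcome_eq_single hρ hn'.1 hn'.2,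
      hρ _ _ fun k => congrFun (hs i₀) k]

end AnnouncementOutcome

/-- The majority among the votes of three agents. -/
def majority {J C : Type*} {F : C → Type*} (i₀ i₁ i₂ : J) (c : J → ∀ θ, F θ) : ∀ θ, F θ :=
  fun θ => if c i₁ θ = c i₂ θ then c i₁ θ else c i₀ θ

theorem majority_const {J C : Type*} {F : C → Type*} (i₀ i₁ i₂ : J) (d : ∀ θ, F θ) :
    majority i₀ i₁ i₂ (fun _ => d) = d := by
  funext θ
  simp [majority]

theorem majority_update_const {J C : Type*} [DecidableEq J] {F : C → Type*} {i₀ i₁ i₂ : J}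
    (h01 : i₀ ≠ i₁) (h02 : i₀ ≠ i₂) (h12 : i₁ ≠ i₂) (d : ∀ θ, F θ) (l : J) (b : ∀ θ, F θ) :
    majority i₀ i₁ i₂ (Function.update (fun _ => d) l b) = d := by
  funext θ
  unfold majority
  by_cases h1 : i₁ = l
  · subst h1
    simp only [Function.update_self, Function.update_of_ne h12.symm, Function.update_of_ne h01]
    split_ifs with h
    · exact h
    · rfl
  · by_cases h2 : i₂ = l
    · subst h2
      simp only [Function.update_self, Function.update_of_ne h12, Function.update_of_ne h02]
      split_ifs <;> rfl
    · simp [Function.update_of_ne h1, Function.update_of_ne h2]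

/-- If every message consists of a vote and a plan that selects a strategy after each profile of
votes, then supports without weakly dominated messages induce supports without weakly dominated
strategies after each profile of votes. -/
theorem IsUndominatedOn.after_votes {V N : Type} {pay : Fin I → (Fin I → V) → (Fin I → N) → ℝ}
    {S : Fin I → Set (V × ((Fin I → V) → N))}
    (hS : IsUndominatedOn (N := fun _ => V × ((Fin I → V) → N))
      (fun i m => pay i (fun k => (m k).1) fun j => (m j).2 fun k => (m k).1) S)
    (c : Fin I → V) :
    IsUndominatedOn (N := fun _ => N) (fun i n => pay i c n)
      fun i => {b | ∃ μ ∈ S i, μ.1 = c i ∧ μ.2 c = b} := by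
  intro i p hp b hb
  choose m hmS hm1 hm2 using hp
  have hvotes : (fun k => (m k).1) = c := funext hm1
  have hplay : (fun j => (m j).2 c) = p := funext hm2
  have hdev : ∀ q : Fin I → V × ((Fin I → V) → N), q i = m i →
      (fun k => (Function.update q i (c i, Function.update (m i).2 c b) k).1)
        = fun k => (q k).1 := by
    intro q hq
    funext k
    by_cases hk : k = i
    · subst hk
      simp [hq, hm1]
    · simp [hk]
  have hdev2 : ∀ q : Fin I → V × ((Fin I → V) → N), q i = m i →
      (fun j => (Function.update q i (c i, Function.update (m i).2 c b) j).2 c)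
        = Function.update (fun j => (q j).2 c) i b := by
    intro q hq
    funext k
    by_cases hk : k = i
    · subst hk
      simp
    · simp [hk]
  have hdev3 : ∀ q : Fin I → V × ((Fin I → V) → N), q i = m i → ∀ d, d ≠ c →
      (fun j => (Function.update q i (c i, Function.update (m i).2 c b) j).2 d)
        = fun j => (q j).2 d := by
    intro q hq d hd
    funext k
    by_cases hk : k = i
    · subst hk
      simp [hq, hd]
    · simp [hk]
  have := hS i m hmS (c i, Function.update (m i).2 c b) fun q hq hqi => by
    dsimp only
    rw [hdev q hqi]
    by_cases hqc : (fun k => (q k).1) = c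
    · rw [hqc, hdev2 q hqi]
      refine hb (fun j => (q j).2 c) (fun j => ⟨q j, hq j, congrFun hqc j, rfl⟩) ?_
      rw [hqi, hm2]
    · rw [hdev3 q hqi _ hqc]
  dsimp only at this ⊢
  rwa [hdev m rfl, hvotes, hdev2 m rfl, hplay] at this

/-- The mechanism in which each agent votes in `V` and plans a move in the game of state
announcements for each profile of votes, where the votes `c` foresee the outcomes `f c`. -/
def votingMechanism [Fintype Θ] [Nonempty Θ] [Fintype A] {V : Type} [Fintype V] [Nonempty V]
    (w : Fin I → A → Θ → ℝ) (D : (Fin I → Θ) → OutcS A I)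
    (B : Fin I → Θ → OutcS A I → Θ → OutcS A I) {ε : ℝ} (hε0 : 0 ≤ ε) (hε1 : ε ≤ 1) (ρ : Θ → Θ)
    (i₀ : Fin I) (η₁ η₂ : ℝ) (f : (Fin I → V) → Θ → OutcS A I) : FinMechC A I where
  M _ := V × ((Fin I → V) → Θ × Θ)
  fintypeM _ := inferInstance
  nonemptyM _ := inferInstance
  g m := announcementOutcome w D B ε ρ i₀ (f fun k => (m k).1) fun j => (m j).2 fun k => (m k).1
  gProb _ := announcementOutcome_prob hε0 hε1
  τ l m := stateTransfer (fun θ i => prefType w i θ) η₁ η₂ l fun j => (m j).2 fun k => (m k).1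

section VotingMechanism

variable [Fintype Θ] [Nonempty Θ] [Fintype A] {V : Type} [Fintype V] [Nonempty V]
  {w : Fin I → A → Θ → ℝ} {D : (Fin I → Θ) → OutcS A I}
  {B : Fin I → Θ → OutcS A I → Θ → OutcS A I} {ε : ℝ} {hε0 : 0 ≤ ε} {hε1 : ε ≤ 1} {ρ : Θ → Θ}
  {i₀ : Fin I} {η₁ η₂ : ℝ} {f : (Fin I → V) → Θ → OutcS A I}

theorem payoffC_votingMechanism (θ : Θ) (i : Fin I) (m : Fin I → V × ((Fin I → V) → Θ × Θ)) :
    payoffC w (votingMechanism w D B hε0 hε1 ρ i₀ η₁ η₂ f) θ i m =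
      expUtil w i θ (announcementOutcome w D B ε ρ i₀ (f fun k => (m k).1)
        fun j => (m j).2 fun k => (m k).1) +
      stateTransfer (fun θ i => prefType w i θ) η₁ η₂ i fun j => (m j).2 fun k => (m k).1 :=
  rfl

/-- If a single vote against `v` has no effect, then voting for `v` and then telling the truth
is an equilibrium. -/
theorem isPureNEC_votingMechanism {θ : Θ} {v : V} {Ch : Fin I → Θ → Θ → Prop} {G : ℝ}
    (hf : ∀ l b, f (Function.update (fun _ => v) l b) = f fun _ => v)
    (hE : IsTruthInducing (fun θ i => prefType w i θ) θ
      (fun i n => expUtil w i θ (announcementOutcome w D B ε ρ i₀ (f fun _ => v) n)) Ch G)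
    (hI : 2 ≤ I) (hη₂ : 2 * G < η₂) (hη₁ : 2 * G + η₂ * I < η₁) :
    IsPureNEC w (votingMechanism w D B hε0 hε1 ρ i₀ η₁ η₂ f) θ
      fun _ => (v, fun _ => (θ, θ)) := by
  intro l (b : V × ((Fin I → V) → Θ × Θ))
  have hvotes : (fun k => (Function.update (fun _ => (v, fun _ => (θ, θ))) l b k).1)
      = Function.update (fun _ => v) l b.1 := by
    funext k
    by_cases hk : k = l
    · subst hk
      simp
    · simp [hk]
  have hplays : ∀ c, (fun k => (Function.update (fun _ => (v, fun _ => (θ, θ))) l b k).2 c)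
      = Function.update (fun _ => (θ, θ)) l (b.2 c) := by
    intro c
    funext k
    by_cases hk : k = l
    · subst hk
      simp
    · simp [hk]
  refine (payoffC_votingMechanism θ l
    (Function.update (fun _ => (v, fun _ => (θ, θ))) l b)).trans_le ?_
  rw [hvotes, hplays, hf]
  exact hE.update_truth_le hI hη₂ hη₁ l _

theorem InSuppNEC.votingMechanism_consensus {θ : Θ} {Ch : Fin I → Θ → Θ → Prop} {G : ℝ}
    {m : Fin I → V × ((Fin I → V) → Θ × Θ)}
    (hm : InSuppNEC w (votingMechanism w D B hε0 hε1 ρ i₀ η₁ η₂ f) θ m)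
    (hE : IsTruthInducing (fun θ i => prefType w i θ) θ
      (fun i n => expUtil w i θ (announcementOutcome w D B ε ρ i₀ (f fun k => (m k).1) n)) Ch G)
    (hI : 2 ≤ I) (hη₂ : 2 * G < η₂) (hη₁ : 2 * G + η₂ * I < η₁)
    {n : Fin I → Θ × Θ} (hn : n = fun j => (m j).2 fun k => (m k).1) :
    Consensus (fun θ i => prefType w i θ) n ∧
      ∀ i, ¬ Ch i (n i).2 (n i).1 ∧ ¬ Ch i (n i).2 θ := by
  obtain ⟨σ, hσ, hpos⟩ := hm
  have hm' : ∀ j, 0 < σ j (m j) := fun j =>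
    lt_of_le_of_ne ((hσ.1 j).1 _) fun h0 =>
      hpos.ne' (Finset.prod_eq_zero (Finset.mem_univ j) h0.symm)
  have hund := IsUndominatedOn.after_votes (V := V) (N := Θ × Θ)
    (pay := fun i c n => expUtil w i θ (announcementOutcome w D B ε ρ i₀ (f c) n)
      + stateTransfer (fun θ i => prefType w i θ) η₁ η₂ i n)
    hσ.isUndominatedOn_support fun k => (m k).1
  subst hn
  exact hE.consensus_and_not_challenge hI hη₂ hη₁ hund fun j => ⟨m j, hm' j, rfl, rfl⟩

end VotingMechanism

/-- A mechanism with a single message profile implements an SCC on the empty set of states. -/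
theorem nashImplementableSCC_of_isEmpty [IsEmpty Θ] [Fintype A] [Nonempty A]
    (w : Fin I → A → Θ → ℝ) (F : Θ → Set (OutcS A I)) : NashImplementableSCC w F := by
  obtain ⟨c⟩ := ‹Nonempty A›
  let x : OutcS A I := (⟨Pi.single c 1, single_mem_stdSimplex ℝ c⟩, 0)
  refine ⟨⟨fun _ => Unit, fun _ => inferInstance, fun _ => inferInstance,
    fun _ => Finsupp.single x 1, fun _ => ⟨fun y => ?_, by simp⟩, fun _ _ => 0⟩,
    fun θ => isEmptyElim θ⟩
  rw [Finsupp.single_apply]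
  split_ifs <;> norm_num

/-- Representatives of the states with the same types. -/
theorem exists_representative [Fintype A] (w : Fin I → A → Θ → ℝ) :
    ∃ ρ : Θ → Θ, (∀ s s', (∀ i, prefType w i s = prefType w i s') → ρ s = ρ s') ∧
      ∀ s i, prefType w i (ρ s) = prefType w i s := by
  let Z : Θ → Fin I → A → ℝ := fun θ i => prefType w i θ
  refine ⟨fun s => Set.rangeSplitting Z ⟨Z s, s, rfl⟩, fun s s' h => ?_, fun s i => ?_⟩
  · have : Z s = Z s' := funext h
    simp only [this]
  · exact congrFun (Set.apply_rangeSplitting Z ⟨Z s, s, rfl⟩) i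

theorem MaskinMonotoneSCC.nashImplementable [Fintype Θ] [Fintype A] [Nonempty A] (hI : 3 ≤ I)
    {w : Fin I → A → Θ → ℝ} {F : Θ → Set (OutcS A I)} (hFfin : ∀ θ, (F θ).Finite)
    (hFne : ∀ θ, (F θ).Nonempty) (hF : MaskinMonotoneSCC w F) : NashImplementableSCC w F := by
  rcases isEmpty_or_nonempty Θ with hΘ | hΘ
  · exact nashImplementableSCC_of_isEmpty w F
  obtain ⟨ρ, hρ, hρ'⟩ := exists_representative w
  have hFρ : ∀ θ, F (ρ θ) = F θ := fun θ =>
    (hF.subset_of_prefType_eq (hρ' θ)).antisymm (hF.subset_of_prefType_eq fun i => (hρ' θ i).symm)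
  obtain ⟨D, B, ε, hD⟩ := exists_isChallengeScheme w (Set.finite_iUnion hFfin)
  obtain ⟨i₀, i₁, i₂, h01, h02, h12⟩ : ∃ i₀ i₁ i₂ : Fin I, i₀ ≠ i₁ ∧ i₀ ≠ i₂ ∧ i₁ ≠ i₂ :=
    ⟨⟨0, by omega⟩, ⟨1, by omega⟩, ⟨2, by omega⟩, by simp, by simp, by simp⟩
  have hfin : ∀ θ, Finite (F θ) := hFfin
  have hne : ∀ θ, Nonempty (F θ) := fun θ => (hFne θ).to_subtype
  let V := ∀ θ, F θ
  have : Fintype V := Fintype.ofFinite V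
  let f : (Fin I → V) → Θ → OutcS A I := fun c θ => majority i₀ i₁ i₂ c θ
  have hf : ∀ c θ, f c θ ∈ F θ := fun c θ => (majority i₀ i₁ i₂ c θ).2
  obtain ⟨G, hG⟩ := Finite.exists_le fun p : (Fin I → V) × Fin I × Θ × (Fin I → Θ × Θ) =>
    |expUtil w p.2.1 p.2.2.1 (announcementOutcome w D B ε ρ i₀ (f p.1) p.2.2.2)|
  have hη₂ : 2 * G < 2 * G + 1 := by linarith
  have hη₁ : 2 * G + (2 * G + 1) * I < 2 * G + (2 * G + 1) * I + 1 := by linarith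
  have hT : ∀ (c : Fin I → V) (θ : Θ), IsTruthInducing (fun θ i => prefType w i θ) θ
      (fun i n => expUtil w i θ (announcementOutcome w D B ε ρ i₀ (f c) n))
      (fun i s a => Reversal w i (ρ s) (f c (ρ s)) a) G := fun c θ =>
    hD.isTruthInducing hρ hρ' (fun s => Set.mem_iUnion.mpr ⟨s, hf c s⟩)
      fun i n => hG (c, i, θ, n)
  refine ⟨votingMechanism w D B hD.pos.le hD.lt_one.le ρ i₀
    (2 * G + (2 * G + 1) * I + 1) (2 * G + 1) f, fun θ => ⟨fun x hx => ?_, fun m hm => ?_⟩⟩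
  · obtain ⟨v, hv⟩ : ∃ v : V, (v (ρ θ) : OutcS A I) = x := by
      rw [← hFρ] at hx
      exact ⟨Function.update (fun θ => Classical.arbitrary (F θ)) (ρ θ) ⟨x, hx⟩, by simp⟩
    have hmaj : ∀ l b, f (Function.update (fun _ => v) l b) = f fun _ => v := by
      intro l b
      funext s
      simp only [f, majority_const]
      exact congrArg Subtype.val (congrFun (majority_update_const h01 h02 h12 v l b) s)
    refine ⟨fun _ => (v, fun _ => (θ, θ)),
      isPureNEC_votingMechanism hmaj (hT _ θ) (by omega) hη₂ hη₁, ?_,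
      fun l => stateTransfer_eq_zero (Z := fun θ i => prefType w i θ) (n := fun _ => (θ, θ))
        (fun _ _ => rfl) _ _ l⟩
    refine (announcementOutcome_eq_single (i₀ := i₀) hρ (fun _ _ => rfl)
      fun i => not_reversal_of_prefType_eq (hρ' θ i) _).trans ?_
    simp only [f, majority_const, hv]
  · obtain ⟨c, hc⟩ : ∃ c : Fin I → V, c = fun k => (m k).1 := ⟨_, rfl⟩
    obtain ⟨n, hn⟩ : ∃ n : Fin I → Θ × Θ, n = fun j => (m j).2 fun k => (m k).1 := ⟨_, rfl⟩
    obtain ⟨hcons, hch⟩ := hm.votingMechanism_consensus (hT _ θ) (by omega) hη₂ hη₁ hn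
    have hτ := fun l => stateTransfer_eq_zero hcons (2 * G + (2 * G + 1) * I + 1) (2 * G + 1) l
    have hg : announcementOutcome w D B ε ρ i₀ (f fun k => (m k).1) n = _ :=
      announcementOutcome_eq_single hρ hcons fun i => (hch i).1
    rw [← hc] at hch hg
    have hmem : f c (ρ (n i₀).2) ∈ F θ := by
      by_contra hyn
      obtain ⟨i, hr⟩ := hF _ θ _ (hf c (ρ (n i₀).2)) hyn
      refine (hch i).2 ?_
      rw [hρ (n i).2 (n i₀).2 fun k => congrFun (hcons i i₀) k]
      exact hr
    subst hc hn
    refine ⟨fun y hy => ?_, hτ⟩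
    have hy' : y ∈ (announcementOutcome w D B ε ρ i₀ (f fun k => (m k).1)
        fun j => (m j).2 fun k => (m k).1).support := hy
    rw [hg] at hy'
    rwa [Finset.mem_singleton.mp (Finsupp.support_single_subset hy')]

/-- **Theorem 2**: with at least three agents, an SCC (with nonempty finite values) is
implementable in mixed-strategy Nash equilibria by a finite mechanism iff it satisfies
Maskin monotonicity. -/
theorem scc_nashImplementable_iff_maskinMonotone
    [Fintype Θ] [Fintype A] [Nonempty A] (hI : 3 ≤ I)
    (w : Fin I → A → Θ → ℝ)
    (F : Θ → Set (OutcS A I))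
    (hFfin : ∀ θ, (F θ).Finite) (hFne : ∀ θ, (F θ).Nonempty) :
    NashImplementableSCC w F ↔ MaskinMonotoneSCC w F := by
  exact ⟨NashImplementableSCC.maskinMonotone, MaskinMonotoneSCC.nashImplementable hI hFfin hFne⟩

end
end

section
/- For every agent i there exists a challenge scheme {x(θ̃,x,θ_i)} for the SCC F such that: (1) for every state θ̃ ∈ Θ, every x ∈ F(θ̃), and every type θ_i ∈ Θ_i, u_i(x(θ̃,x,θ_i),θ_i) ≥ u_i(x(θ̃,x,θ_i'),θ_i) for all θ_i' ∈ Θ_i; and (2) whenever x(θ̃,x,θ_i) ≠ x, u_i(x(θ̃,x,θ_i),θ_i'') ≠ u_i(x',θ_i'') for every θ_i'' ∈ Θ_i and every x' ∈ F(Θ). -/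
/-!
STATEMENT 8 (Lemma 3, challenge scheme for an SCC): For every agent i there exists a
challenge scheme {x(θ̃,x,θ_i)} for the SCC F such that (1) truth-telling is a best
challenge, and (2) whenever x(θ̃,x,θ_i) ≠ x, no type of agent i is indifferent between
x(θ̃,x,θ_i) and any allocation in F(Θ).
-/

open scoped BigOperators Classical

noncomputable section

variable {A Θ : Type} {I : ℕ}

/-- Agent `i`'s quasilinear utility at an outcome, given his type
`t : A → ℝ` (a vector of Bernoulli utilities). -/
def uTyS [Fintype A] (i : Fin I) (x : OutcS A I) (t : A → ℝ) : ℝ :=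
  (∑ a, (x.1 : A → ℝ) a * t a) + x.2 i

/-- The type of agent `i` at state `θ`. -/
def typeOf {A Θ : Type} {I : ℕ} (w : Fin I → A → Θ → ℝ) (i : Fin I) (θ : Θ) : A → ℝ :=
  fun a => w i a θ

/-- Lower-contour set of `x` for type `t`. -/
def lowerCS [Fintype A] (i : Fin I) (x : OutcS A I) (t : A → ℝ) : Set (OutcS A I) :=
  {x' | uTyS i x' t ≤ uTyS i x t}

/-- Strict upper-contour set of `x` for type `t`. -/
def strictUpperCS [Fintype A] (i : Fin I) (x : OutcS A I) (t : A → ℝ) : Set (OutcS A I) :=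
  {x' | uTyS i x t < uTyS i x' t}

/-- A challenge scheme for the SCC `F` and agent `i`: for each state `θ̃`, each
`x ∈ F(θ̃)` and each type `θ_i ∈ Θ_i`, it selects a test allocation in
`𝓛_i(x,θ̃_i) ∩ 𝓢𝓤_i(x,θ_i)` whenever this set is nonempty, and `x` otherwise. -/
def IsChallengeSchemeSCC [Fintype A] (w : Fin I → A → Θ → ℝ) (F : Θ → Set (OutcS A I))
    (i : Fin I) (xs : Θ → OutcS A I → (A → ℝ) → OutcS A I) : Prop :=
  ∀ (θ' : Θ), ∀ x ∈ F θ', ∀ t ∈ Set.range (typeOf w i),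
    ((lowerCS i x (typeOf w i θ') ∩ strictUpperCS i x t).Nonempty →
      xs θ' x t ∈ lowerCS i x (typeOf w i θ') ∩ strictUpperCS i x t) ∧
    (¬ (lowerCS i x (typeOf w i θ') ∩ strictUpperCS i x t).Nonempty →
      xs θ' x t = x)

/-- Lowering agent `i`'s transfer by `ε` lowers his utility by `ε`, whatever his type. -/
theorem uTyS_sub_single [Fintype A] (i : Fin I) (x : OutcS A I) (ε : ℝ) (t : A → ℝ) :
    uTyS i (x.1, x.2 - Pi.single i ε) t = uTyS i x t - ε := by
  simp [uTyS, add_sub_assoc]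

/-- A nonempty challenge set contains an outcome that no type in a finite set `T` finds
indifferent to any outcome in a finite set `Y`. -/
theorem exists_generic_challenge [Fintype A] (i : Fin I) {T : Set (A → ℝ)} (hT : T.Finite)
    {Y : Set (OutcS A I)} (hY : Y.Finite) (x : OutcS A I) (s t : A → ℝ)
    (h : (lowerCS i x s ∩ strictUpperCS i x t).Nonempty) :
    ∃ c ∈ lowerCS i x s ∩ strictUpperCS i x t,
      ∀ r ∈ T, ∀ y ∈ Y, uTyS i c r ≠ uTyS i y r := by
  obtain ⟨z, hzs, hzt⟩ := h
  simp only [lowerCS, strictUpperCS, Set.mem_ofPred_eq] at hzs hzt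
  have hbad : (Set.image2 (fun r y => uTyS i z r - uTyS i y r) T Y).Finite :=
    hT.image2 _ hY
  obtain ⟨ε, ⟨hε0, hε⟩, hεbad⟩ :=
    ((Set.Ioo_infinite (sub_pos.2 hzt)).sdiff hbad).nonempty
  refine ⟨(z.1, z.2 - Pi.single i ε), ⟨?_, ?_⟩, fun r hr y hy heq => hεbad ⟨r, hr, y, hy, ?_⟩⟩
  · simp only [lowerCS, Set.mem_ofPred_eq, uTyS_sub_single]
    linarith
  · simp only [strictUpperCS, Set.mem_ofPred_eq, uTyS_sub_single]
    linarith
  · rw [uTyS_sub_single] at heq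
    dsimp only
    linarith

/-- For a fixed outcome `x` and reported type `s`, there is a selection of challenges, one for each
type in a finite set `T`, that is incentive compatible and generic. -/
theorem exists_best_generic_selection [Fintype A] (i : Fin I) {T : Set (A → ℝ)} (hT : T.Finite)
    {Y : Set (OutcS A I)} (hY : Y.Finite) (x : OutcS A I) (s : A → ℝ) :
    ∃ f : (A → ℝ) → OutcS A I,
      (∀ t ∈ T,
        ((lowerCS i x s ∩ strictUpperCS i x t).Nonempty →
          f t ∈ lowerCS i x s ∩ strictUpperCS i x t) ∧
        (¬ (lowerCS i x s ∩ strictUpperCS i x t).Nonempty → f t = x)) ∧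
      (∀ t ∈ T, ∀ t' ∈ T, uTyS i (f t') t ≤ uTyS i (f t) t) ∧
      (∀ t ∈ T, f t ≠ x → ∀ r ∈ T, ∀ y ∈ Y, uTyS i (f t) r ≠ uTyS i y r) := by
  let N : (A → ℝ) → Prop := fun t => (lowerCS i x s ∩ strictUpperCS i x t).Nonempty
  choose c hc hgen using exists_generic_challenge i hT hY x s
  have hmax (t) (ht : t ∈ T ∧ N t) :
      ∃ r, ∃ hr : r ∈ T ∧ N r, ∀ r', ∀ hr' : r' ∈ T ∧ N r',
        uTyS i (c r' hr'.2) t ≤ uTyS i (c r hr.2) t := by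
    have hfin : Finite {r // r ∈ T ∧ N r} :=
      (hT.subset fun r hr => hr.1 : {r | r ∈ T ∧ N r}.Finite)
    have hne : Nonempty {r // r ∈ T ∧ N r} := ⟨⟨t, ht⟩⟩
    obtain ⟨r, hr⟩ := Finite.exists_max fun r : {r // r ∈ T ∧ N r} => uTyS i (c r r.2.2) t
    exact ⟨r, r.2, fun r' hr' => hr ⟨r', hr'⟩⟩
  choose m hm hmle using hmax
  let f : (A → ℝ) → OutcS A I :=
    fun t => if ht : t ∈ T ∧ N t then c (m t ht) (hm t ht).2 else x
  have hpos (t) (ht : t ∈ T ∧ N t) : f t = c (m t ht) (hm t ht).2 := dif_pos ht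
  have hneg (t) (ht : ¬ (t ∈ T ∧ N t)) : f t = x := dif_neg ht
  have hlow (t) : f t ∈ lowerCS i x s := by
    by_cases ht : t ∈ T ∧ N t
    · rw [hpos t ht]
      exact (hc _ _).1
    · rw [hneg t ht]
      exact le_refl (uTyS i x s)
  have hupp (t) (ht : t ∈ T ∧ N t) : f t ∈ strictUpperCS i x t := by
    rw [hpos t ht]
    exact (hc t ht.2).2.trans_le (hmle t ht t ht)
  refine ⟨f, fun t ht => ⟨fun h => ⟨hlow t, hupp t ⟨ht, h⟩⟩, fun h => hneg t fun h' => h h'.2⟩,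
    fun t ht t' ht' => ?_, fun t ht hne => ?_⟩
  · by_cases h : N t
    · by_cases h' : N t'
      · rw [hpos t ⟨ht, h⟩, hpos t' ⟨ht', h'⟩]
        exact hmle t ⟨ht, h⟩ _ (hm t' ⟨ht', h'⟩)
      · rw [hneg t' fun h'' => h' h''.2]
        exact (hupp t ⟨ht, h⟩).le
    · rw [hneg t fun h'' => h h''.2]
      exact not_lt.1 fun hlt => h ⟨f t', hlow t', hlt⟩
  · have h : t ∈ T ∧ N t := by
      by_contra h
      exact hne (hneg t h)
    rw [hpos t h]
    exact hgen _ _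

/-- **Lemma 3**: existence of a best and "generic" challenge scheme for an SCC. -/
theorem exists_best_generic_challenge_scheme_scc
    [Fintype Θ] [Fintype A] [Nonempty A] (hI : 2 ≤ I)
    (w : Fin I → A → Θ → ℝ)
    (F : Θ → Set (OutcS A I))
    (hFfin : ∀ θ, (F θ).Finite) (hFne : ∀ θ, (F θ).Nonempty) :
    ∀ i : Fin I, ∃ xs : Θ → OutcS A I → (A → ℝ) → OutcS A I,
      IsChallengeSchemeSCC w F i xs ∧
      -- (1) truthful reporting of one's type is a (weakly) best challenge
      (∀ (θ' : Θ), ∀ x ∈ F θ', ∀ t ∈ Set.range (typeOf w i), ∀ t' ∈ Set.range (typeOf w i),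
        uTyS i (xs θ' x t') t ≤ uTyS i (xs θ' x t) t) ∧
      -- (2) an effective challenge is generic: no type is indifferent between the test
      -- allocation and any allocation in F(Θ)
      (∀ (θ' : Θ), ∀ x ∈ F θ', ∀ t ∈ Set.range (typeOf w i), xs θ' x t ≠ x →
        ∀ t'' ∈ Set.range (typeOf w i), ∀ θ'' : Θ, ∀ x' ∈ F θ'',
          uTyS i (xs θ' x t) t'' ≠ uTyS i x' t'') := by
  intro i
  have hY : (⋃ θ, F θ).Finite := Set.finite_iUnion hFfin
  choose f hscheme hbest hgen using fun (θ' : Θ) (x : OutcS A I) =>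
    exists_best_generic_selection i (Set.finite_range (typeOf w i)) hY x (typeOf w i θ')
  exact ⟨f, fun θ' x _ => hscheme θ' x, fun θ' x _ => hbest θ' x,
    fun θ' x _ t ht hne r hr θ'' y hy =>
      hgen θ' x t ht hne r hr y (Set.mem_iUnion_of_mem θ'' hy)⟩

end
end

section
/- Suppose Θ is a compact Polish space, each map θ ↦ v_i(a,θ) (for a ∈ A and i ∈ 𝓘) is continuous, and the SCF f: Θ → X is continuous. If f satisfies Maskin monotonicity, then there exists a mechanism with compact message spaces, a continuous outcome function, and continuous transfer rules that implements f in mixed-strategy Nash equilibria. -/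
/-!
STATEMENT 11 (Theorem 4, second part): Suppose Θ is a compact Polish space, each map
θ ↦ v_i(a,θ) is continuous, and the SCF f : Θ → X is continuous. If f satisfies Maskin
monotonicity, then there exists a mechanism with compact message spaces, a continuous
outcome function and continuous transfer rules that implements f in mixed-strategy Nash
equilibria.
-/

open scoped BigOperators Classical

noncomputable section

variable {A Θ : Type} {I : ℕ}

/-- Agent `i`'s quasilinear utility `ũ_i(x,θ) = ℓ · v̄_i(θ_i) + t_i`, where
`w i θ : A → ℝ` is the utility vector of agent `i`'s type at state `θ`. -/
def uP [Fintype A] (w : Fin I → Θ → A → ℝ) (i : Fin I) (x : OutcS A I) (θ : Θ) : ℝ :=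
  (∑ a, (x.1 : A → ℝ) a * w i θ a) + x.2 i

/-- Maskin monotonicity of an SCF `f : Θ → X`. -/
def MaskinMonotoneP [Fintype A] (w : Fin I → Θ → A → ℝ) (f : Θ → OutcS A I) : Prop :=
  ∀ θ' θ : Θ, f θ' ≠ f θ →
    ∃ (i : Fin I) (x : OutcS A I),
      uP w i x θ' ≤ uP w i (f θ') θ' ∧ uP w i (f θ') θ < uP w i x θ

/-- A mechanism with topological message spaces. -/
structure MechT (X : Type) (I : ℕ) where
  M : Fin I → Type
  topM : ∀ i, TopologicalSpace (M i)
  nonemptyM : ∀ i, Nonempty (M i)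
  g : (∀ i, M i) → X
  τ : Fin I → (∀ i, M i) → ℝ

attribute [instance] MechT.topM MechT.nonemptyM

/-- Message spaces carry their Borel σ-algebras. -/
instance MechT.instMeasurableSpaceM {X : Type} {I : ℕ} (𝓜 : MechT X I) (i : Fin I) :
    MeasurableSpace (𝓜.M i) := borel (𝓜.M i)

/-- An analytic function: the preimage of every open set is an analytic set (hence the
function is universally measurable). -/
def AnalyticFunction {α β : Type} [TopologicalSpace α] [TopologicalSpace β]
    (f : α → β) : Prop :=
  ∀ U : Set β, IsOpen U → MeasureTheory.AnalyticSet (f ⁻¹' U)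

/-- The (topological) support of a measure: points all of whose open neighbourhoods have
positive measure. -/
def mSupport {α : Type} [TopologicalSpace α] [MeasurableSpace α]
    (μ : MeasureTheory.Measure α) : Set α :=
  {x | ∀ U : Set α, IsOpen U → x ∈ U → 0 < μ U}

/-- Expected payoff to agent `i` from the pure message `mi` against the mixed strategies
of the other agents (a profile of Borel probability measures). -/
def devPayT {X : Type} (𝓜 : MechT X I) (pay : Fin I → (∀ j, 𝓜.M j) → ℝ)
    (σ : ∀ i, MeasureTheory.Measure (𝓜.M i)) (i : Fin I) (mi : 𝓜.M i) : ℝ :=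
  ∫ m, pay i (Function.update m i mi) ∂(MeasureTheory.Measure.pi σ)

/-- Mixed-strategy Nash equilibrium: every message in the support of `σ i` is a best
response against `σ_{-i}`. -/
def IsNET {X : Type} (𝓜 : MechT X I) (pay : Fin I → (∀ j, 𝓜.M j) → ℝ)
    (σ : ∀ i, MeasureTheory.Measure (𝓜.M i)) : Prop :=
  (∀ i, MeasureTheory.IsProbabilityMeasure (σ i)) ∧
    ∀ i : Fin I, ∀ mi ∈ mSupport (σ i), ∀ mi' : 𝓜.M i,
      devPayT 𝓜 pay σ i mi' ≤ devPayT 𝓜 pay σ i mi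

/-- Pure-strategy Nash equilibrium. -/
def IsPureNET {X : Type} (𝓜 : MechT X I) (pay : Fin I → (∀ j, 𝓜.M j) → ℝ)
    (m : ∀ j, 𝓜.M j) : Prop :=
  ∀ (i : Fin I) (mi' : 𝓜.M i), pay i (Function.update m i mi') ≤ pay i m

/-- `m` is played with positive probability under some mixed-strategy Nash equilibrium. -/
def InSuppNET {X : Type} (𝓜 : MechT X I) (pay : Fin I → (∀ j, 𝓜.M j) → ℝ)
    (m : ∀ j, 𝓜.M j) : Prop :=
  ∃ σ, IsNET 𝓜 pay σ ∧ ∀ i, m i ∈ mSupport (σ i)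

/-- Payoffs of the complete-information game `Γ(𝓜,θ)`. -/
def payT [Fintype A] (w : Fin I → Θ → A → ℝ) (𝓜 : MechT (OutcS A I) I) (θ : Θ)
    (i : Fin I) (m : ∀ j, 𝓜.M j) : ℝ :=
  uP w i (𝓜.g m) θ + 𝓜.τ i m

/-- `𝓜` implements `f` in mixed-strategy Nash equilibria. -/
def ImplementsT [Fintype A] (w : Fin I → Θ → A → ℝ) (𝓜 : MechT (OutcS A I) I)
    (f : Θ → OutcS A I) : Prop :=
  ∀ θ : Θ,
    (∃ m, IsPureNET 𝓜 (payT w 𝓜 θ) m) ∧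
    ∀ m, InSuppNET 𝓜 (payT w 𝓜 θ) m → 𝓜.g m = f θ ∧ ∀ i, 𝓜.τ i m = 0

section Support

open MeasureTheory

lemma mSupport_eq_support {α : Type} [TopologicalSpace α] [MeasurableSpace α]
    (μ : Measure α) : mSupport μ = μ.support := by
  rw [Measure.support_eq_forall_isOpen]
  ext x
  exact ⟨fun h U hx hU => h U hU hx, fun h U hU hx => h U hx hU⟩

instance MechT.instBorelSpaceM {X : Type} (𝓜 : MechT X I) (i : Fin I) : BorelSpace (𝓜.M i) :=
  ⟨rfl⟩

/-- In a mixed equilibrium, a deviation that never hurts on the product of the supports does not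
help at any profile in the product of the supports. -/
lemma IsNET.deviation_le {X : Type} {𝓜 : MechT X I} [∀ i, CompactSpace (𝓜.M i)]
    [∀ i, SecondCountableTopology (𝓜.M i)] {pay : Fin I → (∀ j, 𝓜.M j) → ℝ}
    (hpay : ∀ i, Continuous (pay i)) {σ : ∀ i, Measure (𝓜.M i)} (hσ : IsNET 𝓜 pay σ)
    (i : Fin I) {m : ∀ j, 𝓜.M j} (hm : ∀ j, m j ∈ mSupport (σ j)) (x : 𝓜.M i)
    (hx : ∀ n : ∀ j, 𝓜.M j, (∀ j, n j ∈ mSupport (σ j)) → n i = m i →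
      pay i n ≤ pay i (Function.update n i x)) :
    pay i (Function.update m i x) ≤ pay i m := by
  have := hσ.1
  have hcont : ∀ y : 𝓜.M i, Continuous fun n : ∀ j, 𝓜.M j => pay i (Function.update n i y) :=
    fun y => (hpay i).comp (continuous_id.update i continuous_const)
  have hint : ∀ y : 𝓜.M i,
      Integrable (fun n : ∀ j, 𝓜.M j => pay i (Function.update n i y)) (Measure.pi σ) := fun y =>
    (hcont y).integrable_of_hasCompactSupport (HasCompactSupport.of_compactSpace _)
  have hsupp : ∀ᵐ n ∂(Measure.pi σ), ∀ j, n j ∈ mSupport (σ j) := by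
    refine Filter.eventually_all.2 fun j => Measure.tendsto_eval_ae_ae.eventually ?_
    rw [mSupport_eq_support]
    exact Measure.support_mem_ae
  have hnn : ∀ n : ∀ j, 𝓜.M j, (∀ j, n j ∈ mSupport (σ j)) →
      0 ≤ pay i (Function.update n i x) - pay i (Function.update n i (m i)) := by
    intro n hn
    have := hx (Function.update n i (m i)) (fun j => by
      rcases eq_or_ne j i with rfl | hj
      · simpa using hm j
      · simpa [hj] using hn j) (by simp)
    rw [Function.update_idem] at this
    linarith
  have hae : 0 ≤ᵐ[Measure.pi σ]
      fun n => pay i (Function.update n i x) - pay i (Function.update n i (m i)) :=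
    hsupp.mono hnn
  have hzero : ∫ n, (pay i (Function.update n i x) - pay i (Function.update n i (m i)))
      ∂(Measure.pi σ) = 0 := by
    refine le_antisymm ?_ (integral_nonneg_of_ae hae)
    rw [integral_sub (hint _) (hint _)]
    exact sub_nonpos.2 (hσ.2 i (m i) (hm i) x)
  rw [integral_eq_zero_iff_of_nonneg_ae hae ((hint _).sub (hint _))] at hzero
  by_contra! hlt
  have hopen : IsOpen {n : ∀ j, 𝓜.M j |
      pay i (Function.update n i x) - pay i (Function.update n i (m i)) ≠ 0} :=
    isOpen_ne_fun ((hcont x).sub (hcont _)) continuous_const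
  have hmem : m ∈ {n : ∀ j, 𝓜.M j |
      pay i (Function.update n i x) - pay i (Function.update n i (m i)) ≠ 0} := by
    simp only [Function.update_eq_self, Set.mem_ofPred_eq]
    linarith
  obtain ⟨U, hU, hUsub⟩ := isOpen_pi_iff'.1 hopen m hmem
  have hpos : 0 < Measure.pi σ (Set.univ.pi U) := by
    rw [Measure.pi_pi]
    exact pos_iff_ne_zero.2 (Finset.prod_ne_zero_iff.2 fun j _ =>
      (hm j (U j) (hU j).1 (hU j).2).ne')
  exact (hpos.trans_le (measure_mono hUsub)).ne' (ae_iff.1 hzero)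

end Support

section Extension

/-- A continuous retraction of `ℝ^A` onto the simplex of lotteries. -/
def toLot [Fintype A] [Nonempty A] (v : A → ℝ) : Lot A :=
  ⟨fun a => (max (v a) 0 + max (1 - ∑ b, max (v b) 0) 0 / Fintype.card A) /
      max (∑ b, max (v b) 0) 1, by
    constructor
    · intro a
      positivity
    · have hA : (Fintype.card A : ℝ) ≠ 0 := by simp
      rw [← Finset.sum_div, Finset.sum_add_distrib, Finset.sum_const, Finset.card_univ,
        nsmul_eq_mul, mul_div_cancel₀ _ hA, div_eq_one_iff_eq (by positivity)]
      rcases le_total (∑ b, max (v b) 0) 1 with h | h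
      · rw [max_eq_left (by linarith), max_eq_right h]; ring
      · rw [max_eq_right (by linarith), max_eq_left h]; ring⟩

lemma coe_toLot [Fintype A] [Nonempty A] {v : A → ℝ} (hv : v ∈ stdSimplex ℝ A) :
    (toLot v : A → ℝ) = v := by
  have h : ∀ a, max (v a) 0 = v a := fun a => max_eq_left (hv.1 a)
  ext a
  change (max (v a) 0 + max (1 - ∑ b, max (v b) 0) 0 / Fintype.card A) /
      max (∑ b, max (v b) 0) 1 = v a
  simp [h, hv.2]

lemma continuous_toLot [Fintype A] [Nonempty A] : Continuous (toLot : (A → ℝ) → Lot A) := by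
  refine Continuous.subtype_mk (continuous_pi fun a => ?_) _
  refine Continuous.div (by fun_prop) (by fun_prop) fun v => ?_
  positivity

/-- A continuous outcome-valued map that factors through a continuous map `φ` on a compact space
factors through a continuous map on the whole codomain of `φ`. -/
lemma exists_continuous_factorization [Fintype A] [Nonempty A] {Y : Type} [TopologicalSpace Θ]
    [CompactSpace Θ] [TopologicalSpace Y] [T2Space Y] [NormalSpace Y] {φ : Θ → Y}
    (hφ : Continuous φ) {f : Θ → OutcS A I} (hf : Continuous f)
    (h : ∀ θ θ', φ θ = φ θ' → f θ = f θ') :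
    ∃ F : Y → OutcS A I, Continuous F ∧ ∀ θ, F (φ θ) = f θ := by
  have hq : Topology.IsQuotientMap (Set.rangeFactorization φ) :=
    (hφ.subtype_mk _).isClosedMap.isQuotientMap (hφ.subtype_mk _) Set.rangeFactorization_surjective
  let k : C(Θ, (A → ℝ) × (Fin I → ℝ)) :=
    ⟨fun θ => ((f θ).1, (f θ).2), by fun_prop⟩
  obtain ⟨K, hK⟩ := ContinuousMap.exists_restrict_eq (isCompact_range hφ).isClosed
    (Topology.IsQuotientMap.lift (f := ⟨_, hφ.subtype_mk _⟩) hq k fun θ θ' hθ => by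
      have := h θ θ' (congrArg Subtype.val hθ)
      simp only [k, ContinuousMap.coe_mk, this])
  refine ⟨fun y => (toLot (K y).1, (K y).2),
    (continuous_toLot.comp (by fun_prop)).prodMk (by fun_prop), fun θ => ?_⟩
  have hKθ : K (φ θ) = k θ := by
    have h1 := DFunLike.congr_fun hK ⟨φ θ, θ, rfl⟩
    have h2 := DFunLike.congr_fun (Topology.IsQuotientMap.lift_comp
      (f := ⟨_, hφ.subtype_mk _⟩) hq k fun θ θ' hθ => by
      have := h θ θ' (congrArg Subtype.val hθ)
      simp only [k, ContinuousMap.coe_mk, this]) θ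
    exact h1.trans h2
  simp only [hKθ]
  exact Prod.ext (Subtype.ext (coe_toLot (f θ).1.2)) rfl

/-- A continuous penalty on `B × B` that strictly outweighs the effect on `h` of moving
in `B`. -/
lemma exists_penalty {B K : Type} [MetricSpace B] [TopologicalSpace K] [CompactSpace K]
    {h : B → K → ℝ} (hh : Continuous fun x : B × K => h x.1 x.2) :
    ∃ ρ : B → B → ℝ, Continuous (fun x : B × B => ρ x.1 x.2) ∧ (∀ b, ρ b b = 0) ∧
      ∀ b b' k, h b k + dist b b' ≤ h b' k + ρ b b' := by
  let G : C(B, C(K, ℝ)) := ContinuousMap.curry ⟨_, hh⟩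
  refine ⟨fun b b' => dist (G b) (G b') + dist b b', by fun_prop, by simp, fun b b' k => ?_⟩
  have h1 := ContinuousMap.dist_apply_le_dist (f := G b) (g := G b') k
  have h2 : G b k - G b' k ≤ dist (G b k) (G b' k) := by
    rw [Real.dist_eq]; exact le_abs_self _
  have h3 : ∀ b, G b k = h b k := fun _ => rfl
  rw [h3, h3] at h2
  linarith [h3 b ▸ h3 b' ▸ h1]

end Extension

/-- A vector translated to have mean zero. -/
def center [Fintype A] (v : A → ℝ) : A → ℝ := fun a => v a - (∑ b, v b) / Fintype.card A

section Center

variable [Fintype A]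

lemma sum_mul_center (u v : A → ℝ) : ∑ a, u a * center v a = ∑ a, center u a * v a := by
  simp only [center, mul_sub, sub_mul, Finset.sum_sub_distrib, ← Finset.sum_mul, ← Finset.mul_sum]
  ring

lemma sum_center [Nonempty A] (v : A → ℝ) : ∑ a, center v a = 0 := by
  simp only [center, Finset.sum_sub_distrib, Finset.sum_const, Finset.card_univ, nsmul_eq_mul]
  field_simp
  ring

lemma sum_mul_center_of_sum_eq_zero {d : A → ℝ} (hd : ∑ a, d a = 0) (v : A → ℝ) :
    ∑ a, d a * center v a = ∑ a, d a * v a := by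
  simp [center, mul_sub, Finset.sum_sub_distrib, ← Finset.sum_mul, hd]

lemma center_mem_Icc [Nonempty A] {v : A → ℝ} (hv : ∀ a, v a ∈ Set.Icc (0 : ℝ) 1) :
    center v ∈ Set.Icc (-1 : A → ℝ) 1 := by
  have h0 : 0 ≤ (∑ b, v b) / Fintype.card A :=
    div_nonneg (Finset.sum_nonneg fun a _ => (hv a).1) (Nat.cast_nonneg _)
  have h1 : (∑ b, v b) / Fintype.card A ≤ 1 := by
    rw [div_le_one (by simp [Fintype.card_pos])]
    calc ∑ b, v b ≤ ∑ _b : A, (1 : ℝ) := Finset.sum_le_sum fun a _ => (hv a).2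
      _ = Fintype.card A := by simp
  constructor <;> intro a <;> simp only [center, Pi.neg_apply, Pi.one_apply] <;>
    linarith [(hv a).1, (hv a).2]

lemma abs_center_le [Nonempty A] {v : A → ℝ} (hv : v ∈ Set.Icc (-1 : A → ℝ) 1) (a : A) :
    |center v a| ≤ 2 := by
  have hva : |v a| ≤ 1 := abs_le.2 ⟨hv.1 a, hv.2 a⟩
  have hm : |(∑ b, v b) / Fintype.card A| ≤ 1 := by
    rw [abs_div, Nat.abs_cast, div_le_one (by simp [Fintype.card_pos])]
    calc |∑ b, v b| ≤ ∑ b, |v b| := Finset.abs_sum_le_sum_abs _ _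
      _ ≤ ∑ _b : A, (1 : ℝ) := Finset.sum_le_sum fun b _ => abs_le.2 ⟨hv.1 b, hv.2 b⟩
      _ = Fintype.card A := by simp
  exact (abs_sub _ _).trans (by linarith)

lemma continuous_center : Continuous (center : (A → ℝ) → A → ℝ) := by
  unfold center
  fun_prop

lemma sum_mul_lot_mem_Icc {u v : A → ℝ} (hu : ∀ a, u a ∈ Set.Icc (0 : ℝ) 1)
    (hv : v ∈ stdSimplex ℝ A) : ∑ a, u a * v a ∈ Set.Icc (0 : ℝ) 1 := by
  refine ⟨Finset.sum_nonneg fun a _ => mul_nonneg (hu a).1 (hv.1 a), ?_⟩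
  rw [← hv.2]
  exact Finset.sum_le_sum fun a _ => mul_le_of_le_one_left (hv.1 a) (hu a).2

lemma sum_sub_mul_sub_center (p q : Lot A) (u : A → ℝ) :
    ∑ a, ((p : A → ℝ) a - (q : A → ℝ) a) * (u a - center u a) = 0 := by
  have hd : ∑ a, ((p : A → ℝ) a - (q : A → ℝ) a) = 0 := by
    rw [Finset.sum_sub_distrib]
    exact sub_eq_zero.2 (p.2.2.trans q.2.2.symm)
  simp only [mul_sub, Finset.sum_sub_distrib (s := Finset.univ) (f := fun a => _ * u a)]
  rw [sum_mul_center_of_sum_eq_zero hd, sub_self]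

end Center

/-- Vectors with entries in `[-1,1]`. -/
abbrev Cube (A : Type) : Type := ↥(Set.Icc (-1 : A → ℝ) 1)

/-- A message of agent `i`: a scored report of its own centered type, an announcement of its own
centered type, an announcement of the centered type of its predecessor, and a proposed
lottery. -/
abbrev Msg (A : Type) [Fintype A] : Type := Cube A × Cube A × Cube A × Lot A

/-- The parameters of the mechanism: the permutation sending each agent to the one who
reports on it, an extension of the social choice function to profiles of vectors, the set of
feasible profiles, and the weight of inconsistencies. -/
structure Design (A : Type) [Fintype A] (I : ℕ) where
  next : Equiv.Perm (Fin I)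
  F : (Fin I → A → ℝ) → OutcS A I
  Φ : Set (Fin I → A → ℝ)
  ε : ℝ

namespace Design

variable [Fintype A] (D : Design A I)

/-- The announced profile: the type of `k` is announced by the agent next to `k`. -/
def state (m : Fin I → Msg A) : Fin I → A → ℝ := fun k => (m (D.next k)).2.2.1

/-- The lottery which the social choice function selects at the announced profile. -/
def base (m : Fin I → Msg A) : A → ℝ := ((D.F (D.state m)).1 : A → ℝ)

/-- The difference between the lottery proposed by `j` and the selected one. -/
def gap (m : Fin I → Msg A) (j : Fin I) : A → ℝ := fun a => ((m j).2.2.2 : A → ℝ) a - D.base m a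

/-- A measure of the inconsistency of a message profile. -/
def incons (m : Fin I → Msg A) : ℝ :=
  ∑ k, dist (m k).2.1 (m (D.next k)).2.2.1 + Metric.infDist (D.state m) D.Φ +
    ∑ j, ∑ a, D.gap m j a ^ 2

/-- The scale of the scoring rule. -/
def scale (A : Type) [Fintype A] (I : ℕ) : ℝ := 1 / (2 * Fintype.card A * I)

/-- The lottery that rewards the scored reports. -/
def score (m : Fin I → Msg A) : A → ℝ := fun a =>
  1 / Fintype.card A + scale A I * ∑ k, center ((m k).1 : A → ℝ) a

/-- The lottery chosen by the mechanism. -/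
def lottery (m : Fin I → Msg A) : A → ℝ := fun a =>
  D.base m a + 1 / (2 * I) * ∑ j, D.gap m j a +
    D.ε * D.incons m * (score m a - D.base m a)

/-- The outcome function of the mechanism. -/
def outcome [Nonempty A] (m : Fin I → Msg A) : OutcS A I :=
  (toLot (D.lottery m), (D.F (D.state m)).2)

/-- The price of proposing a lottery, and the cost of the scoring rule. -/
def transfer (i : Fin I) (m : Fin I → Msg A) : ℝ :=
  -(1 / (2 * I) * ∑ a, D.gap m i a * D.state m i a) -
    D.ε * D.incons m * (scale A I / 2 * ∑ a, ((m i).1 : A → ℝ) a ^ 2 + 2)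

/-- Utility net of the penalties for misreporting the predecessor. -/
def gross [Nonempty A] (w : Fin I → Θ → A → ℝ) (i : Fin I) (θ : Θ) (m : Fin I → Msg A) : ℝ :=
  uP w i (D.outcome m) θ + D.transfer i m

/-- The utility effect, per unit of inconsistency, for an agent with utility vector `u`. -/
def effect (u : A → ℝ) (i : Fin I) (m : Fin I → Msg A) : ℝ :=
  ∑ a, u a * (score m a - D.base m a) - scale A I / 2 * ∑ a, ((m i).1 : A → ℝ) a ^ 2 - 2

/-- The inconsistency weights are small enough for `Design.lottery` to be a lottery. -/
def Small : Prop := 0 < D.ε ∧ ∀ m, D.ε * D.incons m ≤ 1 / 2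

variable {D} {m : Fin I → Msg A}

lemma base_mem : D.base m ∈ stdSimplex ℝ A := (D.F (D.state m)).1.2

lemma incons_nonneg : 0 ≤ D.incons m := by
  unfold incons
  have := Metric.infDist_nonneg (x := D.state m) (s := D.Φ)
  positivity

lemma incons_eq_zero_iff : D.incons m = 0 ↔
    (∀ k, (m k).2.1 = (m (D.next k)).2.2.1) ∧ Metric.infDist (D.state m) D.Φ = 0 ∧
      ∀ j a, ((m j).2.2.2 : A → ℝ) a = D.base m a := by
  have h0 := Metric.infDist_nonneg (x := D.state m) (s := D.Φ)
  have h1 : 0 ≤ ∑ k, dist (m k).2.1 (m (D.next k)).2.2.1 := by positivity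
  have h2 : 0 ≤ ∑ j, ∑ a, D.gap m j a ^ 2 := by positivity
  unfold incons
  rw [add_eq_zero_iff_of_nonneg (by positivity) h2, add_eq_zero_iff_of_nonneg h1 h0,
    Finset.sum_eq_zero_iff_of_nonneg (fun _ _ => dist_nonneg),
    Finset.sum_eq_zero_iff_of_nonneg (fun _ _ => by positivity)]
  simp [Finset.sum_eq_zero_iff_of_nonneg, sq_nonneg, gap, sub_eq_zero, and_assoc]

lemma scale_pos [Nonempty A] (i : Fin I) : 0 < scale A I := by
  have : 0 < I := i.pos
  unfold scale
  positivity

lemma scale_mul_card_le [Nonempty A] (i : Fin I) : scale A I * Fintype.card A ≤ 1 / 2 := by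
  have hI : (1 : ℝ) ≤ I := by exact_mod_cast i.pos
  have hA : (0 : ℝ) < Fintype.card A := by exact_mod_cast Fintype.card_pos
  unfold scale
  rw [div_mul_eq_mul_div, div_le_div_iff₀ (by positivity) (by norm_num)]
  nlinarith

lemma score_mem [Nonempty A] (hI : 0 < I) : score m ∈ stdSimplex ℝ A := by
  have hI' : (0 : ℝ) < I := by exact_mod_cast hI
  have hA : (0 : ℝ) < Fintype.card A := by exact_mod_cast Fintype.card_pos
  constructor
  · intro a
    have h : |∑ k, center ((m k).1 : A → ℝ) a| ≤ I * 2 :=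
      (Finset.abs_sum_le_sum_abs _ _).trans <|
        (Finset.sum_le_sum fun k _ => abs_center_le (m k).1.2 a).trans (by simp)
    have h2 : scale A I * (-(I * 2)) ≤ scale A I * ∑ k, center ((m k).1 : A → ℝ) a :=
      mul_le_mul_of_nonneg_left (abs_le.1 h).1 (scale_pos ⟨0, hI⟩).le
    have h3 : scale A I * (-(I * 2)) = -(1 / Fintype.card A) := by
      unfold scale; field_simp
    unfold score
    linarith
  · simp only [score, Finset.sum_add_distrib, ← Finset.mul_sum]
    rw [Finset.sum_comm]
    simp [sum_center]

lemma lottery_mem [Nonempty A] (hD : D.Small) (hI : 0 < I) : D.lottery m ∈ stdSimplex ℝ A := by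
  have hI' : (0 : ℝ) < I := by exact_mod_cast hI
  have he : 0 ≤ D.ε * D.incons m := mul_nonneg hD.1.le incons_nonneg
  have h : ∀ a, D.lottery m a = (1 / 2 - D.ε * D.incons m) * D.base m a +
      1 / (2 * I) * ∑ j, ((m j).2.2.2 : A → ℝ) a + D.ε * D.incons m * score m a := by
    intro a
    simp only [lottery, gap, Finset.sum_sub_distrib, Finset.sum_const, Finset.card_univ,
      Fintype.card_fin, nsmul_eq_mul]
    field_simp
    ring
  constructor
  · intro a
    rw [h]
    have h1 := base_mem (D := D) (m := m).1 a
    have h2 := (score_mem (m := m) hI).1 a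
    have h3 : 0 ≤ ∑ j, ((m j).2.2.2 : A → ℝ) a := Finset.sum_nonneg fun j _ => (m j).2.2.2.2.1 a
    have h4 := hD.2 m
    have h5 : 0 ≤ (1 / 2 - D.ε * D.incons m) * D.base m a := mul_nonneg (by linarith) h1
    positivity
  · simp only [h, Finset.sum_add_distrib, ← Finset.mul_sum, base_mem.2, (score_mem hI).2]
    rw [Finset.sum_comm]
    have h5 : ∀ j, ∑ a, ((m j).2.2.2 : A → ℝ) a = 1 := fun j => (m j).2.2.2.2.2
    simp only [h5, Finset.sum_const, Finset.card_univ, Fintype.card_fin, nsmul_eq_mul]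
    field_simp
    ring

lemma effect_le [Nonempty A] {u : A → ℝ} (hu : ∀ a, u a ∈ Set.Icc (0 : ℝ) 1) (i : Fin I) :
    D.effect u i m ≤ -1 := by
  have h1 := (sum_mul_lot_mem_Icc hu (score_mem (m := m) i.pos)).2
  have h2 := (sum_mul_lot_mem_Icc hu (base_mem (D := D) (m := m))).1
  have h3 : 0 ≤ scale A I / 2 * ∑ a, ((m i).1 : A → ℝ) a ^ 2 :=
    mul_nonneg (half_pos (scale_pos i)).le (by positivity)
  simp only [effect, mul_sub, Finset.sum_sub_distrib]
  linarith

lemma le_effect [Nonempty A] {u : A → ℝ} (hu : ∀ a, u a ∈ Set.Icc (0 : ℝ) 1) (i : Fin I) :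
    -4 ≤ D.effect u i m := by
  have h1 := (sum_mul_lot_mem_Icc hu (score_mem (m := m) i.pos)).1
  have h2 := (sum_mul_lot_mem_Icc hu (base_mem (D := D) (m := m))).2
  have h3 : ∑ a, ((m i).1 : A → ℝ) a ^ 2 ≤ Fintype.card A := by
    calc _ ≤ ∑ _a : A, (1 : ℝ) := Finset.sum_le_sum fun a _ =>
          (sq_le_one_iff_abs_le_one _).2 (abs_le.2 ⟨(m i).1.2.1 a, (m i).1.2.2 a⟩)
      _ = _ := by simp
  have h4 : scale A I / 2 * ∑ a, ((m i).1 : A → ℝ) a ^ 2 ≤ scale A I / 2 * Fintype.card A :=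
    mul_le_mul_of_nonneg_left h3 (half_pos (scale_pos i)).le
  have h5 := scale_mul_card_le (A := A) i
  simp only [effect, mul_sub, Finset.sum_sub_distrib]
  linarith

lemma gross_eq [Nonempty A] (hD : D.Small) (w : Fin I → Θ → A → ℝ) (i : Fin I) (θ : Θ) :
    D.gross w i θ m = uP w i (D.F (D.state m)) θ +
      1 / (2 * I) * ∑ j, ∑ a, D.gap m j a * w i θ a -
      1 / (2 * I) * ∑ a, D.gap m i a * D.state m i a +
      D.ε * D.incons m * D.effect (w i θ) i m := by
  have h : ∑ a, D.lottery m a * w i θ a = ∑ a, D.base m a * w i θ a +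
      1 / (2 * I) * ∑ j, ∑ a, D.gap m j a * w i θ a +
      D.ε * D.incons m * ∑ a, w i θ a * (score m a - D.base m a) := by
    rw [Finset.sum_comm]
    simp only [Finset.mul_sum, ← Finset.sum_add_distrib]
    refine Finset.sum_congr rfl fun a _ => ?_
    simp only [lottery, ← Finset.mul_sum, ← Finset.sum_mul]
    ring
  simp only [gross, uP, outcome, coe_toLot (lottery_mem hD i.pos), h, transfer, effect, base]
  ring

section Update

variable {i : Fin I} {x : Msg A}

lemma _root_.sum_apply_update {β : Type} (q : Fin I → β → ℝ) (m : Fin I → β) (i : Fin I) (x : β) :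
    ∑ j, q j (Function.update m i x j) = ∑ j, q j (m j) + (q i x - q i (m i)) := by
  rw [← Finset.add_sum_erase _ _ (Finset.mem_univ i),
    ← Finset.add_sum_erase Finset.univ (fun j => q j (m j)) (Finset.mem_univ i),
    Function.update_self, Finset.sum_congr rfl fun j hj => by
      rw [Function.update_of_ne (Finset.ne_of_mem_erase hj)]]
  ring

lemma update_announcement (hb : x.2.2.1 = (m i).2.2.1) (k : Fin I) :
    (Function.update m i x k).2.2.1 = (m k).2.2.1 := by
  rcases eq_or_ne k i with rfl | hk
  · simpa using hb
  · simp [hk]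

lemma state_update (hb : x.2.2.1 = (m i).2.2.1) :
    D.state (Function.update m i x) = D.state m :=
  funext fun _ => congrArg Subtype.val (update_announcement hb _)

lemma base_update (hb : x.2.2.1 = (m i).2.2.1) :
    D.base (Function.update m i x) = D.base m := by
  simp only [base, state_update hb]

lemma incons_update (hb : x.2.2.1 = (m i).2.2.1) :
    D.incons (Function.update m i x) = D.incons m +
      (dist x.2.1 (m (D.next i)).2.2.1 - dist (m i).2.1 (m (D.next i)).2.2.1) +
      (∑ a, ((x.2.2.2 : A → ℝ) a - D.base m a) ^ 2 - ∑ a, D.gap m i a ^ 2) := by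
  simp only [incons, gap, base_update hb, state_update hb, update_announcement hb]
  rw [sum_apply_update (fun k (y : Msg A) => dist y.2.1 (m (D.next k)).2.2.1),
    sum_apply_update (fun _ (y : Msg A) => ∑ a, ((y.2.2.2 : A → ℝ) a - D.base m a) ^ 2)]
  ring

lemma effect_update (hb : x.2.2.1 = (m i).2.2.1) (u : A → ℝ) :
    D.effect u i (Function.update m i x) = D.effect u i m +
      scale A I / 2 * (∑ a, (((m i).1 : A → ℝ) a - center u a) ^ 2 -
        ∑ a, ((x.1 : A → ℝ) a - center u a) ^ 2) := by
  have h : ∀ a, score (Function.update m i x) a =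
      score m a + scale A I * (center (x.1 : A → ℝ) a - center ((m i).1 : A → ℝ) a) := by
    intro a
    simp only [score]
    rw [sum_apply_update (fun _ (y : Msg A) => center (y.1 : A → ℝ) a)]
    ring
  have hs : ∑ a, u a * (score (Function.update m i x) a - D.base m a) =
      ∑ a, u a * (score m a - D.base m a) + scale A I *
        (∑ a, center u a * (x.1 : A → ℝ) a - ∑ a, center u a * ((m i).1 : A → ℝ) a) := by
    rw [← sum_mul_center, ← sum_mul_center]
    simp only [h, Finset.mul_sum, ← Finset.sum_sub_distrib, ← Finset.sum_add_distrib]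
    exact Finset.sum_congr rfl fun a _ => by ring
  simp only [effect, base_update hb, hs, Function.update_self]
  have hq : ∀ v : A → ℝ, ∑ a, (v a - center u a) ^ 2 =
      ∑ a, v a ^ 2 - 2 * ∑ a, center u a * v a + ∑ a, center u a ^ 2 := by
    intro v
    simp only [Finset.mul_sum, ← Finset.sum_sub_distrib, ← Finset.sum_add_distrib]
    exact Finset.sum_congr rfl fun a _ => by ring
  rw [hq, hq]
  ring

lemma gross_update [Nonempty A] (hD : D.Small) (w : Fin I → Θ → A → ℝ) (θ : Θ)
    (hb : x.2.2.1 = (m i).2.2.1) :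
    D.gross w i θ (Function.update m i x) = D.gross w i θ m +
      1 / (2 * I) * ∑ a, ((x.2.2.2 : A → ℝ) a - ((m i).2.2.2 : A → ℝ) a) *
        (w i θ a - D.state m i a) +
      (D.ε * D.incons (Function.update m i x) * D.effect (w i θ) i (Function.update m i x) -
        D.ε * D.incons m * D.effect (w i θ) i m) := by
  rw [gross_eq hD, gross_eq hD]
  simp only [gap, base_update hb, state_update hb, Function.update_self]
  rw [sum_apply_update (fun _ (y : Msg A) =>
    ∑ a, ((y.2.2.2 : A → ℝ) a - D.base m a) * w i θ a)]
  have h : ∑ a, ((x.2.2.2 : A → ℝ) a - ((m i).2.2.2 : A → ℝ) a) * (w i θ a - D.state m i a) =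
      (∑ a, ((x.2.2.2 : A → ℝ) a - D.base m a) * w i θ a -
        ∑ a, (((m i).2.2.2 : A → ℝ) a - D.base m a) * w i θ a) -
      (∑ a, ((x.2.2.2 : A → ℝ) a - D.base m a) * D.state m i a -
        ∑ a, (((m i).2.2.2 : A → ℝ) a - D.base m a) * D.state m i a) := by
    simp only [← Finset.sum_sub_distrib]
    exact Finset.sum_congr rfl fun a _ => by ring
  rw [h]
  ring

end Update

/-- The penalty of agent `i` for its announcement about its predecessor, normalized to vanish at
consistent profiles. -/
def tax (D : Design A I) (ρ : Fin I → Cube A → Cube A → ℝ) (i : Fin I) (m : Fin I → Msg A) : ℝ :=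
  ρ i (m i).2.2.1 (m (D.next.symm i)).1 -
    ρ i (m (D.next.symm i)).2.1 (m (D.next.symm i)).1

/-- The total payoff of agent `i`. -/
def payoff [Nonempty A] (D : Design A I) (ρ : Fin I → Cube A → Cube A → ℝ)
    (w : Fin I → Θ → A → ℝ) (θ : Θ) (i : Fin I) (m : Fin I → Msg A) : ℝ :=
  D.gross w i θ m - D.tax ρ i m

/-- The message `x` with the announcement about the predecessor replaced by `b`. -/
def announce (x : Msg A) (b : Cube A) : Msg A := (x.1, x.2.1, b, x.2.2.2)

/-- The standing assumptions on a design. -/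
structure Admissible [Nonempty A] (D : Design A I) (ρ : Fin I → Cube A → Cube A → ℝ)
    (w : Fin I → Θ → A → ℝ) : Prop where
  small : D.Small
  next_ne : ∀ i, D.next i ≠ i
  util : ∀ i θ a, w i θ a ∈ Set.Icc (0 : ℝ) 1
  penalty_self : ∀ i b, ρ i b b = 0
  penalty : ∀ i θ m b b', D.gross w i θ (Function.update m i (announce (m i) b)) + dist b b' ≤
    D.gross w i θ (Function.update m i (announce (m i) b')) + ρ i b b'

/-- A product of message sets on which weakly improving deviations do not strictly improve. -/
def Stable {M : Type} (pay : Fin I → (Fin I → M) → ℝ) (S : Fin I → Set M) : Prop :=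
  ∀ i m, (∀ j, m j ∈ S j) → ∀ x, (∀ n : Fin I → M, (∀ j, n j ∈ S j) → n i = m i →
    pay i n ≤ pay i (Function.update n i x)) → pay i (Function.update m i x) ≤ pay i m

lemma _root_.update_mem_of_forall_mem {M : Type} {S : Fin I → Set M} {m : Fin I → M}
    (hm : ∀ j, m j ∈ S j) {k : Fin I} {x : M} (hx : x ∈ S k) (j : Fin I) :
    Function.update m k x j ∈ S j := by
  rcases eq_or_ne j k with rfl | hj
  · simpa using hx
  · simpa [hj] using hm j

/-- Two messages coinciding up to the scored report. -/
def SameAnnouncement (x y : Msg A) : Prop := x.2 = y.2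

lemma incons_congr (hnn : ∀ k, SameAnnouncement (m k) ((n : Fin I → Msg A) k)) :
    D.incons m = D.incons n := by
  unfold SameAnnouncement at hnn
  have hst : D.state m = D.state n := funext fun k => by simp only [state, hnn]
  simp only [incons, gap, base, hst, hnn]

/-- At consistent profiles, the announcements of an agent are determined by those of the
others. -/
lemma sameAnnouncement_of_incons_eq_zero (hs : ∀ i, D.next i ≠ i) {k : Fin I} {x : Msg A}
    (hm : D.incons m = 0) (hx : D.incons (Function.update m k x) = 0) :
    SameAnnouncement x (m k) := by
  obtain ⟨h1, -, h3⟩ := incons_eq_zero_iff.1 hm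
  obtain ⟨h1', -, h3'⟩ := incons_eq_zero_iff.1 hx
  have hb : x.2.2.1 = (m k).2.2.1 := by
    have e1 := h1 (D.next.symm k)
    have e2 := h1' (D.next.symm k)
    have hne : D.next.symm k ≠ k := fun h => hs k (by rw [← h, Equiv.apply_symm_apply, h])
    simp only [Equiv.apply_symm_apply, Function.update_self, Function.update_of_ne hne] at e1 e2
    rw [← e2, e1]
  have ha : x.2.1 = (m k).2.1 := by
    have e2 := h1' k
    rw [Function.update_self, Function.update_of_ne (hs k)] at e2
    rw [e2, h1 k]
  have hl : x.2.2.2 = (m k).2.2.2 := by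
    refine Subtype.ext (funext fun a => ?_)
    have e2 := h3' k a
    rw [Function.update_self, base_update hb] at e2
    exact e2.trans (h3 k a).symm
  exact Prod.ext ha (Prod.ext hb hl)

namespace Admissible

variable [Nonempty A] {ρ : Fin I → Cube A → Cube A → ℝ} {w : Fin I → Θ → A → ℝ} {θ : Θ}
  {S : Fin I → Set (Msg A)} {i : Fin I} {x : Msg A}

lemma symm_ne (h : D.Admissible ρ w) (i : Fin I) : D.next.symm i ≠ i := fun hi =>
  h.next_ne i (by nth_rw 1 [← hi]; simp)

/-- The centered type of agent `i` as an element of the cube. -/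
def type (h : D.Admissible ρ w) (i : Fin I) (θ : Θ) : Cube A :=
  ⟨center (w i θ), center_mem_Icc (h.util i θ)⟩

lemma payoff_update (h : D.Admissible ρ w) (hb : x.2.2.1 = (m i).2.2.1) :
    D.payoff ρ w θ i (Function.update m i x) = D.payoff ρ w θ i m +
      1 / (2 * I) * ∑ a, ((x.2.2.2 : A → ℝ) a - ((m i).2.2.2 : A → ℝ) a) *
        (w i θ a - D.state m i a) +
      (D.ε * D.incons (Function.update m i x) * D.effect (w i θ) i (Function.update m i x) -
        D.ε * D.incons m * D.effect (w i θ) i m) := by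
  simp only [payoff, gross_update h.small w θ hb, tax, Function.update_self,
    Function.update_of_ne (h.symm_ne i), hb]
  ring

/-- Announcing the scored report of the predecessor is strictly optimal. -/
lemma payoff_announce (h : D.Admissible ρ w) (i : Fin I) (m : Fin I → Msg A) :
    D.payoff ρ w θ i m + dist (m i).2.2.1 (m (D.next.symm i)).1 ≤
      D.payoff ρ w θ i
        (Function.update m i (announce (m i) (m (D.next.symm i)).1)) := by
  have h1 := h.penalty i θ m (m i).2.2.1 (m (D.next.symm i)).1
  have h2 : announce (m i) (m i).2.2.1 = m i := rfl
  rw [h2, Function.update_eq_self] at h1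
  simp only [payoff, tax, Function.update_self, Function.update_of_ne (h.symm_ne i), announce,
    h.penalty_self] at h1 ⊢
  linarith

/-- A report that affects the outcome with positive probability is truthful. -/
lemma report_eq (h : D.Admissible ρ w) (hS : Stable (D.payoff ρ w θ) S)
    (hm : ∀ j, m j ∈ S j) (he : D.incons m ≠ 0) (i : Fin I) : (m i).1 = h.type i θ := by
  have key : ∀ n : Fin I → Msg A, n i = m i →
      D.payoff ρ w θ i (Function.update n i (h.type i θ, (m i).2)) = D.payoff ρ w θ i n +
        D.ε * D.incons n * (scale A I / 2 * ∑ a, (((m i).1 : A → ℝ) a - center (w i θ) a) ^ 2) := by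
    intro n hn
    have hinc : D.incons (Function.update n i (h.type i θ, (m i).2)) = D.incons n := by
      refine incons_congr fun k => ?_
      rcases eq_or_ne k i with rfl | hk
      · simp [SameAnnouncement, hn]
      · simp [SameAnnouncement, hk]
    rw [h.payoff_update (by rw [hn]), effect_update (by rw [hn]), hinc, hn]
    simp [type]
    ring
  have hε := h.small.1
  have hsc := scale_pos (A := A) i
  have hle := hS i m hm (h.type i θ, (m i).2) fun n _ hn => by
    rw [key n hn]
    have := incons_nonneg (D := D) (m := n)
    have : 0 ≤ D.ε * D.incons n * (scale A I / 2 *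
        ∑ a, (((m i).1 : A → ℝ) a - center (w i θ) a) ^ 2) := by positivity
    linarith
  rw [key m rfl] at hle
  have hpos : 0 < D.incons m := lt_of_le_of_ne incons_nonneg (Ne.symm he)
  have h0 : ∑ a, (((m i).1 : A → ℝ) a - center (w i θ) a) ^ 2 ≤ 0 := by
    by_contra! hlt
    have : 0 < D.ε * D.incons m * (scale A I / 2 *
        ∑ a, (((m i).1 : A → ℝ) a - center (w i θ) a) ^ 2) := by positivity
    linarith
  have h1 := (Finset.sum_eq_zero_iff_of_nonneg fun _ _ => by positivity).1
    (le_antisymm h0 (by positivity))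
  refine Subtype.ext (funext fun a => ?_)
  have := h1 a (Finset.mem_univ a)
  exact sub_eq_zero.1 (pow_eq_zero_iff two_ne_zero |>.1 this)

/-- If the predecessor always makes the same scored report, it is announced. -/
lemma announcement_eq (h : D.Admissible ρ w) (hS : Stable (D.payoff ρ w θ) S) {t : Cube A}
    (ht : ∀ n : Fin I → Msg A, (∀ j, n j ∈ S j) → (n (D.next.symm i)).1 = t)
    (hm : ∀ j, m j ∈ S j) : (m i).2.2.1 = t := by
  have key : ∀ n : Fin I → Msg A, (∀ j, n j ∈ S j) → n i = m i →
      D.payoff ρ w θ i n + dist (m i).2.2.1 t ≤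
        D.payoff ρ w θ i (Function.update n i (announce (m i) t)) := by
    intro n hn hni
    have := h.payoff_announce (θ := θ) i n
    rwa [ht n hn, hni] at this
  have hle := hS i m hm (announce (m i) t) fun n hn hni =>
    (le_add_of_nonneg_right dist_nonneg).trans (key n hn hni)
  have := key m hm rfl
  exact dist_le_zero.1 (by linarith)

/-- If the announcement about `i` is always the same, `i` announces the same about itself. -/
lemma own_eq (h : D.Admissible ρ w) (hS : Stable (D.payoff ρ w θ) S) {t : Cube A}
    (ht : ∀ n : Fin I → Msg A, (∀ j, n j ∈ S j) → (n (D.next i)).2.2.1 = t)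
    (hm : ∀ j, m j ∈ S j) : (m i).2.1 = t := by
  have hε := h.small.1
  have key : ∀ n : Fin I → Msg A, (∀ j, n j ∈ S j) → n i = m i →
      D.payoff ρ w θ i n + D.ε * dist (m i).2.1 t ≤
        D.payoff ρ w θ i (Function.update n i ((m i).1, t, (m i).2.2)) := by
    intro n hn hni
    have hb : ((m i).1, t, (m i).2.2).2.2.1 = (n i).2.2.1 := by rw [hni]
    have heff := effect_le (D := D) (m := n) (h.util i θ) i
    rw [h.payoff_update hb, incons_update hb, effect_update hb, ht n hn, hni]
    simp only [gap, hni, dist_self, sub_self, zero_mul, Finset.sum_const_zero, mul_zero, add_zero,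
      zero_sub]
    nlinarith [mul_nonneg hε.le (dist_nonneg (x := (m i).2.1) (y := t))]
  have hle := hS i m hm ((m i).1, t, (m i).2.2) fun n hn hni => by
    have := key n hn hni
    have := mul_nonneg hε.le (dist_nonneg (x := (m i).2.1) (y := t))
    linarith
  have := key m hm rfl
  exact dist_le_zero.1 (by nlinarith)

/-- If all scored reports are truthful, there are no inconsistencies. -/
lemma incons_eq_zero_of_truthful (h : D.Admissible ρ w) (hS : Stable (D.payoff ρ w θ) S)
    (hΦ : (fun k => center (w k θ)) ∈ D.Φ)
    (ht : ∀ n : Fin I → Msg A, (∀ j, n j ∈ S j) → ∀ k, (n k).1 = h.type k θ)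
    (hm : ∀ j, m j ∈ S j) : D.incons m = 0 := by
  have hε := h.small.1
  have hb : ∀ n : Fin I → Msg A, (∀ j, n j ∈ S j) → ∀ k,
      (n (D.next k)).2.2.1 = h.type k θ := fun n hn k =>
    h.announcement_eq hS (fun n' hn' => by rw [Equiv.symm_apply_apply]; exact ht n' hn' k) hn
  have hst : ∀ n : Fin I → Msg A, (∀ j, n j ∈ S j) →
      D.state n = fun k => center (w k θ) := fun n hn =>
    funext fun k => congrArg Subtype.val (hb n hn k)
  have hown : ∀ n : Fin I → Msg A, (∀ j, n j ∈ S j) → ∀ k, (n k).2.1 = h.type k θ :=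
    fun n hn k => h.own_eq hS (fun n' hn' => hb n' hn' k) hn
  refine incons_eq_zero_iff.2 ⟨fun k => by rw [hown m hm, hb m hm], ?_, fun i => ?_⟩
  · rw [hst m hm]
    exact Metric.infDist_zero_of_mem hΦ
  let x : Msg A := ((m i).1, (m i).2.1, (m i).2.2.1, (D.F (D.state m)).1)
  have key : ∀ n : Fin I → Msg A, (∀ j, n j ∈ S j) → n i = m i →
      D.payoff ρ w θ i n + D.ε * ∑ a, D.gap m i a ^ 2 ≤
        D.payoff ρ w θ i (Function.update n i x) := by
    intro n hn hni
    have hxb : x.2.2.1 = (n i).2.2.1 := by simp only [x, hni]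
    have heff := effect_le (D := D) (m := n) (h.util i θ) i
    have hbase : D.base n = D.base m := by simp only [base, hst n hn, hst m hm]
    have hsum := sum_sub_mul_sub_center x.2.2.2 (n i).2.2.2 (w i θ)
    rw [h.payoff_update hxb, incons_update hxb, effect_update hxb, hst n hn, hsum]
    have hx0 : ∑ a, ((x.2.2.2 : A → ℝ) a - D.base n a) ^ 2 = 0 :=
      Finset.sum_eq_zero fun a _ => by rw [hbase]; simp [x, base]
    have hgap : ∑ a, D.gap n i a ^ 2 = ∑ a, D.gap m i a ^ 2 := by simp only [gap, hni, hbase]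
    have hg : 0 ≤ D.ε * ∑ a, D.gap m i a ^ 2 := by positivity
    rw [hx0, hgap, hni]
    simp only [x, sub_self, mul_zero, add_zero, zero_sub]
    nlinarith
  have hg : 0 ≤ ∑ a, D.gap m i a ^ 2 := by positivity
  have hle := hS i m hm x fun n hn hni => by
    have := key n hn hni
    have := mul_nonneg hε.le hg
    linarith
  have h0 : ∑ a, D.gap m i a ^ 2 ≤ 0 := by
    have := key m hm rfl
    nlinarith
  intro a
  have := (Finset.sum_eq_zero_iff_of_nonneg fun _ _ => by positivity).1 (le_antisymm h0 hg) a
    (Finset.mem_univ a)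
  exact sub_eq_zero.1 (pow_eq_zero_iff two_ne_zero |>.1 this)

/-- There are no inconsistencies in equilibrium. -/
lemma incons_eq_zero (h : D.Admissible ρ w) (hS : Stable (D.payoff ρ w θ) S)
    (hΦ : (fun k => center (w k θ)) ∈ D.Φ) (hm : ∀ j, m j ∈ S j) : D.incons m = 0 := by
  by_cases ht : ∀ n : Fin I → Msg A, (∀ j, n j ∈ S j) → ∀ k, (n k).1 = h.type k θ
  · exact h.incons_eq_zero_of_truthful hS hΦ ht hm
  by_contra hne
  push Not at ht
  obtain ⟨n₀, hn₀, i, hi⟩ := ht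
  have hε := h.small.1
  -- The message `y` of agent `i` is consistent with everything the others do.
  set y := n₀ i with hy
  have hyS : y ∈ S i := hn₀ i
  have hcons : ∀ n : Fin I → Msg A, (∀ j, n j ∈ S j) → n i = y → D.incons n = 0 := by
    intro n hn hni
    by_contra hc
    exact hi (by rw [← hni]; exact h.report_eq hS hn hc i)
  have hmyS := update_mem_of_forall_mem hm hyS
  have hmy := hcons _ hmyS (by simp)
  -- Hence all other agents use a single message.
  have hsame : ∀ k, k ≠ i → ∀ z ∈ S k, z = m k := by
    intro k hk z hz
    have h1 := sameAnnouncement_of_incons_eq_zero h.next_ne hmy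
      (hcons _ (update_mem_of_forall_mem hmyS hz) (by simp [hk.symm]))
    rw [Function.update_of_ne hk] at h1
    have h2 : D.incons (Function.update m k z) = D.incons m := by
      refine incons_congr fun j => ?_
      rcases eq_or_ne j k with rfl | hj
      · simpa using h1
      · simp [SameAnnouncement, hj]
    have h3 := h.report_eq hS (update_mem_of_forall_mem hm hz) (h2 ▸ hne) k
    rw [Function.update_self] at h3
    exact Prod.ext (h3.trans (h.report_eq hS hm hne k).symm) h1
  have hfix : ∀ n : Fin I → Msg A, (∀ j, n j ∈ S j) → n = Function.update m i (n i) := by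
    intro n hn
    refine funext fun k => ?_
    rcases eq_or_ne k i with rfl | hk
    · simp
    · simpa [hk] using hsame k hk _ (hn k)
  have hbest : ∀ x, ∀ z ∈ S i, D.payoff ρ w θ i (Function.update m i x) ≤
      D.payoff ρ w θ i (Function.update m i z) := by
    intro x z hz
    by_contra! hlt
    have := hS i _ (update_mem_of_forall_mem hm hz) x fun n hn hni => by
      rw [hfix n hn, hni, Function.update_idem, Function.update_self]
      exact hlt.le
    rw [Function.update_idem] at this
    linarith
  have hb : ∀ n : Fin I → Msg A, (∀ j, n j ∈ S j) →
      (n i).2.2.1 = (m (D.next.symm i)).1 := fun n hn =>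
    h.announcement_eq hS (fun n' hn' => by rw [hsame _ (h.symm_ne i) _ (hn' _)]) hn
  have ha : ∀ n : Fin I → Msg A, (∀ j, n j ∈ S j) →
      (n i).2.1 = (m (D.next i)).2.2.1 := fun n hn =>
    h.own_eq hS (fun n' hn' => by rw [hsame _ (h.next_ne i) _ (hn' _)]) hn
  have hby : (m i).2.2.1 = y.2.2.1 := by rw [hb m hm, hy, hb n₀ hn₀]
  have hay : (m i).2.1 = y.2.1 := by rw [ha m hm, hy, ha n₀ hn₀]
  -- So agent `i` mixes between proposing different lotteries, against strict concavity.
  set n := Function.update m i y with hn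
  have hni : n i = y := by simp [hn]
  have hmn : m = Function.update n i (m i) := by simp [hn]
  have hl := (incons_eq_zero_iff.1 hmy).2.2 i
  obtain ⟨x, hx1, hxa, hxb, hxl⟩ : ∃ x : Msg A, x.1 = (m i).1 ∧ x.2.1 = y.2.1 ∧
      x.2.2.1 = y.2.2.1 ∧ ∀ a, (x.2.2.2 : A → ℝ) a - (y.2.2.2 : A → ℝ) a =
        1 / 2 * (((m i).2.2.2 : A → ℝ) a - (y.2.2.2 : A → ℝ) a) := by
    refine ⟨((m i).1, y.2.1, y.2.2.1, ⟨(1 / 2 : ℝ) • ((m i).2.2.2 : A → ℝ) +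
      (1 / 2 : ℝ) • (y.2.2.2 : A → ℝ), convex_stdSimplex ℝ A (m i).2.2.2.2 y.2.2.2.2
        (by norm_num) (by norm_num) (by norm_num)⟩), rfl, rfl, rfl, fun a => ?_⟩
    change (1 / 2 * ((m i).2.2.2 : A → ℝ) a + 1 / 2 * (y.2.2.2 : A → ℝ) a) - _ = _
    ring
  have hlarge := h.payoff_update (θ := θ) (m := n) (x := m i) (by rw [hby, hni])
  have hhalf := h.payoff_update (θ := θ) (m := n) (x := x) (by rw [hxb, hni])
  have e1 := incons_update (D := D) (m := n) (x := m i) (by rw [hby, hni])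
  have e2 := incons_update (D := D) (m := n) (x := x) (by rw [hxb, hni])
  have q1 := effect_update (D := D) (m := n) (x := m i) (by rw [hby, hni]) (w i θ)
  have q2 := effect_update (D := D) (m := n) (x := x) (by rw [hxb, hni]) (w i θ)
  have hq : D.effect (w i θ) i (Function.update n i x) = D.effect (w i θ) i m := by
    rw [← hmn] at q1
    rw [q1, q2, hx1]
  have hbn : ∀ a, D.base n a = (y.2.2.2 : A → ℝ) a := fun a => by rw [← hl a, hni]
  rw [← hmn] at hlarge e1
  simp only [gap, hni, hbn, hmy, hxl, hay, hxa, sub_self, mul_pow, ← Finset.mul_sum, mul_assoc,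
    zero_pow two_ne_zero, Finset.sum_const_zero, sub_zero, add_zero, zero_add, zero_mul, mul_zero]
    at e1 e2 hlarge hhalf
  rw [hq, e2] at hhalf
  have c1 := hbest y (m i) (hm i)
  have c2 := hbest x y hyS
  rw [Function.update_eq_self, ← hn] at c1
  have hux : Function.update m i x = Function.update n i x := by simp [hn]
  rw [hux, ← hn] at c2
  have hpos : 0 < D.ε * D.incons m := mul_pos hε (lt_of_le_of_ne incons_nonneg (Ne.symm hne))
  have heff := effect_le (D := D) (m := m) (h.util i θ) i
  rw [← e1] at hhalf
  nlinarith

/-- In equilibrium, the announced profile leads to the outcome prescribed at the true state. -/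
lemma F_state_eq (h : D.Admissible ρ w) (hS : Stable (D.payoff ρ w θ) S)
    {f : Θ → OutcS A I} (hf : MaskinMonotoneP w f)
    (hΦ : D.Φ = Set.range fun θ' k => center (w k θ')) (hΦc : IsClosed D.Φ)
    (hF : ∀ θ', D.F (fun k => center (w k θ')) = f θ') (hm : ∀ j, m j ∈ S j) :
    D.F (D.state m) = f θ := by
  have hmem : (fun k => center (w k θ)) ∈ D.Φ := hΦ ▸ ⟨θ, rfl⟩
  have hzero : ∀ n : Fin I → Msg A, (∀ j, n j ∈ S j) → D.incons n = 0 := fun n hn =>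
    h.incons_eq_zero hS hmem hn
  obtain ⟨θ', hθ'⟩ : ∃ θ', (fun k => center (w k θ')) = D.state m := by
    have := (hΦc.mem_iff_infDist_zero ⟨_, hmem⟩).2 (incons_eq_zero_iff.1 (hzero m hm)).2.1
    rwa [hΦ] at this
  rw [← hθ', hF]
  by_contra hne
  obtain ⟨j, p, hp1, hp2⟩ := hf θ' θ hne
  have hstate : ∀ n : Fin I → Msg A, (∀ j, n j ∈ S j) → D.state n = D.state m := by
    intro n hn
    refine funext fun k => ?_
    have := sameAnnouncement_of_incons_eq_zero h.next_ne (hzero m hm)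
      (hzero _ (update_mem_of_forall_mem hm (hn (D.next k))))
    exact congrArg (fun z : Cube A × Cube A × Lot A => (z.2.1 : A → ℝ)) this
  have hbase : ∀ n : Fin I → Msg A, (∀ j, n j ∈ S j) → D.base n = ((f θ').1 : A → ℝ) := by
    intro n hn
    simp only [base, hstate n hn, ← hθ', hF]
  set q : Lot A := (f θ').1 with hq
  have hgain : 0 < ∑ a, ((p.1 : A → ℝ) a - (q : A → ℝ) a) * (w j θ a - center (w j θ') a) := by
    have h1 := sum_sub_mul_sub_center p.1 q (w j θ')
    simp only [uP, sub_mul, mul_sub, Finset.sum_sub_distrib] at hp1 hp2 h1 ⊢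
    linarith
  have hI : (0 : ℝ) < I := by exact_mod_cast j.pos
  have hε := h.small.1
  set G := 1 / (2 * I) * ∑ a, ((p.1 : A → ℝ) a - (q : A → ℝ) a) * (w j θ a - center (w j θ') a)
    with hG
  have hGpos : 0 < G := mul_pos (by positivity) hgain
  set V := D.ε * ∑ a, ((p.1 : A → ℝ) a - (q : A → ℝ) a) ^ 2 with hV
  have hVnn : 0 ≤ V := by positivity
  -- Agent `j` moves its proposal from `q` towards `p` by a small amount `t`.
  obtain ⟨t, ht0, ht1, ht⟩ : ∃ t : ℝ, 0 < t ∧ t ≤ 1 ∧ t * (4 * V) < G := by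
    refine ⟨min 1 (G / (4 * V + 1)), by positivity, min_le_left _ _, ?_⟩
    calc min 1 (G / (4 * V + 1)) * (4 * V) ≤ G / (4 * V + 1) * (4 * V) :=
          mul_le_mul_of_nonneg_right (min_le_right _ _) (by positivity)
      _ < G / (4 * V + 1) * (4 * V + 1) := by
          apply mul_lt_mul_of_pos_left (by linarith) (by positivity)
      _ = G := div_mul_cancel₀ _ (by positivity)
  obtain ⟨r, hr⟩ : ∃ r : Lot A, ∀ a, (r : A → ℝ) a - (q : A → ℝ) a =
      t * ((p.1 : A → ℝ) a - (q : A → ℝ) a) := by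
    refine ⟨⟨(1 - t) • (q : A → ℝ) + t • (p.1 : A → ℝ),
      convex_stdSimplex ℝ A q.2 p.1.2 (by linarith) ht0.le (by ring)⟩, fun a => ?_⟩
    change ((1 - t) * (q : A → ℝ) a + t * (p.1 : A → ℝ) a) - _ = _
    ring
  let x : Msg A := ((m j).1, (m j).2.1, (m j).2.2.1, r)
  have key : ∀ n : Fin I → Msg A, (∀ j, n j ∈ S j) → n j = m j →
      D.payoff ρ w θ j n + t * (G - t * (4 * V)) ≤
        D.payoff ρ w θ j (Function.update n j x) := by
    intro n hn hnj
    have hxb : x.2.2.1 = (n j).2.2.1 := by simp only [x, hnj]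
    have hl : ∀ a, ((n j).2.2.2 : A → ℝ) a = (q : A → ℝ) a := fun a => by
      rw [(incons_eq_zero_iff.1 (hzero n hn)).2.2 j a, hbase n hn]
    have hlm : ∀ a, ((m j).2.2.2 : A → ℝ) a = (q : A → ℝ) a := fun a => by rw [← hnj]; exact hl a
    have heff := le_effect (D := D) (m := Function.update n j x) (h.util j θ) j
    have hinc : D.ε * D.incons (Function.update n j x) = t ^ 2 * V := by
      rw [incons_update hxb, hzero n hn, hbase n hn]
      simp only [x, gap, hbase n hn, hlm, hnj, hr, mul_pow, ← Finset.mul_sum, hV, sub_self]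
      simp
      ring
    have hst : D.state n j = center (w j θ') := by rw [hstate n hn, ← hθ']
    rw [h.payoff_update hxb, hinc, hzero n hn, hst]
    simp only [x, hl, hr, mul_assoc, ← Finset.mul_sum]
    have e1 : 1 / (2 * (I : ℝ)) * (t * ∑ a, ((p.1 : A → ℝ) a - (q : A → ℝ) a) *
        (w j θ a - center (w j θ') a)) = t * G := by rw [hG]; ring
    rw [e1]
    nlinarith [mul_nonneg (sq_nonneg t) hVnn]
  have hpos : 0 < t * (G - t * (4 * V)) := mul_pos ht0 (by linarith)
  have hle := hS j m hm x fun n hn hnj => by linarith [key n hn hnj]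
  linarith [key m hm rfl]

/-- Truthful announcements are a pure equilibrium. -/
lemma payoff_update_truthful_le (h : D.Admissible ρ w)
    (hΦ : (fun k => center (w k θ)) ∈ D.Φ) (i : Fin I) (x : Msg A)
    (hm : m = fun k => (h.type k θ, h.type k θ, h.type (D.next.symm k) θ,
      (D.F fun k => center (w k θ)).1)) :
    D.payoff ρ w θ i (Function.update m i x) ≤ D.payoff ρ w θ i m := by
  have hst : D.state m = fun k => center (w k θ) := by
    funext k
    simp [hm, state, type]
  have hinc : D.incons m = 0 := by
    refine incons_eq_zero_iff.2 ⟨fun k => by simp [hm], ?_, fun j a => ?_⟩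
    · rw [hst]
      exact Metric.infDist_zero_of_mem hΦ
    · rw [base, hst, hm]
  have h1 := h.payoff_announce (θ := θ) i (Function.update m i x)
  rw [Function.update_idem, Function.update_self, Function.update_of_ne (h.symm_ne i)] at h1
  refine ((le_add_of_nonneg_right dist_nonneg).trans h1).trans ?_
  rw [h.payoff_update (by simp [announce, hm]), hst, sum_sub_mul_sub_center, hinc]
  have heff := effect_le (D := D)
    (m := Function.update m i (announce x (m (D.next.symm i)).1)) (h.util i θ) i
  have hn := mul_nonneg h.small.1.le
    (incons_nonneg (D := D) (m := Function.update m i (announce x (m (D.next.symm i)).1)))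
  nlinarith

end Admissible

lemma continuous_state : Continuous D.state := by
  unfold state
  fun_prop

lemma continuous_base (hF : Continuous D.F) : Continuous D.base :=
  continuous_subtype_val.comp (continuous_fst.comp (hF.comp continuous_state))

lemma continuous_gap (hF : Continuous D.F) (j : Fin I) : Continuous fun m => D.gap m j := by
  have hl : Continuous fun m : Fin I → Msg A => (m j).2.2.2 := by fun_prop
  exact continuous_pi fun a => ((continuous_apply a).comp (continuous_subtype_val.comp hl)).sub
    ((continuous_apply a).comp (continuous_base hF))

lemma continuous_incons (hF : Continuous D.F) : Continuous D.incons := by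
  have := continuous_gap hF
  have hd : Continuous fun m => Metric.infDist (D.state m) D.Φ :=
    (Metric.continuous_infDist_pt _).comp continuous_state
  unfold incons
  fun_prop

lemma continuous_lottery (hF : Continuous D.F) : Continuous D.lottery := by
  have h1 := continuous_base hF
  have h2 := continuous_gap hF
  have h3 := continuous_incons hF
  have h4 : Continuous (score : (Fin I → Msg A) → A → ℝ) := by
    have := continuous_center (A := A)
    unfold score
    fun_prop
  unfold lottery
  fun_prop

lemma continuous_outcome [Nonempty A] (hF : Continuous D.F) : Continuous D.outcome :=
  (continuous_toLot.comp (continuous_lottery hF)).prodMk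
    (continuous_snd.comp (hF.comp continuous_state))

lemma continuous_transfer (hF : Continuous D.F) (i : Fin I) : Continuous (D.transfer i) := by
  have h1 : ∀ a, Continuous fun m => D.gap m i a := continuous_pi_iff.1 (continuous_gap hF i)
  have h2 := continuous_incons hF
  have h3 : ∀ a, Continuous fun m => D.state m i a :=
    continuous_pi_iff.1 (continuous_pi_iff.1 continuous_state i)
  have h4 : ∀ a, Continuous fun m : Fin I → Msg A => ((m i).1 : A → ℝ) a := fun a =>
    (continuous_apply a).comp (continuous_subtype_val.comp (by fun_prop))
  unfold transfer
  fun_prop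

lemma continuous_tax {ρ : Fin I → Cube A → Cube A → ℝ}
    (hρ : ∀ i, Continuous fun x : Cube A × Cube A => ρ i x.1 x.2) (i : Fin I) :
    Continuous (D.tax ρ i) :=
  ((hρ i).comp (f := fun m : Fin I → Msg A => ((m i).2.2.1, (m (D.next.symm i)).1))
    (by fun_prop)).sub
  ((hρ i).comp (f := fun m : Fin I → Msg A =>
    ((m (D.next.symm i)).2.1, (m (D.next.symm i)).1)) (by fun_prop))

lemma _root_.continuous_uP [TopologicalSpace Θ] {w : Fin I → Θ → A → ℝ}
    (hw : ∀ i a, Continuous fun θ => w i θ a) (i : Fin I) :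
    Continuous fun y : OutcS A I × Θ => uP w i y.1 y.2 := by
  unfold uP
  refine Continuous.add (continuous_finsetSum _ fun a _ => Continuous.mul ?_ ?_) (by fun_prop)
  · exact (continuous_apply a).comp (continuous_subtype_val.comp
      (continuous_fst.comp continuous_fst))
  · exact (hw i a).comp continuous_snd

lemma continuous_gross [Nonempty A] [TopologicalSpace Θ] {w : Fin I → Θ → A → ℝ}
    (hF : Continuous D.F) (hw : ∀ i a, Continuous fun θ => w i θ a) (i : Fin I) :
    Continuous fun y : (Fin I → Msg A) × Θ => D.gross w i y.2 y.1 :=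
  ((continuous_uP hw i).comp (((continuous_outcome hF).comp continuous_fst).prodMk
    continuous_snd)).add ((continuous_transfer hF i).comp continuous_fst)

lemma exists_small (D : Design A I) (hF : Continuous D.F) :
    ∃ ε, Small { D with ε := ε } := by
  obtain ⟨N, hN⟩ := (isCompact_univ (X := Fin I → Msg A)).exists_bound_of_continuousOn
    (continuous_incons hF).continuousOn
  have hpos : 0 < |N| + 1 := by positivity
  refine ⟨1 / (2 * (|N| + 1)), by positivity, fun m => ?_⟩
  have h1 : D.incons m ≤ |N| + 1 :=
    ((le_abs_self _).trans (hN m trivial)).trans ((le_abs_self N).trans (by linarith))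
  calc 1 / (2 * (|N| + 1)) * D.incons m ≤ 1 / (2 * (|N| + 1)) * (|N| + 1) :=
        mul_le_mul_of_nonneg_left h1 (by positivity)
    _ = 1 / 2 := by field_simp

/-- The mechanism induced by a design. -/
def mechanism [Nonempty A] (D : Design A I) (ρ : Fin I → Cube A → Cube A → ℝ) :
    MechT (OutcS A I) I where
  M _ := Msg A
  topM _ := inferInstance
  nonemptyM _ := ⟨⟨0, by simp, by simp⟩, ⟨0, by simp, by simp⟩, ⟨0, by simp, by simp⟩,
    toLot 0⟩
  g := D.outcome
  τ i m := D.transfer i m - D.tax ρ i m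

lemma payT_mechanism [Nonempty A] (D : Design A I) (ρ : Fin I → Cube A → Cube A → ℝ)
    (w : Fin I → Θ → A → ℝ) (θ : Θ) :
    payT w (D.mechanism ρ) θ = D.payoff ρ w θ := by
  funext i m
  exact (add_sub_assoc _ _ _).symm

/-- At consistent profiles the mechanism chooses the announced outcome without transfers. -/
lemma mechanism_of_incons_eq_zero [Nonempty A] (D : Design A I)
    (ρ : Fin I → Cube A → Cube A → ℝ) (hm : D.incons m = 0) :
    (D.mechanism ρ).g m = D.F (D.state m) ∧ ∀ i, (D.mechanism ρ).τ i m = 0 := by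
  obtain ⟨h1, -, h3⟩ := incons_eq_zero_iff.1 hm
  have hgap : ∀ j a, D.gap m j a = 0 := fun j a => sub_eq_zero.2 (h3 j a)
  constructor
  · have hl : D.lottery m = D.base m := by
      funext a
      simp [lottery, hgap, hm]
    refine Prod.ext (Subtype.ext ?_) rfl
    change (toLot (D.lottery m) : A → ℝ) = _
    rw [hl, coe_toLot base_mem]
    rfl
  · intro i
    change D.transfer i m - D.tax ρ i m = 0
    have := h1 (D.next.symm i)
    rw [Equiv.apply_symm_apply] at this
    simp [transfer, tax, hgap, hm, this]

end Design

lemma exists_perm_forall_ne (hI : 2 ≤ I) : ∃ s : Equiv.Perm (Fin I), ∀ i, s i ≠ i := by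
  obtain ⟨n, rfl⟩ := Nat.exists_eq_add_of_le' hI
  exact ⟨finRotate (n + 2), fun i => by rw [finRotate_apply]; simp⟩

/-- Under Maskin monotonicity, the social choice function depends only on the centered types. -/
lemma MaskinMonotoneP.eq_of_center_eq [Fintype A] {w : Fin I → Θ → A → ℝ} {f : Θ → OutcS A I}
    (hf : MaskinMonotoneP w f) {θ θ' : Θ} (h : ∀ k, center (w k θ) = center (w k θ')) :
    f θ = f θ' := by
  by_contra hne
  obtain ⟨i, x, h1, h2⟩ := hf θ θ' hne
  have e1 := sum_sub_mul_sub_center x.1 (f θ).1 (w i θ)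
  have e2 := sum_sub_mul_sub_center x.1 (f θ).1 (w i θ')
  rw [h] at e1
  simp only [uP, sub_mul, mul_sub, Finset.sum_sub_distrib] at h1 h2 e1 e2
  linarith

/-- **Theorem 4 (second part)**: in a compact and continuous setting, every
Maskin-monotonic SCF is implementable in mixed-strategy Nash equilibria by a mechanism
with compact message spaces, a continuous outcome function and continuous transfer
rules. -/
theorem implementable_by_compact_continuous_mechanism
    [TopologicalSpace Θ] [PolishSpace Θ] [CompactSpace Θ] [Fintype A] [Nonempty A]
    (hI : 2 ≤ I)
    (w : Fin I → Θ → A → ℝ) (hw : ∀ i θ a, w i θ a ∈ Set.Icc (0:ℝ) 1)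
    (hwCont : ∀ i a, Continuous fun θ => w i θ a)
    (f : Θ → OutcS A I) (hfCont : Continuous f)
    (T : ℝ) (hT : ∀ θ i, |(f θ).2 i| ≤ T)
    (hf : MaskinMonotoneP w f) :
    ∃ 𝓜 : MechT (OutcS A I) I,
      (∀ i, CompactSpace (𝓜.M i)) ∧
      Continuous 𝓜.g ∧
      (∀ i, Continuous (𝓜.τ i)) ∧
      ImplementsT w 𝓜 f := by
  obtain ⟨s, hs⟩ := exists_perm_forall_ne hI
  let φ : Θ → Fin I → A → ℝ := fun θ k => center (w k θ)
  have hφ : Continuous φ := continuous_pi fun k =>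
    continuous_center.comp (continuous_pi fun a => hwCont k a)
  obtain ⟨F, hF, hFφ⟩ := exists_continuous_factorization hφ hfCont fun θ θ' h =>
    hf.eq_of_center_eq fun k => congrFun h k
  obtain ⟨ε, hε⟩ := Design.exists_small ⟨s, F, Set.range φ, 0⟩ hF
  let D : Design A I := ⟨s, F, Set.range φ, ε⟩
  have hpen := fun i => exists_penalty (B := Cube A) (K := (Fin I → Msg A) × Θ)
    (h := fun b k => D.gross w i k.2 (Function.update k.1 i (Design.announce (k.1 i) b)))
    ((Design.continuous_gross (D := D) hF hwCont i).comp
      (f := fun x : Cube A × ((Fin I → Msg A) × Θ) =>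
        (Function.update x.2.1 i (Design.announce (x.2.1 i) x.1), x.2.2))
      (((continuous_fst.comp continuous_snd).update i
        (by unfold Design.announce; fun_prop)).prodMk (by fun_prop)))
  choose ρ hρ hρ0 hρle using hpen
  have hD : D.Admissible ρ w := ⟨hε, hs, fun i θ a => hw i θ a, hρ0,
    fun i θ m b b' => hρle i b b' (m, θ)⟩
  have hg : Continuous (D.mechanism ρ).g := Design.continuous_outcome (D := D) hF
  have hτ : ∀ i, Continuous ((D.mechanism ρ).τ i) := fun i =>
    (Design.continuous_transfer (D := D) hF i).sub (Design.continuous_tax hρ i)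
  have hcomp : ∀ i, CompactSpace ((D.mechanism ρ).M i) := fun i =>
    inferInstanceAs (CompactSpace (Msg A))
  have hsc : ∀ i, SecondCountableTopology ((D.mechanism ρ).M i) := fun i =>
    inferInstanceAs (SecondCountableTopology (Msg A))
  refine ⟨D.mechanism ρ, hcomp, hg, hτ, fun θ => ⟨⟨fun k => (hD.type k θ, hD.type k θ,
    hD.type (D.next.symm k) θ, (D.F fun k => center (w k θ)).1), fun i x => ?_⟩, fun m hm => ?_⟩⟩
  · rw [Design.payT_mechanism]
    exact hD.payoff_update_truthful_le ⟨θ, rfl⟩ i x rfl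
  · obtain ⟨σ, hσ, hmσ⟩ := hm
    have hpay : ∀ i, Continuous (payT w (D.mechanism ρ) θ i) := fun i =>
      ((continuous_uP hwCont i).comp (hg.prodMk continuous_const)).add (hτ i)
    have hS : Design.Stable (M := Msg A) (D.payoff ρ w θ)
        (fun j => mSupport (α := (D.mechanism ρ).M j) (σ j)) := by
      rw [← Design.payT_mechanism]
      exact fun i n hn x hx => hσ.deviation_le hpay i hn x hx
    have h0 := hD.incons_eq_zero hS ⟨θ, rfl⟩ hmσ
    obtain ⟨h1, h2⟩ := Design.mechanism_of_incons_eq_zero D ρ h0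
    exact ⟨h1.trans (hD.F_state_eq hS hf rfl (isCompact_range hφ).isClosed hFφ hmσ), h2⟩

end
end

section
/- For each agent i ∈ 𝓘 there exists a continuous function y_i: Θ_i → X such that: (1) for all types θ_i, θ_i' ∈ Θ_i with θ_i ≠ θ_i', u_i(y_i(θ_i),θ_i) > u_i(y_i(θ_i'),θ_i); and (2) for each agent j ∈ 𝓘, each type θ_j' ∈ Θ_j, and every x ∈ f(Θ), u_i(y_j(θ_j'),θ_i) < u_i(x,θ_i). -/
/-!
STATEMENT 13 (Lemma 5, continuous dictator lotteries): For each agent i there exists a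
continuous function y_i : Θ_i → X such that (1) for all distinct types θ_i ≠ θ_i',
u_i(y_i(θ_i),θ_i) > u_i(y_i(θ_i'),θ_i); and (2) for each agent j, each type θ_j' ∈ Θ_j,
and every x ∈ f(Θ), u_i(y_j(θ_j'),θ_i) < u_i(x,θ_i).
-/

open scoped BigOperators Classical

noncomputable section

variable {A Θ : Type} {I : ℕ}

/-- Agent `i`'s quasilinear utility at an outcome, given the utility vector `t : A → ℝ`
of his type: `u_i((ℓ,(t_j)), θ_i) = ℓ · v̄_i(θ_i) + t_i`. -/
def uVec [Fintype A] (i : Fin I) (x : OutcS A I) (t : A → ℝ) : ℝ :=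
  (∑ a, (x.1 : A → ℝ) a * t a) + x.2 i

/-- The set `Δ(A)` of lotteries, identified with outcomes carrying zero transfers. -/
def lotOutcomes (A : Type) [Fintype A] (I : ℕ) : Set (OutcS A I) :=
  Set.range fun ℓ : Lot A => ((ℓ, fun _ => 0) : OutcS A I)

/-- The vector `v` minus its mean, in Euclidean space. -/
def centered [Fintype A] (v : A → ℝ) : EuclideanSpace ℝ A :=
  WithLp.toLp 2 fun a => v a - (∑ b, v b) / Fintype.card A

lemma continuous_centered [Fintype A] : Continuous (centered : (A → ℝ) → EuclideanSpace ℝ A) := by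
  unfold centered
  fun_prop

lemma sum_centered [Fintype A] [Nonempty A] (v : A → ℝ) : ∑ a, centered v a = 0 := by
  have hn : (Fintype.card A : ℝ) ≠ 0 := by exact_mod_cast Fintype.card_ne_zero
  simp only [centered, Finset.sum_sub_distrib, Finset.sum_const, Finset.card_univ, nsmul_eq_mul]
  field_simp
  ring

lemma centered_ne_zero [Fintype A] {v : A → ℝ} (hv : ∃ a b : A, v a ≠ v b) :
    centered v ≠ 0 := by
  rintro h
  obtain ⟨a, b, hab⟩ := hv
  have ha : centered v a = 0 := by rw [h]; rfl
  have hb : centered v b = 0 := by rw [h]; rfl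
  simp only [centered] at ha hb
  exact hab (by linarith)

/-- The uniform lottery perturbed in the direction of the centered utility vector. -/
def tiltedLot [Fintype A] [Nonempty A] (v : A → ℝ) : Lot A :=
  ⟨fun a => (1 + ‖centered v‖⁻¹ * centered v a) / Fintype.card A, by
    have hn : (Fintype.card A : ℝ) ≠ 0 := by exact_mod_cast Fintype.card_ne_zero
    refine ⟨fun a => div_nonneg ?_ (Nat.cast_nonneg _), ?_⟩
    · have h₁ : |centered v a| ≤ ‖centered v‖ := PiLp.norm_apply_le (centered v) a
      have h₂ : |‖centered v‖⁻¹ * centered v a| ≤ 1 := by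
        rw [abs_mul, abs_inv, abs_norm, mul_comm]
        exact mul_inv_le_one_of_le₀ h₁ (norm_nonneg _)
      linarith [(abs_le.mp h₂).1]
    · rw [← Finset.sum_div, Finset.sum_add_distrib, ← Finset.mul_sum, sum_centered]
      simp [hn]⟩

lemma tiltedLot_apply [Fintype A] [Nonempty A] (v : A → ℝ) (a : A) :
    (tiltedLot v : A → ℝ) a = (1 + ‖centered v‖⁻¹ * centered v a) / Fintype.card A := rfl

lemma sum_tiltedLot_mul [Fintype A] [Nonempty A] (v w : A → ℝ) :
    ∑ a, (tiltedLot v : A → ℝ) a * w a =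
      (∑ a, w a + ‖centered v‖⁻¹ * inner ℝ (centered w) (centered v)) / Fintype.card A := by
  set m := (∑ b, w b) / Fintype.card A with hm
  have hw : ∀ a, w a = centered w a + m := fun a => by simp [centered, hm]
  have h : inner ℝ (centered w) (centered v) = ∑ a, centered v a * w a := by
    calc inner ℝ (centered w) (centered v) = ∑ a, centered v a * centered w a := by
          simp [PiLp.inner_apply]
      _ = ∑ a, centered v a * centered w a + (∑ a, centered v a) * m := by
          rw [sum_centered, zero_mul, add_zero]
      _ = ∑ a, centered v a * w a := by
          rw [Finset.sum_mul, ← Finset.sum_add_distrib]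
          exact Finset.sum_congr rfl fun a _ => by rw [hw a]; ring
  rw [h, Finset.mul_sum, ← Finset.sum_add_distrib, Finset.sum_div]
  exact Finset.sum_congr rfl fun a _ => by rw [tiltedLot_apply]; ring

lemma sum_tiltedLot_mul_lt [Fintype A] [Nonempty A] {v w : A → ℝ}
    (hv : ∃ a b : A, v a ≠ v b) (hw : ∃ a b : A, w a ≠ w b)
    (hvw : ¬ ∃ α β : ℝ, 0 < α ∧ ∀ a, v a = α * w a + β) :
    ∑ a, (tiltedLot v : A → ℝ) a * w a < ∑ a, (tiltedLot w : A → ℝ) a * w a := by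
  have hv₀ : 0 < ‖centered v‖ := norm_pos_iff.mpr (centered_ne_zero hv)
  have hw₀ : 0 < ‖centered w‖ := norm_pos_iff.mpr (centered_ne_zero hw)
  have hlt : inner ℝ (centered w) (centered v) < ‖centered w‖ * ‖centered v‖ := by
    rw [inner_lt_norm_mul_iff_real]
    intro h
    refine hvw ⟨‖centered v‖ / ‖centered w‖, (∑ b, v b) / Fintype.card A -
      ‖centered v‖ / ‖centered w‖ * ((∑ b, w b) / Fintype.card A), div_pos hv₀ hw₀, fun a => ?_⟩
    have ha : ‖centered v‖ * centered w a = ‖centered w‖ * centered v a :=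
      congrArg (fun x : EuclideanSpace ℝ A => x a) h
    have hva : centered v a = ‖centered v‖ / ‖centered w‖ * centered w a := by
      field_simp
      linarith
    have e₁ : centered v a = v a - (∑ b, v b) / Fintype.card A := rfl
    have e₂ : centered w a = w a - (∑ b, w b) / Fintype.card A := rfl
    rw [e₁, e₂] at hva
    linarith
  rw [sum_tiltedLot_mul, sum_tiltedLot_mul, real_inner_self_eq_norm_mul_norm,
    inv_mul_cancel_left₀ hw₀.ne']
  have hn : (0 : ℝ) < Fintype.card A := by exact_mod_cast Fintype.card_pos
  gcongr
  rw [inv_mul_lt_iff₀ hv₀, mul_comm]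
  exact hlt

lemma continuous_tiltedLot_comp [Fintype A] [Nonempty A] {T : Type*} [TopologicalSpace T]
    {v : T → A → ℝ} (hv : Continuous v) (hne : ∀ t, ∃ a b : A, v t a ≠ v t b) :
    Continuous fun t => tiltedLot (v t) := by
  have hc : Continuous fun t => centered (v t) := continuous_centered.comp hv
  refine Continuous.subtype_mk (continuous_pi fun a => ?_) _
  have ha : Continuous fun t => centered (v t) a := by fun_prop
  exact ((hc.norm.inv₀ fun t => norm_ne_zero_iff.mpr (centered_ne_zero (hne t))).mul ha
    |>.const_add 1).div_const _

/-- **Lemma 5 (continuous dictator lotteries)**. -/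
theorem exists_continuous_dictator_lotteries
    [Fintype A] [Nonempty A] {I : ℕ}
    (Ti : Fin I → Type) [∀ i, MetricSpace (Ti i)]
    (vb : ∀ i, Ti i → A → ℝ)
    (hvbCont : ∀ i, Continuous (vb i))
    (hvbIcc : ∀ i t a, vb i t a ∈ Set.Icc (0:ℝ) 1)
    -- no type is indifferent over all alternatives
    (hNonconst : ∀ (i : Fin I) (t : Ti i), ∃ a b : A, vb i t a ≠ vb i t b)
    -- distinct types induce distinct preference orderings over Δ(A): neither is a
    -- positive affine transformation of the other
    (hDistinct : ∀ (i : Fin I) (t t' : Ti i), t ≠ t' →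
      ¬ ∃ α β : ℝ, 0 < α ∧ ∀ a, vb i t' a = α * vb i t a + β)
    (Θ : Type) (f : Θ → OutcS A I)
    (η : ℝ) (hη : 0 < η)
    -- η exceeds the supremum of absolute utility differences over f(Θ) ∪ Δ(A)
    (hηBig : ∀ (i : Fin I) (t : Ti i), ∀ x ∈ Set.range f ∪ lotOutcomes A I,
      ∀ x' ∈ Set.range f ∪ lotOutcomes A I, |uVec i x (vb i t) - uVec i x' (vb i t)| < η) :
    ∃ y : ∀ i, Ti i → OutcS A I,
      ∀ i : Fin I,
        Continuous (y i) ∧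
        (∀ t t' : Ti i, t ≠ t' → uVec i (y i t') (vb i t) < uVec i (y i t) (vb i t)) ∧
        (∀ (j : Fin I) (t' : Ti j) (t : Ti i), ∀ x ∈ Set.range f,
          uVec i (y j t') (vb i t) < uVec i x (vb i t)) := by
  refine ⟨fun i t => (tiltedLot (vb i t), fun _ => -η), fun i => ⟨?_, ?_, ?_⟩⟩
  · exact (continuous_tiltedLot_comp (hvbCont i) (hNonconst i)).prodMk continuous_const
  · intro t t' h
    exact add_lt_add_left (sum_tiltedLot_mul_lt (hNonconst i t') (hNonconst i t)
      (hDistinct i t t' h)) _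
  · intro j t' t x hx
    have h := hηBig i t (tiltedLot (vb j t'), fun _ => 0) (Or.inr ⟨_, rfl⟩) x (Or.inl hx)
    have h' := (abs_lt.mp h).2
    simp only [uVec] at h' ⊢
    linarith

end
end

section
/- If the SCF f: Θ → A satisfies ordinal almost monotonicity on Θ, then the induced SCF f*: Θ* → A is strictly Maskin-monotonic on Θ*: for all θ*, θ̃* ∈ Θ* with f*(θ*) ≠ f*(θ̃*), there exist an agent i and an allocation x ∈ X such that u_i(x,θ̃_i*) < u_i(f*(θ̃*),θ̃_i*) and u_i(x,θ_i*) > u_i(f*(θ̃*),θ_i*). -/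
/-!
STATEMENT 15 (Claim 11): If the SCF f : Θ → A satisfies ordinal almost monotonicity on Θ,
then the induced SCF f* : Θ* → A is strictly Maskin-monotonic on Θ*: for all θ*, θ̃* ∈ Θ*
with f*(θ*) ≠ f*(θ̃*), there exist an agent i and an allocation x ∈ X such that
u_i(x,θ̃_i*) < u_i(f*(θ̃*),θ̃_i*) and u_i(x,θ_i*) > u_i(f*(θ̃*),θ_i*).

Here Θ* = ⋃_{θ∈Θ} V^θ, where V^θ = ×_i V_i^θ and V_i^θ is the set of [0,1]-valued
cardinal representations of ⪰_i^θ. A generic element of V^θ is a profile of utility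
vectors (θ_i*)_i with θ_i* : A → ℝ, and f*(θ*) = f(θ) whenever θ* ∈ V^θ.
-/

open scoped BigOperators Classical

noncomputable section

variable {A Θ : Type} {I : ℕ}

/-- The degenerate lottery on a pure alternative. -/
def pureLot [Fintype A] (a : A) : Lot A :=
  ⟨fun a' => if a' = a then 1 else 0, by
    constructor
    · intro x; dsimp only; split <;> norm_num
    · simp⟩

/-- A pure alternative `a` identified with the outcome `(δ_a, 0, …, 0) ∈ X`. -/
def pureOutc [Fintype A] (a : A) : OutcS A I := (pureLot a, fun _ => 0)

/-- `v : A → [0,1]` is a cardinal representation of the single ordinal preference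
relation `r` over `A` (`r a a'` means `a ⪰ a'`). -/
def IsRep (r : A → A → Prop) (v : A → ℝ) : Prop :=
  (∀ a, v a ∈ Set.Icc (0:ℝ) 1) ∧ ∀ a a' : A, v a' ≤ v a ↔ r a a'

/-- Agent `i`'s utility at a cardinal state: `u_i((ℓ,(t_j)),θ_i*) = θ_i*(ℓ) + t_i`. -/
def uStar [Fintype A] (i : Fin I) (x : OutcS A I) (vi : A → ℝ) : ℝ :=
  (∑ a, (x.1 : A → ℝ) a * vi a) + x.2 i

/-- Ordinal almost monotonicity (Sanver 2006) of `f : Θ → A`. -/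
def OrdinalAlmostMonotone (R : Fin I → Θ → A → A → Prop) (f : Θ → A) : Prop :=
  ∀ θ θ' : Θ, f θ' ≠ f θ →
    ∃ i : Fin I,
      (∃ a : A, R i θ' (f θ') a ∧ (R i θ a (f θ') ∧ ¬ R i θ (f θ') a)) ∨
      (∃ a : A, (R i θ' (f θ') a ∧ ¬ R i θ' a (f θ')) ∧ R i θ a (f θ'))

@[simp]
theorem uStar_pureLot [Fintype A] (i : Fin I) (a : A) (t : Fin I → ℝ) (w : A → ℝ) :
    uStar i (pureLot a, t) w = w a + t i := by
  change (∑ a', (if a' = a then 1 else 0) * w a') + t i = w a + t i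
  simp

/-- If the utility loss of moving from `b` to `a` is smaller under `w` than under `w'`, then a
transfer paid on top of `a` reverses the preference with respect to `b` strictly. -/
theorem exists_strict_reversal [Fintype A] (i : Fin I) {a b : A} {w w' : A → ℝ}
    (h : w b - w a < w' b - w' a) :
    ∃ x : OutcS A I,
      uStar i x w' < uStar i (pureOutc b : OutcS A I) w' ∧
      uStar i (pureOutc b : OutcS A I) w < uStar i x w := by
  obtain ⟨c, hc, hc'⟩ := exists_between h
  refine ⟨(pureLot a, fun _ => c), ?_, ?_⟩ <;> simp only [pureOutc, uStar_pureLot] <;> linarith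

/-- **Claim 11**: ordinal almost monotonicity of `f` on `Θ` implies strict Maskin
monotonicity of the induced SCF `f*` on `Θ*`. An element of `Θ*` lying in `V^θ` is a
profile `v : Fin I → A → ℝ` with `IsRep (R i θ) (v i)` for every agent `i`, and
`f*` assigns to it the outcome `f θ`. -/
theorem induced_scf_strictly_maskin_monotone
    [Fintype Θ] [Fintype A] [Nonempty A] (hI : 2 ≤ I)
    (R : Fin I → Θ → A → A → Prop)
    (hTotal : ∀ i θ a b, R i θ a b ∨ R i θ b a)
    (hTrans : ∀ i θ a b c, R i θ a b → R i θ b c → R i θ a c)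
    (hNoRedundancy : ∀ θ θ' : Θ, θ ≠ θ' → ∃ i, R i θ ≠ R i θ')
    (f : Θ → A) (hf : OrdinalAlmostMonotone R f) :
    ∀ (θ θ' : Θ) (v v' : Fin I → A → ℝ),
      (∀ i, IsRep (R i θ) (v i)) → (∀ i, IsRep (R i θ') (v' i)) →
      f θ' ≠ f θ →
      ∃ (i : Fin I) (x : OutcS A I),
        uStar i x (v' i) < uStar i (pureOutc (f θ') : OutcS A I) (v' i) ∧
        uStar i (pureOutc (f θ') : OutcS A I) (v i) < uStar i x (v i) := by
  intro θ θ' v v' hv hv' hne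
  obtain ⟨i, ⟨a, hweak, -, hstrict⟩ | ⟨a, ⟨-, hstrict⟩, hweak⟩⟩ := hf θ θ' hne
  · rw [← (hv' i).2] at hweak
    rw [← (hv i).2, not_le] at hstrict
    exact ⟨i, exists_strict_reversal i (a := a) (by linarith)⟩
  · rw [← (hv i).2] at hweak
    rw [← (hv' i).2, not_le] at hstrict
    exact ⟨i, exists_strict_reversal i (a := a) (by linarith)⟩

end
end

section
/- Suppose L(a*,⪰) ⊆ L(a*,⪰̃) and SL(a*,⪰) ⊆ SL(a*,⪰̃). Then for every cardinal representation v of ⪰ there exists a cardinal representation ṽ of ⪰̃ such that ṽ(a) ≤ v(a) for all a ∈ A and ṽ(a*) = v(a*). -/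
/-!
STATEMENT 19 (Claim C of Mezzetti–Renou 2012): Suppose L(a*,⪰) ⊆ L(a*,⪰̃) and
SL(a*,⪰) ⊆ SL(a*,⪰̃). Then for every cardinal representation v of ⪰ there exists a
cardinal representation ṽ of ⪰̃ such that ṽ(a) ≤ v(a) for all a ∈ A and ṽ(a*) = v(a*).
-/

noncomputable section

variable {A : Type}

/-- `v` is a cardinal representation of the preference relation `R` over `A`
(`R a b` means `a ⪰ b`). -/
def IsCardinalRep (R : A → A → Prop) (v : A → ℝ) : Prop :=
  ∀ a b : A, v b ≤ v a ↔ R a b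

/-- A total preorder on a finite type is represented by the sizes of its weak
lower-contour sets. -/
theorem isCardinalRep_ncard_lowerContour [Finite A] {R : A → A → Prop}
    (total : ∀ a b, R a b ∨ R b a) (trans : ∀ a b c, R a b → R b c → R a c) :
    IsCardinalRep R fun a => ({c | R a c}.ncard : ℝ) := by
  intro a b
  simp only [Nat.cast_le]
  constructor
  · intro h
    by_contra hab
    have hba : R b a := (total a b).resolve_left hab
    have hbb : R b b := (total b b).elim id id
    have hss : {c | R a c} ⊂ {c | R b c} :=
      ⟨fun c hc => trans b a c hba hc, fun hsub => hab (hsub hbb)⟩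
    exact absurd (Set.ncard_lt_ncard hss (Set.toFinite _)) (not_lt.mpr h)
  · intro h
    exact Set.ncard_le_ncard (fun c hc => trans a b c h hc) (Set.toFinite _)

/-- Finitely many positive reals admit a small positive slope `δ` with `δ * x i ≤ y i`. -/
theorem exists_pos_forall_mul_le {ι : Type*} [Finite ι] (x y : ι → ℝ) :
    ∃ δ : ℝ, 0 < δ ∧ ∀ i, 0 < y i → δ * x i ≤ y i := by
  have h : ∀ᶠ δ : ℝ in nhdsWithin 0 (Set.Ioi 0), ∀ i, 0 < y i → δ * x i ≤ y i := by
    refine Filter.eventually_all.mpr fun i => ?_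
    by_cases hi : 0 < y i
    · have ht : Filter.Tendsto (fun δ : ℝ => δ * x i) (nhds 0) (nhds 0) := by
        simpa using (continuous_id.mul continuous_const).tendsto (0 : ℝ) (f := fun δ => δ * x i)
      filter_upwards [(ht.mono_left nhdsWithin_le_nhds).eventually_lt_const hi] with δ hδ _
      exact hδ.le
    · exact Filter.Eventually.of_forall fun _ h => absurd h hi
  obtain ⟨δ, hδ, hpos⟩ := (h.and self_mem_nhdsWithin).exists
  exact ⟨δ, hpos, hδ⟩

/-- **Claim C**: if the weak and strict lower-contour sets at `a*` under `⪰` are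
contained in those under `⪰̃`, then every cardinal representation `v` of `⪰` admits a
cardinal representation `ṽ` of `⪰̃` with `ṽ ≤ v` pointwise and `ṽ(a*) = v(a*)`. -/
theorem exists_dominated_cardinal_rep
    [Fintype A]
    (R R' : A → A → Prop)
    (hRtotal : ∀ a b, R a b ∨ R b a)
    (hRtrans : ∀ a b c, R a b → R b c → R a c)
    (hR'total : ∀ a b, R' a b ∨ R' b a)
    (hR'trans : ∀ a b c, R' a b → R' b c → R' a c)
    (astar : A)
    (hL : {a | R astar a} ⊆ {a | R' astar a})
    (hSL : {a | R astar a ∧ ¬ R a astar} ⊆ {a | R' astar a ∧ ¬ R' a astar})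
    (v : A → ℝ) (hv : IsCardinalRep R v) :
    ∃ v' : A → ℝ, IsCardinalRep R' v' ∧ (∀ a, v' a ≤ v a) ∧ v' astar = v astar := by
  set r : A → ℝ := fun a => ({c | R' a c}.ncard : ℝ) with hr
  have hrep : IsCardinalRep R' r := isCardinalRep_ncard_lowerContour hR'total hR'trans
  have hgap : ∀ a, r a < r astar → r a - r astar ≤ -1 := by
    intro a h
    have h' : {c | R' a c}.ncard + 1 ≤ {c | R' astar c}.ncard := by
      simpa [hr, Nat.succ_le_iff] using h
    have h'' : ({c | R' a c}.ncard : ℝ) + 1 ≤ {c | R' astar c}.ncard := by exact_mod_cast h'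
    simp only [hr]
    linarith
  obtain ⟨δ, hδ, hδle⟩ :=
    exists_pos_forall_mul_le (fun a => r a - r astar) (fun a => v a - v astar)
  obtain ⟨M, hM⟩ := Finite.exists_le fun a => v astar - v a
  have hM0 : 0 ≤ M := by simpa using hM astar
  have hK : 0 < M + 1 := by linarith
  have hf : StrictMono fun x : ℝ => min (δ * x) ((M + 1) * x) := fun x y hxy =>
    min_lt_min (mul_lt_mul_of_pos_left hxy hδ) (mul_lt_mul_of_pos_left hxy hK)
  refine ⟨fun a => v astar + min (δ * (r a - r astar)) ((M + 1) * (r a - r astar)),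
    fun a b => ?_, fun a => ?_, by simp⟩
  · rw [← hrep a b, add_le_add_iff_left]
    exact hf.le_iff_le.trans (sub_le_sub_iff_right _)
  · rcases lt_trichotomy (r a) (r astar) with h | h | h
    · have hmin := min_le_right (δ * (r a - r astar)) ((M + 1) * (r a - r astar))
      have := mul_le_mul_of_nonneg_left (hgap a h) hK.le
      linarith [hM a]
    · have hva : v astar ≤ v a := by
        by_contra hlt
        have hS : R astar a ∧ ¬ R a astar :=
          ⟨(hv astar a).mp (not_le.mp hlt).le, fun hR => hlt ((hv a astar).mpr hR)⟩
        exact (hSL hS).2 ((hrep a astar).mp h.ge)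
      simpa [h] using hva
    · have hva : v astar < v a := by
        by_contra hle
        have hR : R astar a := (hv astar a).mp (not_lt.mp hle)
        exact absurd ((hrep astar a).mpr (hL hR)) (not_le.mpr h)
      have hmin := min_le_left (δ * (r a - r astar)) ((M + 1) * (r a - r astar))
      linarith [hδle a (sub_pos.mpr hva)]

end
end
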